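/- Let X = {x ∈ ℝ^n : g_i(x) = 0 (i ∈ E1X), g_i(x) ≥ 0 (i ∈ E2X)} with g = (g_1,...,g_{l1}), suppose there is a matrix polynomial G_1(x) with G_1(x)G(x) = I_{l1} for all x, and define λ(x,y) := G_1(x)_{:,1:n} ∇_x F(x,y). Fix y* ∈ ℝ^m and let φ_{y*} be the tuple of polynomials in x consisting of the entries of ∇_x F(x,y*) − Σ_{i} λ_i(x,y*) ∇g_i(x), together with g_i (i ∈ E1X) and λ_i(x,y*)·g_i (i ∈ E2X); let ψ_{y*} := (g_i, λ_i(x,y*))_{i ∈ E2X}, and set d_1 := ⌈max(deg φ_{y*}, deg ψ_{y*})/2⌉. Assume the problem min_{x ∈ X} F(x,y*) has a minimizer, one of the following holds: IQ(g_eq, g_in) is archimedean, or φ_{y*}(x) = 0 has finitely many real solutions, or IQ(φ_{y*}, ψ_{y*}) is archimedean; and each minimizer of min_{x ∈ X} F(x,y*) is an isolated real solution of φ_{y*}(x) = 0. Then for all k big enough, the order-k moment relaxation min { R_z(F(·,y*)) : z_0 = 1, M_k(z) ⪰ 0, L_{φ_{y*}}^{(k)}(z) = 0, L_{ψ_{y*}}^{(k)}(z)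 ⪰ 0 } over truncated multi-sequences z of degree 2k in n variables attains a minimizer, and every minimizer z* satisfies: there exists t with d_1 ≤ t ≤ k such that rank M_t(z*) = rank M_{t−d_1}(z*). -/

import Mathlib

open MvPolynomial

noncomputable section

/-- Index set for rows/columns of moment and localizing matrices:
(exponent vectors of) monomials in the variables `σ` of degree at most `t`. -/
abbrev MomIdx (σ : Type) [Fintype σ] [DecidableEq σ] (t : ℕ) : Type :=
  {v : σ → Fin (t + 1) // ∑ i, (v i : ℕ) ≤ t}

/-- The exponent vector of a moment-matrix index. -/
def MomIdx.exp {σ : Type} [Fintype σ] [DecidableEq σ] {t : ℕ} (v : MomIdx σ t) : σ →₀ ℕ :=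
  Finsupp.equivFunOnFinite.symm fun i => (v.1 i : ℕ)

/-- The Riesz functional of a (truncated) multi-sequence `w`, acting on a polynomial:
`R_w (Σ f_α ξ^α) = Σ f_α w_α`. -/
def riesz {σ : Type} (w : (σ →₀ ℕ) → ℝ) (f : MvPolynomial σ ℝ) : ℝ :=
  ∑ α ∈ f.support, f.coeff α * w α

/-- The order-`k` localizing matrix `L_q^{(k)}(w)` of the polynomial `q`, generated by
`w`: rows and columns are indexed by monomials of degree `≤ k − ⌈deg(q)/2⌉`, and the
`(α, β)` entry is `R_w(q · ξ^α · ξ^β)`. -/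
def locMat {σ : Type} [Fintype σ] [DecidableEq σ] (k : ℕ) (q : MvPolynomial σ ℝ)
    (w : (σ →₀ ℕ) → ℝ) :
    Matrix (MomIdx σ (k - (q.totalDegree + 1) / 2)) (MomIdx σ (k - (q.totalDegree + 1) / 2)) ℝ :=
  Matrix.of fun a b => riesz w (q * monomial (a.exp + b.exp) 1)

/-- The order-`t` moment matrix `M_t(w)` generated by `w`. -/
def momMat {σ : Type} [Fintype σ] [DecidableEq σ] (t : ℕ) (w : (σ →₀ ℕ) → ℝ) :
    Matrix (MomIdx σ t) (MomIdx σ t) ℝ :=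
  Matrix.of fun a b => w (a.exp + b.exp)

/-- Feasibility for the order-`k` Lasserre moment relaxation with equality
constraints `φ` and inequality constraints `ψ`:
`w₀ = 1`, `M_k(w) ⪰ 0`, `L_φ^{(k)}(w) = 0` and `L_ψ^{(k)}(w) ⪰ 0`. -/
def RelaxFeasible {σ : Type} [Fintype σ] [DecidableEq σ] {ι κ : Type*} (k : ℕ)
    (φ : ι → MvPolynomial σ ℝ) (ψ : κ → MvPolynomial σ ℝ) (w : (σ →₀ ℕ) → ℝ) : Prop :=
  w 0 = 1 ∧ (momMat k w).PosSemidef ∧ (∀ i, locMat k (φ i) w = 0) ∧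
    ∀ j, (locMat k (ψ j) w).PosSemidef

/-- A sum of squares of polynomials. -/
def IsSOS {σ : Type} (p : MvPolynomial σ ℝ) : Prop :=
  ∃ (t : ℕ) (s : Fin t → MvPolynomial σ ℝ), p = ∑ i, s i ^ 2


/-- Membership in `IQ(φ,ψ) = Ideal(φ) + Qmod(ψ)`. -/
def InIQ {σ : Type} {ι κ : Type*} [Fintype ι] [Fintype κ]
    (φ : ι → MvPolynomial σ ℝ) (ψ : κ → MvPolynomial σ ℝ) (f : MvPolynomial σ ℝ) : Prop :=
  ∃ (p : ι → MvPolynomial σ ℝ) (σ0 : MvPolynomial σ ℝ) (σs : κ → MvPolynomial σ ℝ),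
    IsSOS σ0 ∧ (∀ j, IsSOS (σs j)) ∧ f = ∑ i, φ i * p i + σ0 + ∑ j, ψ j * σs j

/-- `IQ(φ,ψ)` is archimedean: it contains some `σ` whose nonnegativity set is compact. -/
def IsArchimedean {σ : Type} [Fintype σ] {ι κ : Type*} [Fintype ι] [Fintype κ]
    (φ : ι → MvPolynomial σ ℝ) (ψ : κ → MvPolynomial σ ℝ) : Prop :=
  ∃ σ0 : MvPolynomial σ ℝ, InIQ φ ψ σ0 ∧ IsCompact {z : σ → ℝ | 0 ≤ eval z σ0}

/-- The matrix `G(x)` associated with a tuple `g` of constraining polynomials: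
its `i`-th column is `(∇g_i(x); g_i(x)·e_i)`. -/
def Gmat {n l : ℕ} (g : Fin l → MvPolynomial (Fin n) ℝ) (x : Fin n → ℝ) :
    Matrix (Fin n ⊕ Fin l) (Fin l) ℝ :=
  Matrix.of fun r c =>
    match r with
    | Sum.inl i => eval x (pderiv i (g c))
    | Sum.inr i => if i = c then eval x (g c) else 0

/-- The semialgebraic set `X = {x : gᵢ(x) = 0 (i ∈ E1X), gᵢ(x) ≥ 0 (i ∈ E2X)}`. -/
def SemiSet {n l : ℕ} (E1 E2 : Finset (Fin l)) (g : Fin l → MvPolynomial (Fin n) ℝ) :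
    Set (Fin n → ℝ) :=
  {x | (∀ i ∈ E1, eval x (g i) = 0) ∧ ∀ i ∈ E2, 0 ≤ eval x (g i)}

/-- The polynomial `F(x, y*)`, as a polynomial in `x` only. -/
def Fsub {n m : ℕ} (F : MvPolynomial (Fin n ⊕ Fin m) ℝ) (ystar : Fin m → ℝ) :
    MvPolynomial (Fin n) ℝ :=
  aeval (Sum.elim (fun i => (X i : MvPolynomial (Fin n) ℝ)) fun j => C (ystar j)) F

/-- The Lagrange polynomials `λᵢ(x, y*) = G₁(x)_{i,1:n} ∇ₓ F(x, y*)`, as polynomials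
in `x`, for a polynomial `fy = F(·, y*)`. -/
def lamSub {n l1 : ℕ} (G1 : Matrix (Fin l1) (Fin n ⊕ Fin l1) (MvPolynomial (Fin n) ℝ))
    (fy : MvPolynomial (Fin n) ℝ) (i : Fin l1) : MvPolynomial (Fin n) ℝ :=
  ∑ j : Fin n, G1 i (Sum.inl j) * pderiv j fy

/-- The tuple `φ_{y*}` of equality constraining polynomials (4.10):
the entries of `∇ₓF(x,y*) − Σᵢ λᵢ(x,y*) ∇gᵢ(x)`, together with `gᵢ (i ∈ E1X)` and
`λᵢ(x,y*)·gᵢ (i ∈ E2X)`. -/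
def phiLow {n l1 : ℕ} (E1X E2X : Finset (Fin l1)) (g : Fin l1 → MvPolynomial (Fin n) ℝ)
    (G1 : Matrix (Fin l1) (Fin n ⊕ Fin l1) (MvPolynomial (Fin n) ℝ))
    (fy : MvPolynomial (Fin n) ℝ) : Fin n ⊕ (↥E1X ⊕ ↥E2X) → MvPolynomial (Fin n) ℝ
  | Sum.inl j => pderiv j fy - ∑ i, lamSub G1 fy i * pderiv j (g i)
  | Sum.inr (Sum.inl i) => g i.1
  | Sum.inr (Sum.inr i) => lamSub G1 fy i.1 * g i.1

/-- The tuple `ψ_{y*}` of inequality constraining polynomials (4.11):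
`(gᵢ, λᵢ(x,y*))` for `i ∈ E2X`. -/
def psiLow {n l1 : ℕ} (E2X : Finset (Fin l1)) (g : Fin l1 → MvPolynomial (Fin n) ℝ)
    (G1 : Matrix (Fin l1) (Fin n ⊕ Fin l1) (MvPolynomial (Fin n) ℝ))
    (fy : MvPolynomial (Fin n) ℝ) : ↥E2X ⊕ ↥E2X → MvPolynomial (Fin n) ℝ
  | Sum.inl i => g i.1
  | Sum.inr i => lamSub G1 fy i.1

/-- `d₁ = ⌈max(deg φ_{y*}, deg ψ_{y*})/2⌉`. -/
def dLow {n l1 : ℕ} (E1X E2X : Finset (Fin l1)) (g : Fin l1 → MvPolynomial (Fin n) ℝ)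
    (G1 : Matrix (Fin l1) (Fin n ⊕ Fin l1) (MvPolynomial (Fin n) ℝ))
    (fy : MvPolynomial (Fin n) ℝ) : ℕ :=
  (((Finset.univ.sup fun idx => (phiLow E1X E2X g G1 fy idx).totalDegree) ⊔
    (Finset.univ.sup fun idx => (psiLow E2X g G1 fy idx).totalDegree)) + 1) / 2

/-- The intermediate value property for polynomials over an ordered field. -/
def PolyIVT (R : Type) [Field R] [LinearOrder R] : Prop :=
  ∀ (p : Polynomial R) (a b : R), a ≤ b → p.eval a ≤ 0 → 0 ≤ p.eval b →
    ∃ c, a ≤ c ∧ c ≤ b ∧ p.eval c = 0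

set_option linter.unusedSectionVars false

section IVT

variable {R : Type} [Field R] [LinearOrder R] [IsStrictOrderedRing R]

theorem PolyIVT.exists_root (hR : PolyIVT R) (p : Polynomial R) {a b : R} (hab : a ≤ b)
    (h : p.eval a * p.eval b ≤ 0) : ∃ c, a ≤ c ∧ c ≤ b ∧ p.eval c = 0 := by
  rcases le_total (p.eval a) 0 with ha | ha
  · rcases le_total 0 (p.eval b) with hb | hb
    · exact hR p a b hab ha hb
    · rcases mul_eq_zero.1 (le_antisymm h (mul_nonneg_of_nonpos_of_nonpos ha hb)) with h0 | h0
      · exact ⟨a, le_rfl, hab, h0⟩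
      · exact ⟨b, hab, le_rfl, h0⟩
  · rcases le_total (p.eval b) 0 with hb | hb
    · obtain ⟨c, h1, h2, h3⟩ := hR (-p) a b hab (by simpa using ha) (by simpa using hb)
      exact ⟨c, h1, h2, by simpa using h3⟩
    · rcases mul_eq_zero.1 (le_antisymm h (mul_nonneg ha hb)) with h0 | h0
      · exact ⟨a, le_rfl, hab, h0⟩
      · exact ⟨b, hab, le_rfl, h0⟩

theorem PolyIVT.sign_eq_of_le (hR : PolyIVT R) (p : Polynomial R) {a b : R} (hab : a ≤ b)
    (h : ∀ c, a ≤ c → c ≤ b → p.eval c ≠ 0) :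
    SignType.sign (p.eval a) = SignType.sign (p.eval b) := by
  by_contra hne
  have : p.eval a * p.eval b ≤ 0 := by
    by_contra! hpos
    rcases pos_and_pos_or_neg_and_neg_of_mul_pos hpos with ⟨h1, h2⟩ | ⟨h1, h2⟩
    · simp [sign_pos h1, sign_pos h2] at hne
    · simp [sign_neg h1, sign_neg h2] at hne
  obtain ⟨c, h1, h2, h3⟩ := hR.exists_root p hab this
  exact h c h1 h2 h3

theorem PolyIVT.sign_eq (hR : PolyIVT R) (p : Polynomial R) {a b : R}
    (h : ∀ c, min a b ≤ c → c ≤ max a b → p.eval c ≠ 0) :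
    SignType.sign (p.eval a) = SignType.sign (p.eval b) := by
  rcases le_total a b with hab | hab
  · exact hR.sign_eq_of_le p hab (by simpa [hab] using h)
  · exact (hR.sign_eq_of_le p hab (by simpa [hab] using h)).symm

/-- Rolle's theorem for polynomials over an ordered field with the intermediate value property. -/
theorem PolyIVT.rolle (hR : PolyIVT R) (p : Polynomial R) {x y : R} (hxy : x < y)
    (hx : p.eval x = 0) (hy : p.eval y = 0) :
    ∃ c, x < c ∧ c < y ∧ p.derivative.eval c = 0 := by
  by_cases hp : p = 0
  · obtain ⟨c, h1, h2⟩ := exists_between hxy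
    exact ⟨c, h1, h2, by simp [hp]⟩
  -- pass to the first root after `x`
  let Z := p.roots.toFinset.filter (fun z => x < z)
  have hZ : Z.Nonempty := ⟨y, by simp [Z, hp, hy, hxy]⟩
  obtain ⟨hz1, hz2⟩ : p.eval (Z.min' hZ) = 0 ∧ x < Z.min' hZ := by
    have := Z.min'_mem hZ
    simpa [Z, hp] using this
  have hzy : Z.min' hZ ≤ y := Z.min'_le y (by simp [Z, hp, hy, hxy])
  have hmin : ∀ c, x < c → c < Z.min' hZ → p.eval c ≠ 0 := by
    intro c hc1 hc2 hc
    exact absurd (Z.min'_le c (by simp [Z, hp, hc, hc1])) (not_le.2 hc2)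
  generalize Z.min' hZ = z at *
  obtain ⟨q, hq1, hq2⟩ := Polynomial.exists_eq_pow_rootMultiplicity_mul_and_not_dvd p hp x
  have hm : p.rootMultiplicity x ≠ 0 := by
    have := (Polynomial.rootMultiplicity_pos hp).2 hx; omega
  obtain ⟨m, hm'⟩ := Nat.exists_eq_succ_of_ne_zero hm
  have hqx : q.eval x ≠ 0 := fun h => hq2 (Polynomial.dvd_iff_isRoot.2 h)
  have hq0 : q ≠ 0 := by rintro rfl; simp at hqx
  have hqz : q.eval z = 0 := by
    rw [hq1] at hz1
    have : z - x ≠ 0 := by linarith [sub_pos.2 hz2] |> fun h : z - x > 0 => h.ne'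
    simpa [this] using hz1
  obtain ⟨r, hr1, hr2⟩ := Polynomial.exists_eq_pow_rootMultiplicity_mul_and_not_dvd q hq0 z
  have hn : q.rootMultiplicity z ≠ 0 := by
    have := (Polynomial.rootMultiplicity_pos hq0).2 hqz; omega
  obtain ⟨n, hn'⟩ := Nat.exists_eq_succ_of_ne_zero hn
  have hrz : r.eval z ≠ 0 := fun h => hr2 (Polynomial.dvd_iff_isRoot.2 h)
  rw [hm'] at hq1
  rw [hn'] at hr1
  have hpr : p = (Polynomial.X - Polynomial.C x) ^ (m + 1) *
      ((Polynomial.X - Polynomial.C z) ^ (n + 1) * r) := by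
    rw [← hr1, ← hq1]
  have hrx : r.eval x ≠ 0 := by
    intro h; apply hqx; rw [hr1]; simp [h]
  have hsr : SignType.sign (r.eval x) = SignType.sign (r.eval z) := by
    apply hR.sign_eq_of_le r hz2.le
    intro c h1 h2 hc
    rcases h1.eq_or_lt with rfl | h1
    · exact hrx hc
    rcases h2.eq_or_lt with rfl | h2
    · exact hrz hc
    exact hmin c h1 h2 (by rw [hpr]; simp [hc])
  let b : Polynomial R :=
    (((m + 1 : ℕ) : Polynomial R) * (Polynomial.X - Polynomial.C z) +
      ((n + 1 : ℕ) : Polynomial R) * (Polynomial.X - Polynomial.C x)) * r +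
      (Polynomial.X - Polynomial.C x) * (Polynomial.X - Polynomial.C z) * r.derivative
  have hder : p.derivative = (Polynomial.X - Polynomial.C x) ^ m *
      (Polynomial.X - Polynomial.C z) ^ n * b := by
    rw [hpr, Polynomial.derivative_mul, Polynomial.derivative_mul,
      Polynomial.derivative_X_sub_C_pow, Polynomial.derivative_X_sub_C_pow]
    simp only [b, Nat.add_sub_cancel, Nat.cast_add, Nat.cast_one, map_add, map_one, map_natCast,
      pow_succ]
    ring
  have hbx : b.eval x = (m + 1) * (x - z) * r.eval x := by simp [b]
  have hbz : b.eval z = (n + 1) * (z - x) * r.eval z := by simp [b]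
  have hrr : 0 < r.eval x * r.eval z := by
    rcases lt_or_gt_of_ne hrx with h | h
    · rw [sign_neg h, eq_comm, sign_eq_neg_one_iff] at hsr
      exact mul_pos_of_neg_of_neg h hsr
    · rw [sign_pos h, eq_comm, sign_eq_one_iff] at hsr
      exact mul_pos h hsr
  have hzx : 0 < z - x := sub_pos.2 hz2
  have hm0 : (0 : R) < m + 1 := by positivity
  have hn0 : (0 : R) < n + 1 := by positivity
  have hprod : b.eval x * b.eval z < 0 := by
    rw [hbx, hbz]
    have : (↑m + 1) * (x - z) * Polynomial.eval x r * ((↑n + 1) * (z - x) * Polynomial.eval z r)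
        = -(((m + 1 : R) * (n + 1)) * (z - x) ^ 2 * (r.eval x * r.eval z)) := by ring
    rw [this]
    have : 0 < ((m + 1 : R) * (n + 1)) * (z - x) ^ 2 * (r.eval x * r.eval z) := by positivity
    linarith
  obtain ⟨c, hc1, hc2, hc3⟩ := hR.exists_root b hz2.le hprod.le
  refine ⟨c, lt_of_le_of_ne hc1 ?_, lt_of_lt_of_le (lt_of_le_of_ne hc2 ?_) hzy, ?_⟩
  · rintro rfl; simp [hc3] at hprod
  · rintro rfl; simp [hc3] at hprod
  · rw [hder]; simp [hc3]

/-- Signs of a polynomial around a root which is isolated by the roots of the derivative. -/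
theorem PolyIVT.sign_eval_eq (hR : PolyIVT R) (p : Polynomial R) {a b x : R} (hax : a < x)
    (hxb : x < b) (hx : p.eval x = 0) (hd : ∀ c, a < c → c < b → p.derivative.eval c ≠ 0) :
    p.eval b ≠ 0 ∧ ∀ u, a ≤ u → u ≤ b →
      SignType.sign (p.eval u) = SignType.sign (u - x) * SignType.sign (p.eval b) := by
  have huniq : ∀ u, a ≤ u → u ≤ b → p.eval u = 0 → u = x := by
    intro u hu1 hu2 hu
    rcases lt_trichotomy u x with h | h | h
    · obtain ⟨c, h1, h2, h3⟩ := hR.rolle p h hu hx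
      exact absurd h3 (hd c (by linarith) (by linarith))
    · exact h
    · obtain ⟨c, h1, h2, h3⟩ := hR.rolle p h hx hu
      exact absurd h3 (hd c (by linarith) (by linarith))
  obtain ⟨s, hs⟩ := Polynomial.dvd_iff_isRoot.2 (show p.IsRoot x from hx)
  have hsx : s.eval x ≠ 0 := by
    have := hd x hax hxb
    rw [hs] at this
    simpa [Polynomial.derivative_mul] using this
  have hsne : ∀ u, a ≤ u → u ≤ b → s.eval u ≠ 0 := by
    intro u hu1 hu2 hu
    have := huniq u hu1 hu2 (by rw [hs]; simp [hu])
    rw [this] at hu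
    exact hsx hu
  have hpe : ∀ u, p.eval u = (u - x) * s.eval u := fun u => by rw [hs]; simp
  have hss : ∀ u, a ≤ u → u ≤ b → SignType.sign (s.eval u) = SignType.sign (s.eval b) := by
    intro u hu1 hu2
    exact hR.sign_eq_of_le s hu2 fun c h1 h2 => hsne c (hu1.trans h1) h2
  refine ⟨?_, fun u hu1 hu2 => ?_⟩
  · rw [hpe]
    exact mul_ne_zero (sub_pos.2 hxb).ne' (hsne b (by linarith) le_rfl)
  · rw [hpe, hpe b, sign_mul, sign_mul, hss u hu1 hu2, sign_pos (sub_pos.2 hxb), one_mul]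

end IVT

section Transfer

/-- Corresponding components of the elements of `T` have the same sign. -/
def SignGood {R S : Type} [Field R] [LinearOrder R] [Field S] [LinearOrder S]
    (T : Subring (R × S)) : Prop :=
  ∀ z ∈ T, SignType.sign z.1 = SignType.sign z.2

/-- `T` is the graph of an order isomorphism between a subfield of `R` and a subfield of `S`. -/
def FieldGood {R S : Type} [Field R] [LinearOrder R] [Field S] [LinearOrder S]
    (T : Subring (R × S)) : Prop :=
  SignGood T ∧ ∀ z ∈ T, z.1 ≠ 0 → z⁻¹ ∈ T

variable {R S : Type} [Field R] [LinearOrder R] [IsStrictOrderedRing R]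
  [Field S] [LinearOrder S] [IsStrictOrderedRing S]

theorem sign_sub_comm (x y : R) : SignType.sign (x - y) = -SignType.sign (y - x) := by
  rw [← Left.sign_neg, neg_sub]

theorem SignGood.eq_zero_iff {T : Subring (R × S)} (hT : SignGood T) {z : R × S} (hz : z ∈ T) :
    z.1 = 0 ↔ z.2 = 0 := by
  rw [← sign_eq_zero_iff, hT z hz, sign_eq_zero_iff]

theorem SignGood.sign_sub {T : Subring (R × S)} (hT : SignGood T) {z w : R × S} (hz : z ∈ T)
    (hw : w ∈ T) : SignType.sign (z.1 - w.1) = SignType.sign (z.2 - w.2) :=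
  hT (z - w) (T.sub_mem hz hw)

theorem SignGood.lt_iff {T : Subring (R × S)} (hT : SignGood T) {z w : R × S} (hz : z ∈ T)
    (hw : w ∈ T) : z.1 < w.1 ↔ z.2 < w.2 := by
  rw [← sub_neg, ← sign_eq_neg_one_iff, hT.sign_sub hz hw, sign_eq_neg_one_iff, sub_neg]

theorem SignGood.le_iff {T : Subring (R × S)} (hT : SignGood T) {z w : R × S} (hz : z ∈ T)
    (hw : w ∈ T) : z.1 ≤ w.1 ↔ z.2 ≤ w.2 := by
  rw [← not_lt, hT.lt_iff hw hz, not_lt]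

theorem SignGood.exists_fieldGood {T : Subring (R × S)} (hT : SignGood T) :
    ∃ T' ≥ T, FieldGood T' := by
  let T' : Subring (R × S) :=
    { carrier := {z | ∃ w ∈ T, w.1 ≠ 0 ∧ w * z ∈ T}
      mul_mem' := by
        rintro a b ⟨w, hw, hw0, ha⟩ ⟨v, hv, hv0, hb⟩
        refine ⟨w * v, T.mul_mem hw hv, mul_ne_zero hw0 hv0, ?_⟩
        rw [mul_mul_mul_comm]
        exact T.mul_mem ha hb
      one_mem' := ⟨1, T.one_mem, one_ne_zero, by simp⟩
      add_mem' := by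
        rintro a b ⟨w, hw, hw0, ha⟩ ⟨v, hv, hv0, hb⟩
        refine ⟨w * v, T.mul_mem hw hv, mul_ne_zero hw0 hv0, ?_⟩
        have : w * v * (a + b) = v * (w * a) + w * (v * b) := by ring
        rw [this]
        exact T.add_mem (T.mul_mem hv ha) (T.mul_mem hw hb)
      zero_mem' := ⟨1, T.one_mem, one_ne_zero, by simp⟩
      neg_mem' := by
        rintro a ⟨w, hw, hw0, ha⟩
        exact ⟨w, hw, hw0, by simpa using T.neg_mem ha⟩ }
  have hgood : SignGood T' := by
    rintro z ⟨w, hw, hw0, hz⟩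
    have h1 := hT _ hz
    have h2 := hT _ hw
    rw [Prod.fst_mul, Prod.snd_mul, sign_mul, sign_mul, h2] at h1
    have h3 : SignType.sign w.2 ≠ 0 := by rwa [← h2, Ne, sign_eq_zero_iff]
    revert h1 h3
    generalize SignType.sign w.2 = a
    generalize SignType.sign z.1 = b
    generalize SignType.sign z.2 = c
    revert a b c
    decide
  refine ⟨T', fun z hz => ⟨1, T.one_mem, one_ne_zero, by simpa using hz⟩, hgood, ?_⟩
  rintro z ⟨w, hw, hw0, hz⟩ hz0
  refine ⟨w * z, hz, mul_ne_zero hw0 hz0, ?_⟩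
  have hz2 : z.2 ≠ 0 := fun h => hz0 ((hgood.eq_zero_iff ⟨w, hw, hw0, hz⟩).2 h)
  have : w * z * z⁻¹ = w := by
    ext <;> simp [hz0, hz2]
  rwa [this]

theorem polyEval_pair (p : Polynomial (R × S)) (x : R) (y : S) :
    p.eval (x, y) = ((p.map (RingHom.fst R S)).eval x, (p.map (RingHom.snd R S)).eval y) := by
  ext
  · exact (Polynomial.eval_map_apply (f := RingHom.fst R S) (p := p) (x := (x, y))).symm
  · exact (Polynomial.eval_map_apply (f := RingHom.snd R S) (p := p) (x := (x, y))).symm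

theorem eval_mem_of_coeff_mem {T : Subring (R × S)} {p : Polynomial (R × S)}
    (hp : ∀ n, p.coeff n ∈ T) {z : R × S} (hz : z ∈ T) : p.eval z ∈ T := by
  rw [Polynomial.eval_eq_sum_range]
  exact T.sum_mem fun i _ => T.mul_mem (hp i) (T.pow_mem hz i)

theorem SignGood.sign_eval {T : Subring (R × S)} (hT : SignGood T) {p : Polynomial (R × S)}
    (hp : ∀ n, p.coeff n ∈ T) {x : R} {y : S} (hz : (x, y) ∈ T) :
    SignType.sign ((p.map (RingHom.fst R S)).eval x) =
      SignType.sign ((p.map (RingHom.snd R S)).eval y) := by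
  have := hT _ (eval_mem_of_coeff_mem hp hz)
  rwa [polyEval_pair] at this

theorem SignGood.map_eq_zero_iff {T : Subring (R × S)} (hT : SignGood T)
    {p : Polynomial (R × S)} (hp : ∀ n, p.coeff n ∈ T) :
    p.map (RingHom.fst R S) = 0 ↔ p.map (RingHom.snd R S) = 0 := by
  simp only [Polynomial.ext_iff, Polynomial.coeff_map, Polynomial.coeff_zero]
  exact forall_congr' fun n => hT.eq_zero_iff (hp n)

theorem coeff_derivative_mem {T : Subring (R × S)} {p : Polynomial (R × S)}
    (hp : ∀ n, p.coeff n ∈ T) (n : ℕ) : p.derivative.coeff n ∈ T := by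
  rw [Polynomial.coeff_derivative]
  exact T.mul_mem (hp _) (T.add_mem (natCast_mem T n) T.one_mem)

theorem SignGood.exists_adjoin {T : Subring (R × S)} (x : R) (y : S)
    (h : ∀ p : Polynomial (R × S), (∀ n, p.coeff n ∈ T) →
      SignType.sign ((p.map (RingHom.fst R S)).eval x) =
        SignType.sign ((p.map (RingHom.snd R S)).eval y)) :
    ∃ T' ≥ T, FieldGood T' ∧ (x, y) ∈ T' := by
  let T0 : Subring (R × S) := (Polynomial.eval₂RingHom T.subtype (x, y)).range
  have hT0 : SignGood T0 := by
    rintro z ⟨q, rfl⟩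
    have := h (q.map T.subtype) (fun n => by simp [Polynomial.coeff_map])
    have h2 := polyEval_pair (q.map T.subtype) x y
    rw [Polynomial.eval_map] at h2
    rw [Polynomial.coe_eval₂RingHom, h2]
    exact this
  obtain ⟨T', hT', hg⟩ := hT0.exists_fieldGood
  refine ⟨T', fun z hz => hT' ⟨Polynomial.C ⟨z, hz⟩, by simp⟩, hg, hT' ⟨Polynomial.X, by simp⟩⟩

/-- A point of `T` in prescribed position with respect to finitely many points of `T`. -/
theorem FieldGood.exists_pick {T : Subring (R × S)} (hT : FieldGood T) (U : Finset R)
    (hU : ∀ u ∈ U, ∃ v, (u, v) ∈ T) (x : R) (hx : x ∉ U) :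
    ∃ c ∈ T, ∀ u ∈ U, SignType.sign (c.1 - u) = SignType.sign (x - u) := by
  let Lo := U.filter (· < x)
  let Hi := U.filter (x < ·)
  have key : ∀ c : R × S, c ∈ T → (∀ u ∈ Lo, u < c.1) → (∀ u ∈ Hi, c.1 < u) →
      ∃ c ∈ T, ∀ u ∈ U, SignType.sign (c.1 - u) = SignType.sign (x - u) := by
    intro c hc h1 h2
    refine ⟨c, hc, fun u hu => ?_⟩
    rcases lt_trichotomy u x with h | h | h
    · rw [sign_pos (sub_pos.2 h), sign_pos (sub_pos.2 (h1 u (by simp [Lo, hu, h])))]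
    · exact absurd (h ▸ hu) hx
    · rw [sign_neg (sub_neg.2 h), sign_neg (sub_neg.2 (h2 u (by simp [Hi, hu, h])))]
  by_cases hLo : Lo.Nonempty
  · obtain ⟨v, hv⟩ := hU _ (Finset.mem_filter.1 (Lo.max'_mem hLo)).1
    have hLx := (Finset.mem_filter.1 (Lo.max'_mem hLo)).2
    by_cases hHi : Hi.Nonempty
    · obtain ⟨v', hv'⟩ := hU _ (Finset.mem_filter.1 (Hi.min'_mem hHi)).1
      have hHx := (Finset.mem_filter.1 (Hi.min'_mem hHi)).2
      have h2 : (2 : R × S) ∈ T := by exact_mod_cast natCast_mem T 2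
      have h2' := hT.2 _ h2 (by simp)
      refine key _ (T.mul_mem h2' (T.add_mem hv hv')) (fun u hu => ?_) (fun u hu => ?_)
      · have := Lo.le_max' u hu
        simp only [Prod.fst_mul, Prod.fst_inv, Prod.fst_ofNat, Prod.fst_add]
        rw [inv_mul_eq_div, lt_div_iff₀ two_pos]
        linarith
      · have := Hi.min'_le u hu
        simp only [Prod.fst_mul, Prod.fst_inv, Prod.fst_ofNat, Prod.fst_add]
        rw [inv_mul_eq_div, div_lt_iff₀ two_pos]
        linarith
    · refine key _ (T.add_mem hv T.one_mem) (fun u hu => ?_)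
        (fun u hu => absurd ⟨u, hu⟩ hHi)
      have := Lo.le_max' u hu
      simp only [Prod.fst_add, Prod.fst_one]
      linarith
  · by_cases hHi : Hi.Nonempty
    · obtain ⟨v', hv'⟩ := hU _ (Finset.mem_filter.1 (Hi.min'_mem hHi)).1
      refine key _ (T.sub_mem hv' T.one_mem) (fun u hu => absurd ⟨u, hu⟩ hLo) (fun u hu => ?_)
      have := Hi.min'_le u hu
      simp only [Prod.fst_sub, Prod.fst_one]
      linarith
    · exact key 0 T.zero_mem (fun u hu => absurd ⟨u, hu⟩ hLo) (fun u hu => absurd ⟨u, hu⟩ hHi)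

theorem ne_of_sign_eq_of_between {a b c : R} (h : SignType.sign (a - c) = SignType.sign (b - c))
    (hb : b ≠ c) : ¬ (min a b ≤ c ∧ c ≤ max a b) := by
  rintro ⟨h1, h2⟩
  rcases lt_or_gt_of_ne hb with h3 | h3
  · rw [sign_neg (sub_neg.2 h3), sign_eq_neg_one_iff, sub_neg] at h
    exact absurd h2 (not_le.2 (max_lt h h3))
  · rw [sign_pos (sub_pos.2 h3), sign_eq_one_iff, sub_pos] at h
    exact absurd h1 (not_le.2 (lt_min h h3))

theorem abs_root_lt {p : Polynomial R} {d : ℕ} (hd : p.natDegree ≤ d + 1)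
    (hu : p.coeff (d + 1) ≠ 0) {x : R} (hx : p.eval x = 0) :
    |x| < 1 + ∑ i ∈ Finset.range (d + 1), (1 + (p.coeff i * (p.coeff (d + 1))⁻¹) ^ 2) := by
  by_contra! hM
  have hnn : ∀ i ∈ Finset.range (d + 1),
      |p.coeff i * (p.coeff (d + 1))⁻¹| ≤ 1 + (p.coeff i * (p.coeff (d + 1))⁻¹) ^ 2 := by
    intro i _
    rw [← sq_abs]
    nlinarith [sq_nonneg (|p.coeff i * (p.coeff (d + 1))⁻¹| - 1),
      abs_nonneg (p.coeff i * (p.coeff (d + 1))⁻¹)]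
  have hx1 : 1 ≤ |x| := by
    refine le_trans ?_ hM
    have : 0 ≤ ∑ i ∈ Finset.range (d + 1), (1 + (p.coeff i * (p.coeff (d + 1))⁻¹) ^ 2) :=
      Finset.sum_nonneg fun i hi => (abs_nonneg _).trans (hnn i hi)
    linarith
  rw [Polynomial.eval_eq_sum_range' (Nat.lt_succ_of_le hd), Finset.sum_range_succ] at hx
  have h1 : x ^ (d + 1) = -∑ i ∈ Finset.range (d + 1),
      (p.coeff i * (p.coeff (d + 1))⁻¹) * x ^ i := by
    have h2 : p.coeff (d + 1) * x ^ (d + 1) = -∑ i ∈ Finset.range (d + 1), p.coeff i * x ^ i := by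
      linarith
    have h3 : x ^ (d + 1) = (p.coeff (d + 1))⁻¹ * (p.coeff (d + 1) * x ^ (d + 1)) := by
      field_simp
    rw [h3, h2, mul_neg, Finset.mul_sum]
    congr 1
    exact Finset.sum_congr rfl fun i _ => by ring
  have h2 : |x| ^ (d + 1) ≤
      (∑ i ∈ Finset.range (d + 1), |p.coeff i * (p.coeff (d + 1))⁻¹|) * |x| ^ d := by
    rw [← abs_pow, h1, abs_neg, Finset.sum_mul]
    refine (Finset.abs_sum_le_sum_abs _ _).trans (Finset.sum_le_sum fun i hi => ?_)
    rw [abs_mul, abs_pow]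
    exact mul_le_mul_of_nonneg_left
      (pow_le_pow_right₀ hx1 (Nat.lt_succ_iff.1 (Finset.mem_range.1 hi))) (abs_nonneg _)
  have hpos : 0 < |x| ^ d := pow_pos (by linarith) d
  rw [pow_succ, mul_comm] at h2
  have h3 := le_of_mul_le_mul_right h2 hpos
  have h4 := Finset.sum_le_sum hnn
  linarith

end Transfer

section RootExt

/-- Roots in `R` of polynomials of degree at most `d` over `T` have counterparts in `S`. -/
def RootExt (d : ℕ) (R S : Type) [Field R] [LinearOrder R] [Field S] [LinearOrder S] : Prop :=
  ∀ T : Subring (R × S), FieldGood T → ∀ p : Polynomial (R × S), (∀ n, p.coeff n ∈ T) →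
    p.natDegree ≤ d → p.map (RingHom.fst R S) ≠ 0 → ∀ x : R,
    (p.map (RingHom.fst R S)).eval x = 0 → ∃ T' ≥ T, FieldGood T' ∧ ∃ y, (x, y) ∈ T'

variable {R S : Type} [Field R] [LinearOrder R] [IsStrictOrderedRing R]
  [Field S] [LinearOrder S] [IsStrictOrderedRing S]

theorem FieldGood.comap_swap {T : Subring (R × S)} (hT : FieldGood T) :
    FieldGood (T.comap (RingEquiv.prodComm : S × R ≃+* R × S).toRingHom) := by
  refine ⟨fun z hz => (hT.1 _ hz).symm, fun z hz hz0 => ?_⟩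
  refine hT.2 _ hz fun h => hz0 ?_
  exact (hT.1.eq_zero_iff hz).1 h

theorem RootExt.exists_roots_fst {d : ℕ} (h : RootExt d R S) {T : Subring (R × S)}
    (hT : FieldGood T) {p : Polynomial (R × S)} (hp : ∀ n, p.coeff n ∈ T)
    (hd : p.natDegree ≤ d) (h0 : p.map (RingHom.fst R S) ≠ 0) :
    ∃ T' ≥ T, FieldGood T' ∧
      ∀ x, (p.map (RingHom.fst R S)).eval x = 0 → ∃ y, (x, y) ∈ T' := by
  have key : ∀ Z : Finset R, (∀ x ∈ Z, (p.map (RingHom.fst R S)).eval x = 0) →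
      ∃ T' ≥ T, FieldGood T' ∧ ∀ x ∈ Z, ∃ y, (x, y) ∈ T' := by
    intro Z
    induction Z using Finset.induction_on with
    | empty => exact fun _ => ⟨T, le_rfl, hT, by simp⟩
    | insert a Z _ ih =>
      intro hZ
      obtain ⟨T1, h1, hg1, hZ1⟩ := ih fun x hx => hZ x (Finset.mem_insert_of_mem hx)
      obtain ⟨T2, h2, hg2, y, hy⟩ := h T1 hg1 p (fun n => h1 (hp n)) hd h0 a
        (hZ a (Finset.mem_insert_self _ _))
      refine ⟨T2, h1.le.trans h2, hg2, fun x hx => ?_⟩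
      rcases Finset.mem_insert.1 hx with rfl | hx
      · exact ⟨y, hy⟩
      · obtain ⟨y, hy⟩ := hZ1 x hx
        exact ⟨y, h2 hy⟩
  obtain ⟨T', h1, h2, h3⟩ := key (p.map (RingHom.fst R S)).roots.toFinset
    (fun x hx => by simpa [h0] using hx)
  exact ⟨T', h1, h2, fun x hx => h3 x (by simpa [h0] using hx)⟩

theorem RootExt.exists_roots {d : ℕ} (h : RootExt d R S) (h' : RootExt d S R)
    {T : Subring (R × S)} (hT : FieldGood T) {p : Polynomial (R × S)}
    (hp : ∀ n, p.coeff n ∈ T) (hd : p.natDegree ≤ d) (h0 : p.map (RingHom.fst R S) ≠ 0) :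
    ∃ T' ≥ T, FieldGood T' ∧
      (∀ x, (p.map (RingHom.fst R S)).eval x = 0 → ∃ y, (x, y) ∈ T') ∧
      ∀ y, (p.map (RingHom.snd R S)).eval y = 0 → ∃ x, (x, y) ∈ T' := by
  obtain ⟨T1, h1, hg1, hx⟩ := h.exists_roots_fst hT hp hd h0
  let e : S × R ≃+* R × S := RingEquiv.prodComm
  let e' : R × S ≃+* S × R := RingEquiv.prodComm
  have hfst : (RingHom.fst S R).comp e'.toRingHom = RingHom.snd R S := rfl
  obtain ⟨T2, h2, hg2, hy⟩ := h'.exists_roots_fst (T := T1.comap e.toRingHom) hg1.comap_swap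
    (p := p.map e'.toRingHom)
    (fun n => by
      rw [Polynomial.coeff_map]
      exact h1 (hp n))
    ((Polynomial.natDegree_map_le).trans hd)
    (by
      rw [Polynomial.map_map, hfst]
      exact fun hh => h0 ((hT.1.map_eq_zero_iff hp).2 hh))
  rw [Polynomial.map_map, hfst] at hy
  refine ⟨T2.comap e'.toRingHom, fun z hz => h2 (show e'.toRingHom z ∈ T1.comap e.toRingHom from
    h1 hz), hg2.comap_swap, fun x hx0 => ?_, fun y hy0 => ?_⟩
  · obtain ⟨y, hxy⟩ := hx x hx0
    exact ⟨y, h2 (show (y, x) ∈ T1.comap e.toRingHom from hxy)⟩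
  · obtain ⟨x, hxy⟩ := hy y hy0
    exact ⟨x, hxy⟩

/-- Reduction of a polynomial over a subring modulo a polynomial whose top coefficient is
invertible in the subring. -/
theorem exists_reduction {A : Type} [CommRing A] {T : Subring A} {p : Polynomial A}
    (hp : ∀ n, p.coeff n ∈ T) {d : ℕ} (hd : p.natDegree ≤ d + 1) {v : A} (hv : v ∈ T)
    (huv : v * p.coeff (d + 1) = 1) {q : Polynomial A} (hq : ∀ n, q.coeff n ∈ T) :
    ∃ r s : Polynomial A, (∀ n, r.coeff n ∈ T) ∧ r.natDegree ≤ d ∧ q = r + p * s := by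
  nontriviality A
  have lift : ∀ f : Polynomial A, (∀ n, f.coeff n ∈ T) →
      ∃ F : Polynomial T, F.map T.subtype = f := by
    intro f hf
    have : f ∈ Polynomial.lifts T.subtype := by
      rw [Polynomial.lifts_iff_coeff_lifts]
      exact fun n => ⟨⟨_, hf n⟩, rfl⟩
    exact (Polynomial.mem_lifts f).1 this
  obtain ⟨P, hP⟩ := lift p hp
  obtain ⟨Q, hQ⟩ := lift q hq
  have hinj : Function.Injective T.subtype := Subtype.val_injective
  let m : Polynomial T := Polynomial.C ⟨v, hv⟩ * P
  have hPd : P.natDegree ≤ d + 1 := by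
    rw [← hP, Polynomial.natDegree_map_eq_of_injective hinj] at hd
    exact hd
  have hmd : m.natDegree ≤ d + 1 := (Polynomial.natDegree_C_mul_le _ _).trans hPd
  have hmc : m.coeff (d + 1) = 1 := by
    apply hinj
    rw [← hP, Polynomial.coeff_map] at huv
    simpa [m] using huv
  have hm : m.Monic := Polynomial.monic_of_natDegree_le_of_coeff_eq_one _ hmd hmc
  have hmdeg : m.natDegree = d + 1 :=
    le_antisymm hmd (Polynomial.le_natDegree_of_ne_zero (by rw [hmc]; exact one_ne_zero))
  refine ⟨(Q %ₘ m).map T.subtype, Polynomial.C v * (Q /ₘ m).map T.subtype,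
    fun n => by simp [Polynomial.coeff_map], ?_, ?_⟩
  · have := Polynomial.natDegree_modByMonic_lt Q hm (by
      intro h; rw [h] at hmdeg; simp at hmdeg)
    exact Polynomial.natDegree_map_le.trans (by omega)
  · rw [← hQ, ← hP]
    conv_lhs => rw [← Polynomial.modByMonic_add_div Q m]
    simp [m]
    ring

/-- If a root `x` of `p` and a root `y` of its counterpart cut `T` and its extensions in the same
way, and `p` has minimal degree, then `(x, y)` can be adjoined to `T`. -/
theorem exists_adjoin_of_cut {d : ℕ} (h : RootExt d R S) (h' : RootExt d S R)
    (hR : PolyIVT R) (hS : PolyIVT S) {T : Subring (R × S)} (hT : FieldGood T)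
    {p : Polynomial (R × S)} (hp : ∀ n, p.coeff n ∈ T) (hd : p.natDegree ≤ d + 1)
    (hu : (p.coeff (d + 1)).1 ≠ 0) {x : R} {y : S}
    (hx : (p.map (RingHom.fst R S)).eval x = 0) (hy : (p.map (RingHom.snd R S)).eval y = 0)
    (hcut : ∀ T' ≥ T, FieldGood T' → ∀ c ∈ T',
      SignType.sign (c.1 - x) = SignType.sign (c.2 - y)) :
    ∃ T' ≥ T, FieldGood T' ∧ (x, y) ∈ T' := by
  refine SignGood.exists_adjoin x y fun q hq => ?_
  have hu2 : (p.coeff (d + 1)).2 ≠ 0 := fun h0 => hu ((hT.1.eq_zero_iff (hp _)).2 h0)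
  obtain ⟨r, s, hr, hrd, hqr⟩ := exists_reduction hp hd (hT.2 _ (hp (d + 1)) hu)
    (by ext <;> simp [hu, hu2]) hq
  have e1 : (q.map (RingHom.fst R S)).eval x = (r.map (RingHom.fst R S)).eval x := by
    rw [hqr]; simp [hx]
  have e2 : (q.map (RingHom.snd R S)).eval y = (r.map (RingHom.snd R S)).eval y := by
    rw [hqr]; simp [hy]
  rw [e1, e2]
  by_cases hr0 : r.map (RingHom.fst R S) = 0
  · rw [hr0, (hT.1.map_eq_zero_iff hr).1 hr0]; simp
  obtain ⟨T', hTT', hg', hr1, hr2⟩ := h.exists_roots h' hT hr hrd hr0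
  have hr' : ∀ n, r.coeff n ∈ T' := fun n => hTT' (hr n)
  by_cases hrx : (r.map (RingHom.fst R S)).eval x = 0
  · obtain ⟨y', hy'⟩ := hr1 x hrx
    have := hcut T' hTT' hg' _ hy'
    rw [sub_self, sign_zero, eq_comm, sign_eq_zero_iff, sub_eq_zero] at this
    subst this
    exact hg'.1.sign_eval hr' hy'
  by_cases hry : (r.map (RingHom.snd R S)).eval y = 0
  · obtain ⟨x', hx'⟩ := hr2 y hry
    have := hcut T' hTT' hg' _ hx'
    rw [sub_self, sign_zero, sign_eq_zero_iff, sub_eq_zero] at this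
    subst this
    exact hg'.1.sign_eval hr' hx'
  obtain ⟨c, hc, hcU⟩ := hg'.exists_pick (r.map (RingHom.fst R S)).roots.toFinset
    (fun u hu => hr1 u (by simpa [hr0] using hu)) x (by simp [hr0, hrx])
  have hcr : ∀ u, (r.map (RingHom.fst R S)).eval u = 0 →
      SignType.sign (c.1 - u) = SignType.sign (x - u) := fun u hu => hcU u (by simpa [hr0] using hu)
  have s1 : SignType.sign ((r.map (RingHom.fst R S)).eval c.1) =
      SignType.sign ((r.map (RingHom.fst R S)).eval x) := by
    refine hR.sign_eq _ fun u h1 h2 hu => ?_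
    exact ne_of_sign_eq_of_between (hcr u hu) (by rintro rfl; exact hrx hu) ⟨h1, h2⟩
  have s2 : SignType.sign ((r.map (RingHom.snd R S)).eval c.2) =
      SignType.sign ((r.map (RingHom.snd R S)).eval y) := by
    refine hS.sign_eq _ fun v h1 h2 hv => ?_
    obtain ⟨u, huv⟩ := hr2 v hv
    have hu0 : (r.map (RingHom.fst R S)).eval u = 0 := by
      rw [← sign_eq_zero_iff, hg'.1.sign_eval hr' huv, hv, sign_zero]
    refine ne_of_sign_eq_of_between ?_ (by rintro rfl; exact hry hv) ⟨h1, h2⟩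
    rw [sign_sub_comm y, ← hcut T' hTT' hg' _ huv, ← sign_sub_comm, ← hcr u hu0]
    exact (hg'.1.sign_sub hc huv).symm
  rw [← s1, ← s2]
  exact hg'.1.sign_eval hr' hc

theorem RootExt.succ {d : ℕ} (h : RootExt d R S) (h' : RootExt d S R)
    (hR : PolyIVT R) (hS : PolyIVT S) : RootExt (d + 1) R S := by
  intro T hT p hp hd hp0 x hx
  by_cases hu : (p.coeff (d + 1)).1 = 0
  · refine h T hT p hp ?_ hp0 x hx
    have hu0 : p.coeff (d + 1) = 0 := Prod.ext hu ((hT.1.eq_zero_iff (hp _)).1 hu)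
    by_contra! hlt
    have hdeg : p.natDegree = d + 1 := by omega
    rw [← hdeg, Polynomial.coeff_natDegree, Polynomial.leadingCoeff_eq_zero] at hu0
    simp [hu0] at hp0
  have hp' := coeff_derivative_mem hp
  have hd' : p.derivative.natDegree ≤ d := by
    have := Polynomial.natDegree_derivative_le p
    omega
  have hp'0 : p.derivative.map (RingHom.fst R S) ≠ 0 := by
    intro h0
    have := congrArg (fun f => f.coeff d) h0
    simp only [Polynomial.coeff_map, Polynomial.coeff_derivative, Polynomial.coeff_zero, map_mul,
      RingHom.coe_fst] at this
    rcases mul_eq_zero.1 this with h1 | h1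
    · exact hu h1
    · have : ((d : R) + 1) = 0 := by simpa using h1
      exact absurd this (by positivity)
  obtain ⟨T1, hT1, hg1, hr1, hr2⟩ := h.exists_roots h' hT hp' hd' hp'0
  have hp1 : ∀ n, p.coeff n ∈ T1 := fun n => hT1 (hp n)
  have hp1' : ∀ n, p.derivative.coeff n ∈ T1 := fun n => hT1 (hp' n)
  by_cases hx' : (p.derivative.map (RingHom.fst R S)).eval x = 0
  · exact ⟨T1, hT1, hg1, hr1 x hx'⟩
  -- an element of `T1` bounding `x`
  let M : R × S := 1 + ∑ i ∈ Finset.range (d + 1),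
    (1 + (p.coeff i * (p.coeff (d + 1))⁻¹) ^ 2)
  have hM : M ∈ T1 := T1.add_mem T1.one_mem (T1.sum_mem fun i _ => T1.add_mem T1.one_mem
    (T1.pow_mem (T1.mul_mem (hp1 i) (hg1.2 _ (hp1 _) hu)) 2))
  have hxM : |x| < M.1 := by
    have := abs_root_lt (p := p.map (RingHom.fst R S)) (d := d)
      (Polynomial.natDegree_map_le.trans hd) (by simpa [Polynomial.coeff_map] using hu) hx
    simpa [M, Polynomial.coeff_map, Prod.fst_sum] using this
  rw [abs_lt] at hxM
  let Z : Finset R := insert M.1 (insert (-M.1)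
    (p.derivative.map (RingHom.fst R S)).roots.toFinset)
  have hZ : ∀ z ∈ Z, ∃ v, (z, v) ∈ T1 := by
    intro z hz
    simp only [Z, Finset.mem_insert] at hz
    rcases hz with rfl | rfl | hz
    · exact ⟨M.2, hM⟩
    · exact ⟨-M.2, T1.neg_mem hM⟩
    · exact hr1 z (by simpa [hp'0] using hz)
  have hLo : (Z.filter (· < x)).Nonempty := ⟨-M.1, by simp [Z, hxM.1]⟩
  have hHi : (Z.filter (x < ·)).Nonempty := ⟨M.1, by simp [Z, hxM.2]⟩
  obtain ⟨hz1, hz2⟩ := Finset.mem_filter.1 (Finset.max'_mem _ hLo)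
  obtain ⟨hw1, hw2⟩ := Finset.mem_filter.1 (Finset.min'_mem _ hHi)
  have hz3 : ∀ u ∈ Z, u < x → u ≤ (Z.filter (· < x)).max' hLo := fun u hu1 hu2 =>
    Finset.le_max' (Z.filter (· < x)) u (Finset.mem_filter.2 ⟨hu1, hu2⟩)
  have hw3 : ∀ u ∈ Z, x < u → (Z.filter (x < ·)).min' hHi ≤ u := fun u hu1 hu2 =>
    Finset.min'_le (Z.filter (x < ·)) u (Finset.mem_filter.2 ⟨hu1, hu2⟩)
  generalize (Z.filter (· < x)).max' hLo = z at hz1 hz2 hz3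
  generalize (Z.filter (x < ·)).min' hHi = w at hw1 hw2 hw3
  obtain ⟨z', hz'⟩ := hZ z hz1
  obtain ⟨w', hw'⟩ := hZ w hw1
  have hnr : ∀ c, z < c → c < w → (p.derivative.map (RingHom.fst R S)).eval c ≠ 0 := by
    intro c h1 h2 hc
    have hcZ : c ∈ Z := by simp [Z, hp'0, hc]
    rcases lt_trichotomy c x with h3 | h3 | h3
    · exact absurd (hz3 c hcZ h3) (not_le.2 h1)
    · exact hx' (h3 ▸ hc)
    · exact absurd (hw3 c hcZ h3) (not_le.2 h2)
  have hnr2 : ∀ c, z' < c → c < w' → (p.derivative.map (RingHom.snd R S)).eval c ≠ 0 := by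
    intro c h1 h2 hc
    obtain ⟨u, huc⟩ := hr2 c hc
    refine hnr u ((hg1.1.lt_iff hz' huc).2 h1) ((hg1.1.lt_iff huc hw').2 h2) ?_
    rw [← sign_eq_zero_iff, hg1.1.sign_eval hp1' huc, hc, sign_zero]
  obtain ⟨hw0, hsg⟩ := hR.sign_eval_eq (p.map (RingHom.fst R S)) hz2 hw2 hx
    (by rwa [Polynomial.derivative_map])
  have hzw : z' < w' := (hg1.1.lt_iff hz' hw').1 (hz2.trans hw2)
  have ez := hg1.1.sign_eval hp1 hz'
  have ew := hg1.1.sign_eval hp1 hw'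
  have hsz := hsg z le_rfl (hz2.trans hw2).le
  rw [sign_neg (sub_neg.2 hz2), ez, ew] at hsz
  have hw0' : (p.map (RingHom.snd R S)).eval w' ≠ 0 := by
    rwa [← sign_ne_zero, ← ew, sign_ne_zero]
  have hz0' : (p.map (RingHom.snd R S)).eval z' ≠ 0 := by
    rw [← sign_ne_zero] at hw0' ⊢
    rw [hsz]
    revert hw0'
    generalize SignType.sign ((p.map (RingHom.snd R S)).eval w') = s1
    revert s1
    decide
  have hprod : (p.map (RingHom.snd R S)).eval z' * (p.map (RingHom.snd R S)).eval w' ≤ 0 := by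
    rcases lt_or_gt_of_ne hw0' with h1 | h1
    · rw [sign_neg h1, neg_one_mul, neg_neg, sign_eq_one_iff] at hsz
      exact (mul_neg_of_pos_of_neg hsz h1).le
    · rw [sign_pos h1, mul_one, sign_eq_neg_one_iff] at hsz
      exact (mul_neg_of_neg_of_pos hsz h1).le
  obtain ⟨y, hy1, hy2, hy⟩ := hS.exists_root _ hzw.le hprod
  have hzy : z' < y := lt_of_le_of_ne hy1 (by rintro rfl; exact hz0' hy)
  have hyw : y < w' := lt_of_le_of_ne hy2 (by rintro rfl; exact hw0' hy)
  obtain ⟨-, hsg2⟩ := hS.sign_eval_eq (p.map (RingHom.snd R S)) hzy hyw hy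
    (by rwa [Polynomial.derivative_map])
  obtain ⟨T', hT', hg', hxy⟩ := exists_adjoin_of_cut h h' hR hS hg1 hp1 hd hu hx hy (by
    intro T2 hT2 hg2 c hc
    rcases lt_or_ge c.1 z with h1 | h1
    · have h2 := (hg2.1.lt_iff hc (hT2 hz')).1 h1
      rw [sign_neg (sub_neg.2 (h1.trans hz2)), sign_neg (sub_neg.2 (lt_trans h2 hzy))]
    rcases lt_or_ge w c.1 with h2 | h2
    · have h3 := (hg2.1.lt_iff (hT2 hw') hc).1 h2
      rw [sign_pos (sub_pos.2 (hw2.trans h2)), sign_pos (sub_pos.2 (lt_trans hyw h3))]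
    have a1 := hsg c.1 h1 h2
    have a2 := hsg2 c.2 ((hg2.1.le_iff (hT2 hz') hc).1 h1) ((hg2.1.le_iff hc (hT2 hw')).1 h2)
    have a3 := hg2.1.sign_eval (fun n => hT2 (hp1 n)) (x := c.1) (y := c.2) hc
    rw [a1, a2, ew] at a3
    have a4 := sign_ne_zero.2 hw0'
    revert a3 a4
    generalize SignType.sign ((p.map (RingHom.snd R S)).eval w') = s1
    generalize SignType.sign (c.1 - x) = s2
    generalize SignType.sign (c.2 - y) = s3
    revert s1 s2 s3
    decide)
  exact ⟨T', hT1.le.trans hT', hg', y, hxy⟩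

theorem RootExt.of_polyIVT (d : ℕ) (hR : PolyIVT R) (hS : PolyIVT S) :
    RootExt d R S ∧ RootExt d S R := by
  have zero : ∀ (R S : Type) [Field R] [LinearOrder R] [Field S] [LinearOrder S],
      RootExt 0 R S := by
    intro R S _ _ _ _ T hT p hp hd hp0 x hx
    rw [Polynomial.eq_C_of_natDegree_le_zero hd] at hx hp0
    simp only [Polynomial.map_C, Polynomial.eval_C] at hx hp0
    simp [hx] at hp0
  induction d with
  | zero => exact ⟨zero R S, zero S R⟩
  | succ d ih => exact ⟨ih.1.succ ih.2 hR hS, ih.2.succ ih.1 hS hR⟩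

/-- Finitely many sign conditions over `T` satisfied by `x` can be satisfied in `S`. -/
theorem FieldGood.exists_match {T : Subring (R × S)} (hT : FieldGood T) (hR : PolyIVT R)
    (hS : PolyIVT S) (x : R) (H : Finset (Polynomial (R × S)))
    (hH : ∀ p ∈ H, ∀ n, p.coeff n ∈ T) :
    ∃ y : S, ∀ p ∈ H, SignType.sign ((p.map (RingHom.fst R S)).eval x) =
      SignType.sign ((p.map (RingHom.snd R S)).eval y) := by
  by_cases hex : ∃ p ∈ H, p.map (RingHom.fst R S) ≠ 0 ∧ (p.map (RingHom.fst R S)).eval x = 0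
  · obtain ⟨p, hpH, hp0, hpx⟩ := hex
    obtain ⟨T', hT', hg', y, hy⟩ := (RootExt.of_polyIVT p.natDegree hR hS).1 T hT p (hH p hpH)
      le_rfl hp0 x hpx
    exact ⟨y, fun q hq => hg'.1.sign_eval (fun n => hT' (hH q hq n)) hy⟩
  push Not at hex
  have key : ∀ H' : Finset (Polynomial (R × S)), H' ⊆ H → ∃ T' ≥ T, FieldGood T' ∧
      ∀ p ∈ H', p.map (RingHom.fst R S) ≠ 0 →
        (∀ x, (p.map (RingHom.fst R S)).eval x = 0 → ∃ y, (x, y) ∈ T') ∧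
        ∀ y, (p.map (RingHom.snd R S)).eval y = 0 → ∃ x, (x, y) ∈ T' := by
    intro H'
    induction H' using Finset.induction_on with
    | empty => exact fun _ => ⟨T, le_rfl, hT, by simp⟩
    | insert p H' _ ih =>
      intro hs
      obtain ⟨T1, h1, hg1, hr1⟩ := ih fun q hq => hs (Finset.mem_insert_of_mem hq)
      have hpH := hs (Finset.mem_insert_self p H')
      by_cases hp0 : p.map (RingHom.fst R S) = 0
      · refine ⟨T1, h1, hg1, fun q hq hq0 => ?_⟩
        rcases Finset.mem_insert.1 hq with rfl | hq
        · exact absurd hp0 hq0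
        · exact hr1 q hq hq0
      obtain ⟨e1, e2⟩ := RootExt.of_polyIVT p.natDegree hR hS
      obtain ⟨T2, h2, hg2, hr2⟩ := e1.exists_roots e2 hg1 (fun n => h1 (hH p hpH n)) le_rfl hp0
      refine ⟨T2, h1.le.trans h2, hg2, fun q hq hq0 => ?_⟩
      rcases Finset.mem_insert.1 hq with rfl | hq
      · exact hr2
      · obtain ⟨a1, a2⟩ := hr1 q hq hq0
        exact ⟨fun x hx => (a1 x hx).imp fun y hy => h2 hy,
          fun y hy => (a2 y hy).imp fun x hx => h2 hx⟩
  obtain ⟨T', hT', hg', hr⟩ := key H subset_rfl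
  obtain ⟨c, hc, hcU⟩ := hg'.exists_pick
    ((H.filter fun p => p.map (RingHom.fst R S) ≠ 0).biUnion
      fun p => (p.map (RingHom.fst R S)).roots.toFinset)
    (by
      intro u hu
      simp only [Finset.mem_biUnion, Finset.mem_filter] at hu
      obtain ⟨p, ⟨hp, hp0⟩, hu⟩ := hu
      exact (hr p hp hp0).1 u (by simpa [hp0] using hu)) x
    (by
      simp only [Finset.mem_biUnion, Finset.mem_filter, not_exists, not_and]
      rintro p ⟨hp, hp0⟩ hu
      exact hex p hp hp0 (by simpa [hp0] using hu))
  refine ⟨c.2, fun p hp => ?_⟩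
  by_cases hp0 : p.map (RingHom.fst R S) = 0
  · rw [hp0, (hT.1.map_eq_zero_iff (hH p hp)).1 hp0]; simp
  rw [← hg'.1.sign_eval (fun n => hT' (hH p hp n)) (x := c.1) (y := c.2) hc, eq_comm]
  refine hR.sign_eq _ fun u h1 h2 hu => ?_
  refine ne_of_sign_eq_of_between (hcU u ?_) (by rintro rfl; exact hex p hp hp0 hu) ⟨h1, h2⟩
  simp only [Finset.mem_biUnion, Finset.mem_filter]
  exact ⟨p, ⟨hp, hp0⟩, by simpa [hp0] using hu⟩

end RootExt

section Ultrapower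

variable {I : Type} (U : Ultrafilter I) {S : Type} [Field S] [LinearOrder S]
  [IsStrictOrderedRing S]

/-- The projection onto an ultrapower. -/
def germHom : (I → S) →+* Filter.Germ (U : Filter I) S := Filter.Germ.coeRingHom (U : Filter I)

theorem germHom_surjective : Function.Surjective (germHom U (S := S)) := fun z => by
  induction z using Filter.Germ.inductionOn with
  | _ f => exact ⟨f, rfl⟩

theorem eventually_sign_eq (u : I → S) :
    ∀ᶠ i in (U : Filter I), SignType.sign (u i) = SignType.sign (germHom U u) := by
  rcases lt_trichotomy (germHom U u) 0 with h | h | h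
  · rw [sign_neg h]
    have : ∀ᶠ i in (U : Filter I), u i < 0 := Filter.Germ.coe_lt.1 h
    exact this.mono fun i hi => sign_neg hi
  · rw [h, sign_zero]
    have : ∀ᶠ i in (U : Filter I), u i = 0 := Filter.Germ.coe_eq.1 h
    exact this.mono fun i hi => by rw [hi, sign_zero]
  · rw [sign_pos h]
    have : ∀ᶠ i in (U : Filter I), 0 < u i := Filter.Germ.coe_lt.1 h
    exact this.mono fun i hi => sign_pos hi

theorem germHom_eval (P : Polynomial (I → S)) (u : I → S) :
    (P.map (germHom U)).eval (germHom U u) =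
      germHom U fun i => (P.map (Pi.evalRingHom _ i)).eval (u i) := by
  rw [Polynomial.eval_map_apply]
  congr 1
  funext i
  exact (Polynomial.eval_map_apply (f := Pi.evalRingHom (fun _ : I => S) i) (p := P)
    (x := u)).symm

theorem PolyIVT.germ (hS : PolyIVT S) : PolyIVT (Filter.Germ (U : Filter I) S) := by
  intro p a b hab ha hb
  obtain ⟨P, rfl⟩ := Polynomial.map_surjective _ (germHom_surjective U) p
  obtain ⟨a, rfl⟩ := germHom_surjective U a
  obtain ⟨b, rfl⟩ := germHom_surjective U b
  rw [germHom_eval] at ha hb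
  have h1 : ∀ᶠ i in (U : Filter I), a i ≤ b i := Filter.Germ.coe_le.1 hab
  have h2 : ∀ᶠ i in (U : Filter I), (P.map (Pi.evalRingHom _ i)).eval (a i) ≤ 0 :=
    Filter.Germ.coe_le.1 ha
  have h3 : ∀ᶠ i in (U : Filter I), 0 ≤ (P.map (Pi.evalRingHom _ i)).eval (b i) :=
    Filter.Germ.coe_le.1 hb
  have h4 : ∀ᶠ i in (U : Filter I), ∃ c, a i ≤ c ∧ c ≤ b i ∧
      (P.map (Pi.evalRingHom _ i)).eval c = 0 := by
    filter_upwards [h1, h2, h3] with i e1 e2 e3 using hS _ _ _ e1 e2 e3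
  classical
  let c : I → S := fun i => if h : ∃ c, a i ≤ c ∧ c ≤ b i ∧
      (P.map (Pi.evalRingHom _ i)).eval c = 0 then h.choose else 0
  have hc : ∀ᶠ i in (U : Filter I), a i ≤ c i ∧ c i ≤ b i ∧
      (P.map (Pi.evalRingHom _ i)).eval (c i) = 0 := by
    filter_upwards [h4] with i hi
    simp only [c, dif_pos hi]
    exact hi.choose_spec
  refine ⟨germHom U c, Filter.Germ.coe_le.2 (hc.mono fun i hi => hi.1),
    Filter.Germ.coe_le.2 (hc.mono fun i hi => hi.2.1), ?_⟩
  rw [germHom_eval]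
  exact Filter.Germ.coe_eq.2 (hc.mono fun i hi => hi.2.2)

end Ultrapower

theorem exists_match_one {A R S : Type} [CommRing A] [Field R] [LinearOrder R]
    [IsStrictOrderedRing R] [Field S] [LinearOrder S] [IsStrictOrderedRing S]
    (hR : PolyIVT R) (hS : PolyIVT S) (α : A →+* R) (β : A →+* S)
    (hαβ : ∀ a, SignType.sign (α a) = SignType.sign (β a)) (x : R)
    (H : Finset (Polynomial A)) :
    ∃ y : S, ∀ p ∈ H,
      SignType.sign (p.eval₂ α x) = SignType.sign (p.eval₂ β y) := by
  classical
  have hg : SignGood (α.prod β).range := by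
    rintro z ⟨a, rfl⟩
    exact hαβ a
  obtain ⟨T, hT, hTg⟩ := hg.exists_fieldGood
  obtain ⟨y, hy⟩ := hTg.exists_match hR hS x (H.image (Polynomial.map (α.prod β))) (by
    intro p hp n
    obtain ⟨q, -, rfl⟩ := Finset.mem_image.1 hp
    rw [Polynomial.coeff_map]
    exact hT ⟨_, rfl⟩)
  refine ⟨y, fun p hp => ?_⟩
  have := hy _ (Finset.mem_image_of_mem _ hp)
  rw [Polynomial.map_map, Polynomial.map_map, RingHom.fst_comp_prod, RingHom.snd_comp_prod,
    Polynomial.eval_map, Polynomial.eval_map] at this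
  exact this

/-- The Artin–Lang transfer principle: finitely many sign conditions which are satisfied in one
ordered field with the intermediate value property are satisfied in any other one. -/
theorem exists_match (n : ℕ) : ∀ (A R S : Type) [CommRing A] [Field R] [LinearOrder R]
    [IsStrictOrderedRing R] [Field S] [LinearOrder S] [IsStrictOrderedRing S]
    (_ : PolyIVT R) (_ : PolyIVT S) (α : A →+* R) (β : A →+* S)
    (_ : ∀ a, SignType.sign (α a) = SignType.sign (β a)) (a : Fin n → R)
    (H : Finset (MvPolynomial (Fin n) A)),
    ∃ b : Fin n → S, ∀ h ∈ H,
      SignType.sign (h.eval₂ α a) = SignType.sign (h.eval₂ β b) := by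
  induction n with
  | zero =>
    intro A R S _ _ _ _ _ _ _ _ _ α β hαβ a H
    refine ⟨Fin.elim0, fun h _ => ?_⟩
    rw [MvPolynomial.eq_C_of_isEmpty h, eval₂_C, eval₂_C, hαβ]
  | succ n ih =>
    intro A R S _ _ _ _ _ _ _ hR hS α β hαβ a H
    classical
    choose y hy using fun H' : Finset (Polynomial A) =>
      exists_match_one hR hS α β hαβ (a 0) H'
    let U : Ultrafilter (Finset (Polynomial A)) := Ultrafilter.of Filter.atTop
    have hU : (U : Filter (Finset (Polynomial A))) ≤ Filter.atTop := Ultrafilter.of_le _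
    let cst : S →+* (Finset (Polynomial A) → S) := Pi.constRingHom _ _
    let α' : Polynomial A →+* R := Polynomial.eval₂RingHom α (a 0)
    let β0 : Polynomial A →+* (Finset (Polynomial A) → S) :=
      Polynomial.eval₂RingHom (cst.comp β) y
    let β' : Polynomial A →+* Filter.Germ (U : Filter (Finset (Polynomial A))) S :=
      (germHom U).comp β0
    have hβ0 : ∀ p i, β0 p i = p.eval₂ β (y i) := by
      intro p i
      exact Polynomial.hom_eval₂ p (cst.comp β) (Pi.evalRingHom _ i) y
    have hsgn : ∀ p, SignType.sign (α' p) = SignType.sign (β' p) := by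
      intro p
      have h1 := eventually_sign_eq U (β0 p)
      have h2 : ∀ᶠ i in (U : Filter (Finset (Polynomial A))), p ∈ i :=
        hU ((Filter.eventually_ge_atTop {p}).mono fun i hi => by simpa using hi)
      obtain ⟨i, h3, h4⟩ := (h1.and h2).exists
      rw [hβ0, ← hy i p h4] at h3
      exact h3
    let e : MvPolynomial (Fin (n + 1)) A →+* MvPolynomial (Fin n) (Polynomial A) :=
      eval₂Hom (C.comp Polynomial.C) (Fin.cons (C Polynomial.X) X)
    obtain ⟨b', hb'⟩ := ih (Polynomial A) R _ hR (hS.germ U) α' β' hsgn (Fin.tail a) (H.image e)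
    choose b hb using fun j => germHom_surjective U (b' j)
    have he : ∀ {B : Type} [CommRing B] (γ : A →+* B) (z : B) (v : Fin n → B) h,
        (e h).eval₂ (Polynomial.eval₂RingHom γ z) v = h.eval₂ γ (Fin.cons z v) := by
      intro B _ γ z v h
      have : (eval₂Hom (Polynomial.eval₂RingHom γ z) v).comp e = eval₂Hom γ (Fin.cons z v) := by
        refine MvPolynomial.ringHom_ext (fun r => by simp [e]) fun i => ?_
        refine Fin.cases ?_ (fun i => ?_) i <;> simp [e]
      exact congrArg (fun f => f h) this
    have key : ∀ h ∈ H, ∀ᶠ i in (U : Filter (Finset (Polynomial A))),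
        SignType.sign (h.eval₂ β (Fin.cons (y i) fun j => b j i)) =
          SignType.sign (h.eval₂ α a) := by
      intro h hh
      have h1 := hb' (e h) (Finset.mem_image_of_mem _ hh)
      rw [he, Fin.cons_self_tail] at h1
      have h2 : (e h).eval₂ β' b' = germHom U ((e h).eval₂ β0 b) := by
        have := MvPolynomial.eval₂_comp_left (germHom U) β0 b (e h)
        rw [this]
        congr 1
        funext j
        exact (hb j).symm
      filter_upwards [eventually_sign_eq U ((e h).eval₂ β0 b)] with i hi
      rw [h1, h2, ← hi, he]
      congr 1
      have := MvPolynomial.eval₂_comp_left (Pi.evalRingHom (fun _ => S) i) (cst.comp β)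
        (Fin.cons y b) h
      refine Eq.trans ?_ this.symm
      congr 1
      funext j
      refine Fin.cases ?_ (fun j => ?_) j <;> simp
    have := (Filter.eventually_all_finset H).2 key
    obtain ⟨i, hi⟩ := this.exists
    exact ⟨_, fun h hh => (hi h hh).symm⟩

/-- A set closed under sums and products and containing all squares. -/
structure IsPreordering {A : Type} [CommRing A] (T : Set A) : Prop where
  add : ∀ {a b}, a ∈ T → b ∈ T → a + b ∈ T
  mul : ∀ {a b}, a ∈ T → b ∈ T → a * b ∈ T
  sq : ∀ a, a ^ 2 ∈ T

namespace IsPreordering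

variable {A : Type} [CommRing A] {T : Set A}

theorem zero_mem (hT : IsPreordering T) : 0 ∈ T := by simpa using hT.sq 0

theorem one_mem (hT : IsPreordering T) : 1 ∈ T := by simpa using hT.sq 1

theorem pow_even (hT : IsPreordering T) (a : A) (l : ℕ) : a ^ (2 * l) ∈ T := by
  rw [mul_comm, pow_mul]; exact hT.sq _

theorem sum_mem (hT : IsPreordering T) {ι : Type*} (s : Finset ι) (f : ι → A)
    (hf : ∀ i ∈ s, f i ∈ T) : ∑ i ∈ s, f i ∈ T :=
  Finset.sum_induction f (· ∈ T) (fun _ _ => hT.add) hT.zero_mem hf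

/-- The preordering generated by `T` and `a`. -/
theorem adjoin (hT : IsPreordering T) (a : A) :
    IsPreordering {x | ∃ p ∈ T, ∃ q ∈ T, x = p + a * q} where
  add := by
    rintro _ _ ⟨p, hp, q, hq, rfl⟩ ⟨p', hp', q', hq', rfl⟩
    exact ⟨p + p', hT.add hp hp', q + q', hT.add hq hq', by ring⟩
  mul := by
    rintro _ _ ⟨p, hp, q, hq, rfl⟩ ⟨p', hp', q', hq', rfl⟩
    exact ⟨p * p' + a ^ 2 * (q * q'), hT.add (hT.mul hp hp') (hT.mul (hT.sq a) (hT.mul hq hq')),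
      p * q' + q * p', hT.add (hT.mul hp hq') (hT.mul hq hp'), by ring⟩
  sq := fun x => ⟨x ^ 2, hT.sq x, 0, hT.zero_mem, by ring⟩

theorem exists_total (hT : IsPreordering T) (h : A) (hTh : ∀ l : ℕ, -h ^ (2 * l) ∉ T) :
    ∃ P ⊇ T, IsPreordering P ∧ (∀ a, a ∈ P ∨ -a ∈ P) ∧ ¬(h ∈ P ∧ -h ∈ P) ∧ -1 ∉ P ∧
      ∀ a b, a * b ∈ P → -(a * b) ∈ P → (a ∈ P ∧ -a ∈ P) ∨ (b ∈ P ∧ -b ∈ P) := by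
  let 𝒮 : Set (Set A) := {P | IsPreordering P ∧ ∀ l : ℕ, -h ^ (2 * l) ∉ P}
  obtain ⟨P, hTP, hPmax⟩ := zorn_subset_nonempty 𝒮 (by
    intro c hc hchain hne
    obtain ⟨P0, hP0⟩ := hne
    refine ⟨⋃₀ c, ⟨⟨?_, ?_, ?_⟩, ?_⟩, fun s hs => Set.subset_sUnion_of_mem hs⟩
    · rintro a b ⟨P, hP, ha⟩ ⟨P', hP', hb⟩
      rcases hchain.total hP hP' with hh | hh
      · exact ⟨P', hP', (hc hP').1.add (hh ha) hb⟩
      · exact ⟨P, hP, (hc hP).1.add ha (hh hb)⟩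
    · rintro a b ⟨P, hP, ha⟩ ⟨P', hP', hb⟩
      rcases hchain.total hP hP' with hh | hh
      · exact ⟨P', hP', (hc hP').1.mul (hh ha) hb⟩
      · exact ⟨P, hP, (hc hP).1.mul ha (hh hb)⟩
    · exact fun a => ⟨P0, hP0, (hc hP0).1.sq a⟩
    · rintro l ⟨P, hP, hl⟩
      exact (hc hP).2 l hl) T ⟨hT, hTh⟩
  obtain ⟨hP, hPh⟩ := hPmax.prop
  have hext : ∀ a, a ∉ P → ∃ l : ℕ, ∃ p ∈ P, ∃ q ∈ P, -h ^ (2 * l) = p + a * q := by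
    intro a ha
    by_contra! hno
    have h1 : {x | ∃ p ∈ P, ∃ q ∈ P, x = p + a * q} ∈ 𝒮 :=
      ⟨hP.adjoin a, fun l ⟨p, hp, q, hq, e⟩ => hno l p hp q hq e⟩
    exact ha (hPmax.le_of_ge h1 (fun x hx => ⟨x, hx, 0, hP.zero_mem, by ring⟩)
      ⟨0, hP.zero_mem, 1, hP.one_mem, by ring⟩)
  have htot : ∀ a, a ∈ P ∨ -a ∈ P := by
    intro a
    by_contra! hcon
    obtain ⟨k, p1, hp1, p2, hp2, e1⟩ := hext a hcon.1
    obtain ⟨m, q1, hq1, q2, hq2, e2⟩ := hext (-a) hcon.2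
    apply hPh (k + m)
    have : -h ^ (2 * (k + m)) = h ^ (2 * k) * q1 + p1 * h ^ (2 * m) + p1 * q1 +
        a ^ 2 * (p2 * q2) := by
      have e3 : (h ^ (2 * k) + p1) * (h ^ (2 * m) + q1) = -(a ^ 2 * (p2 * q2)) := by
        have f1 : h ^ (2 * k) + p1 = -(a * p2) := by linear_combination -e1
        have f2 : h ^ (2 * m) + q1 = a * q2 := by linear_combination -e2
        rw [f1, f2]; ring
      have e4 : h ^ (2 * (k + m)) = h ^ (2 * k) * h ^ (2 * m) := by rw [← pow_add]; ring_nf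
      rw [e4]
      linear_combination -e3
    rw [this]
    exact hP.add (hP.add (hP.add (hP.mul (hP.pow_even _ _) hq1) (hP.mul hp1 (hP.pow_even _ _)))
      (hP.mul hp1 hq1)) (hP.mul (hP.sq a) (hP.mul hp2 hq2))
  have hmulneg : ∀ x y, x ∈ P → -x ∈ P → x * y ∈ P ∧ -(x * y) ∈ P := by
    intro x y hx hx'
    rcases htot y with hy | hy
    · exact ⟨hP.mul hx hy, by rw [← neg_mul]; exact hP.mul hx' hy⟩
    · exact ⟨by rw [← neg_mul_neg]; exact hP.mul hx' hy, by rw [← mul_neg]; exact hP.mul hx hy⟩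
  have hprime0 : ∀ a b, a * b ∈ P → -(a * b) ∈ P → -a ∉ P → -b ∉ P → False := by
    intro a b hab hab' ha hb
    obtain ⟨k, p1, hp1, p2, hp2, e1⟩ := hext (-a) ha
    obtain ⟨m, q1, hq1, q2, hq2, e2⟩ := hext (-b) hb
    apply hPh (k + m)
    have : -h ^ (2 * (k + m)) = h ^ (2 * k) * q1 + p1 * h ^ (2 * m) + p1 * q1 +
        -(a * b * (p2 * q2)) := by
      have e3 : (h ^ (2 * k) + p1) * (h ^ (2 * m) + q1) = a * b * (p2 * q2) := by
        have f1 : h ^ (2 * k) + p1 = a * p2 := by linear_combination -e1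
        have f2 : h ^ (2 * m) + q1 = b * q2 := by linear_combination -e2
        rw [f1, f2]; ring
      have e4 : h ^ (2 * (k + m)) = h ^ (2 * k) * h ^ (2 * m) := by rw [← pow_add]; ring_nf
      rw [e4]
      linear_combination -e3
    rw [this]
    exact hP.add (hP.add (hP.add (hP.mul (hP.pow_even _ _) hq1) (hP.mul hp1 (hP.pow_even _ _)))
      (hP.mul hp1 hq1)) (hmulneg _ _ hab hab').2
  refine ⟨P, hTP, hP, htot, ?_, ?_, ?_⟩
  · rintro ⟨h1, h2⟩
    have := (hmulneg h h h1 h2).2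
    exact hPh 1 (by rwa [mul_one, _root_.sq])
  · simpa using hPh 0
  · intro a b hab hab'
    by_contra! hcon
    have sgn : ∀ a : A, (a ∈ P → -a ∉ P) → -a ∉ P ∨ - -a ∉ P := by
      intro a ha
      by_cases h1 : a ∈ P
      · exact Or.inl (ha h1)
      · exact Or.inr (by simpa using h1)
    rcases sgn a hcon.1 with h1 | h1 <;> rcases sgn b hcon.2 with h2 | h2
    · exact hprime0 a b hab hab' h1 h2
    · exact hprime0 a (-b) (by simpa using hab') (by simpa using hab) h1 h2
    · exact hprime0 (-a) b (by simpa using hab') (by simpa using hab) h1 h2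
    · exact hprime0 (-a) (-b) (by simpa using hab) (by simpa using hab') h1 h2

end IsPreordering

theorem exists_linearOrder_of_cone {K : Type} [Field K] (P : Set K)
    (hadd : ∀ a b, a ∈ P → b ∈ P → a + b ∈ P) (hmul : ∀ a b, a ∈ P → b ∈ P → a * b ∈ P)
    (hanti : ∀ a, a ∈ P → -a ∈ P → a = 0) (htot : ∀ a, a ∈ P ∨ -a ∈ P) :
    ∃ _ : LinearOrder K, IsStrictOrderedRing K ∧ ∀ x : K, 0 ≤ x ↔ x ∈ P := by
  classical
  have h0 : (0 : K) ∈ P := by rcases htot 0 with h | h <;> simpa using h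
  have h1 : (1 : K) ∈ P := by
    rcases htot 1 with h | h
    · exact h
    · have := hmul _ _ h h
      simpa using this
  let c : RingCone K :=
    { carrier := P
      add_mem' := fun {a b} => hadd a b
      mul_mem' := fun {a b} => hmul a b
      zero_mem' := h0
      one_mem' := h1
      eq_zero_of_mem_of_neg_mem' := fun {a} => hanti a }
  have : HasMemOrNegMem c := ⟨htot⟩
  let _ : LinearOrder K := LinearOrder.mkOfAddGroupCone c
  have : IsOrderedRing K := IsOrderedRing.mkOfCone c
  refine ⟨inferInstance, inferInstance, fun x => ?_⟩
  change x - 0 ∈ P ↔ x ∈ P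
  rw [sub_zero]

theorem IsPreordering.exists_linearOrder {K : Type} [Field K] {T : Set K}
    (hT : IsPreordering T) (h : -1 ∉ T) :
    ∃ _ : LinearOrder K, IsStrictOrderedRing K ∧ ∀ x ∈ T, 0 ≤ x := by
  obtain ⟨P, hTP, hP, htot, h1, h2, h3⟩ := hT.exists_total 1 (by simpa using h)
  obtain ⟨o, ho, hoP⟩ := exists_linearOrder_of_cone P (fun _ _ => hP.add) (fun _ _ => hP.mul) (by
    intro a ha ha'
    by_contra h0
    apply h2
    have h4 : -1 = -a * a * (a⁻¹) ^ 2 := by field_simp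
    rw [h4]
    exact hP.mul (hP.mul ha' ha) (hP.sq _)) htot
  exact ⟨o, ho, fun x hx => (hoP x).2 (hTP hx)⟩

/-- A set which is the set of nonnegative elements of an ordered subfield. -/
structure IsPartialCone {Ω : Type} [Field Ω] (P : Set Ω) : Prop where
  add : ∀ {a b}, a ∈ P → b ∈ P → a + b ∈ P
  mul : ∀ {a b}, a ∈ P → b ∈ P → a * b ∈ P
  inv : ∀ {a}, a ∈ P → a⁻¹ ∈ P
  sub : ∀ {a b}, a ∈ P → b ∈ P → a - b ∈ P ∨ b - a ∈ P
  anti : ∀ {a}, a ∈ P → -a ∈ P → a = 0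
  one : 1 ∈ P

namespace IsPartialCone

variable {Ω : Type} [Field Ω] {P : Set Ω}

theorem zero (hP : IsPartialCone P) : 0 ∈ P := by
  rcases hP.sub hP.one hP.one with h | h <;> simpa using h

/-- The subfield ordered by a partial cone. -/
def subfield (hP : IsPartialCone P) : Subfield Ω where
  carrier := {x | x ∈ P ∨ -x ∈ P}
  mul_mem' := by
    rintro a b (ha | ha) (hb | hb)
    · exact Or.inl (hP.mul ha hb)
    · exact Or.inr (by rw [← mul_neg]; exact hP.mul ha hb)
    · exact Or.inr (by rw [← neg_mul]; exact hP.mul ha hb)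
    · exact Or.inl (by rw [← neg_mul_neg]; exact hP.mul ha hb)
  one_mem' := Or.inl hP.one
  add_mem' := by
    rintro a b (ha | ha) (hb | hb)
    · exact Or.inl (hP.add ha hb)
    · rcases hP.sub ha hb with h | h
      · exact Or.inl (by simpa using h)
      · exact Or.inr (by convert h using 1; ring)
    · rcases hP.sub hb ha with h | h
      · exact Or.inl (by convert h using 1; ring)
      · exact Or.inr (by convert h using 1; ring)
    · exact Or.inr (by rw [neg_add]; exact hP.add ha hb)
  zero_mem' := Or.inl hP.zero
  neg_mem' := by
    rintro a (ha | ha)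
    · exact Or.inr (by simpa using ha)
    · exact Or.inl ha
  inv_mem' := by
    rintro a (ha | ha)
    · exact Or.inl (hP.inv ha)
    · exact Or.inr (by rw [← inv_neg]; exact hP.inv ha)

theorem image {K : Type} [Field K] [LinearOrder K] [IsStrictOrderedRing K] (i : K →+* Ω) :
    IsPartialCone (i '' {x | 0 ≤ x}) where
  add := by
    rintro _ _ ⟨a, ha, rfl⟩ ⟨b, hb, rfl⟩
    exact ⟨a + b, add_nonneg (Set.mem_ofPred.1 ha) hb, map_add i a b⟩
  mul := by
    rintro _ _ ⟨a, ha, rfl⟩ ⟨b, hb, rfl⟩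
    exact ⟨a * b, mul_nonneg (Set.mem_ofPred.1 ha) hb, map_mul i a b⟩
  inv := by
    rintro _ ⟨a, ha, rfl⟩
    exact ⟨a⁻¹, inv_nonneg.2 ha, map_inv₀ i a⟩
  sub := by
    rintro _ _ ⟨a, ha, rfl⟩ ⟨b, hb, rfl⟩
    rcases le_total a b with h | h
    · exact Or.inr ⟨b - a, sub_nonneg.2 h, map_sub i b a⟩
    · exact Or.inl ⟨a - b, sub_nonneg.2 h, map_sub i a b⟩
  anti := by
    rintro _ ⟨a, ha, rfl⟩ ⟨b, hb, e⟩
    have : b = -a := i.injective (by rw [e, map_neg])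
    have ha' : (0 : K) ≤ a := ha
    have hb' : (0 : K) ≤ b := hb
    have : a = 0 := by linarith
    rw [this, map_zero]
  one := ⟨1, zero_le_one, map_one i⟩

end IsPartialCone

theorem PolyIVT.of_mul_nonpos {R : Type} [Field R] [LinearOrder R] [IsStrictOrderedRing R]
    (h : ∀ (p : Polynomial R) (a b : R), a ≤ b → p.eval a * p.eval b ≤ 0 →
      ∃ c, a ≤ c ∧ c ≤ b ∧ p.eval c = 0) : PolyIVT R :=
  fun p a b hab ha hb => h p a b hab (mul_nonpos_of_nonpos_of_nonneg ha hb)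

/-- An ordering extends to a simple extension by a root of an irreducible polynomial which
changes sign. -/
theorem exists_order_adjoinRoot {K : Type} [Field K] [LinearOrder K] [IsStrictOrderedRing K]
    (p : Polynomial K) [hp : Fact (Irreducible p)] {a b : K}
    (h : p.eval a * p.eval b < 0)
    (ih : ∀ q : Polynomial K, q.natDegree < p.natDegree → q.eval a * q.eval b ≤ 0 →
      ∃ c, a ≤ c ∧ c ≤ b ∧ q.eval c = 0) :
    ∃ _ : LinearOrder (AdjoinRoot p), IsStrictOrderedRing (AdjoinRoot p) ∧
      ∀ x : K, 0 ≤ x → 0 ≤ AdjoinRoot.of p x := by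
  let G : Set (AdjoinRoot p) := {y | ∃ c : K, 0 ≤ c ∧ ∃ z, y = AdjoinRoot.of p c * z ^ 2}
  have hT : IsPreordering (AddSubmonoid.closure G : Set (AdjoinRoot p)) := by
    refine ⟨fun h1 h2 => add_mem h1 h2, fun {x y} h1 h2 => ?_, fun z =>
      AddSubmonoid.subset_closure ⟨1, zero_le_one, z, by simp⟩⟩
    induction h1 using AddSubmonoid.closure_induction with
    | zero => simp
    | add x x' _ _ e1 e2 =>
      rw [SetLike.mem_coe, add_mul]
      exact add_mem e1 e2
    | mem x hx =>
      induction h2 using AddSubmonoid.closure_induction with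
      | zero => simp
      | add x x' _ _ e1 e2 =>
        rw [SetLike.mem_coe, mul_add]
        exact add_mem e1 e2
      | mem y hy =>
        obtain ⟨c, hc, z, rfl⟩ := hx
        obtain ⟨c', hc', z', rfl⟩ := hy
        exact AddSubmonoid.subset_closure ⟨c * c', mul_nonneg hc hc', z * z', by
          rw [map_mul]; ring⟩
  have hp0 : p ≠ 0 := hp.out.ne_zero
  have hpd : 0 < p.natDegree := hp.out.natDegree_pos
  have hrep : ∀ y ∈ AddSubmonoid.closure G, ∃ f : Polynomial K, AdjoinRoot.mk p f = y ∧
      f.natDegree ≤ 2 * (p.natDegree - 1) ∧ ∀ u, 0 ≤ f.eval u := by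
    intro y hy
    induction hy using AddSubmonoid.closure_induction with
    | zero => exact ⟨0, by simp, by simp, by simp⟩
    | add x x' _ _ e1 e2 =>
      obtain ⟨f, rfl, hf1, hf2⟩ := e1
      obtain ⟨f', rfl, hf1', hf2'⟩ := e2
      refine ⟨f + f', map_add _ _ _, (Polynomial.natDegree_add_le _ _).trans
        (max_le hf1 hf1'), fun u => ?_⟩
      rw [Polynomial.eval_add]
      exact add_nonneg (hf2 u) (hf2' u)
    | mem y hy =>
      obtain ⟨c, hc, z, rfl⟩ := hy
      obtain ⟨f, rfl⟩ := AdjoinRoot.mk_surjective z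
      have hmod : AdjoinRoot.mk p (f % p) = AdjoinRoot.mk p f := by
        rw [AdjoinRoot.mk_eq_mk]
        refine ⟨-(f / p), ?_⟩
        linear_combination EuclideanDomain.div_add_mod f p
      refine ⟨Polynomial.C c * (f % p) ^ 2, ?_, ?_, fun u => ?_⟩
      · rw [map_mul, map_pow, hmod, AdjoinRoot.mk_C]
      · refine (Polynomial.natDegree_C_mul_le _ _).trans (Polynomial.natDegree_pow_le.trans ?_)
        have := Polynomial.natDegree_mod_lt f hpd.ne'
        omega
      · rw [Polynomial.eval_mul, Polynomial.eval_C, Polynomial.eval_pow]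
        exact mul_nonneg hc (sq_nonneg _)
  have hneg : (-1 : AdjoinRoot p) ∉ (AddSubmonoid.closure G : Set (AdjoinRoot p)) := by
    intro hmem
    obtain ⟨f, hf, hfd, hfn⟩ := hrep _ hmem
    have hdvd : p ∣ f + 1 := by
      rw [← AdjoinRoot.mk_eq_zero, map_add, hf, map_one]; ring
    obtain ⟨q, hq⟩ := hdvd
    have hev : ∀ u, 0 < (f + 1).eval u := fun u => by
      rw [Polynomial.eval_add, Polynomial.eval_one]
      linarith [hfn u]
    have hq0 : q ≠ 0 := by
      rintro rfl
      have := hev a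
      rw [hq] at this
      simp at this
    have hqd : q.natDegree < p.natDegree := by
      have h1 : (f + 1).natDegree ≤ 2 * (p.natDegree - 1) :=
        (Polynomial.natDegree_add_le _ _).trans (by simpa using hfd)
      rw [hq, Polynomial.natDegree_mul hp0 hq0] at h1
      omega
    have hqab : q.eval a * q.eval b ≤ 0 := by
      have h1 := hev a
      have h2 := hev b
      rw [hq, Polynomial.eval_mul] at h1 h2
      by_contra! h3
      have h4 := mul_pos h1 h2
      have h5 := mul_neg_of_neg_of_pos h h3
      linarith [h4, h5, show p.eval a * q.eval a * (p.eval b * q.eval b) =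
        p.eval a * p.eval b * (q.eval a * q.eval b) by ring]
    obtain ⟨c, -, -, hc⟩ := ih q hqd hqab
    have := hev c
    rw [hq, Polynomial.eval_mul, hc, mul_zero] at this
    exact lt_irrefl _ this
  obtain ⟨o, ho, hoT⟩ := hT.exists_linearOrder hneg
  exact ⟨o, ho, fun x hx => hoT _ (AddSubmonoid.subset_closure ⟨x, hx, 1, by simp⟩)⟩

theorem IsPartialCone.polyIVT {Ω : Type} [Field Ω] [IsAlgClosed Ω] {P : Set Ω}
    (hP : IsPartialCone P) (hmax : ∀ P', IsPartialCone P' → P ⊆ P' → P' ⊆ P)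
    [LinearOrder hP.subfield] [IsStrictOrderedRing hP.subfield]
    (hord : ∀ x : hP.subfield, 0 ≤ x ↔ (x : Ω) ∈ P) : PolyIVT hP.subfield := by
  refine PolyIVT.of_mul_nonpos fun p => ?_
  induction hn : p.natDegree using Nat.strong_induction_on generalizing p with
  | _ d ih =>
  intro a b hab h
  by_contra! hno
  have hp0 : p ≠ 0 := by
    rintro rfl
    exact hno a le_rfl hab (by simp)
  have hlt : p.eval a * p.eval b < 0 :=
    lt_of_le_of_ne h (mul_ne_zero (hno a le_rfl hab) (hno b hab le_rfl))
  have hunit : ¬IsUnit p := by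
    intro hu
    obtain ⟨c, -, rfl⟩ := Polynomial.isUnit_iff.1 hu
    rw [Polynomial.eval_C, Polynomial.eval_C] at hlt
    exact absurd hlt (not_lt.2 (mul_self_nonneg c))
  have hirr : Irreducible p := by
    refine ⟨hunit, fun q r hqr => ?_⟩
    by_contra! hcon
    have hq0 : q ≠ 0 := by rintro rfl; simp [hqr] at hp0
    have hr0 : r ≠ 0 := by rintro rfl; simp [hqr] at hp0
    have hq1 : 0 < q.natDegree := by
      by_contra! h0
      apply hcon.1
      rw [Polynomial.eq_C_of_natDegree_le_zero h0]
      refine (IsUnit.mk0 _ fun h1 => hq0 ?_).map Polynomial.C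
      rw [Polynomial.eq_C_of_natDegree_le_zero h0, h1, map_zero]
    have hr1 : 0 < r.natDegree := by
      by_contra! h0
      apply hcon.2
      rw [Polynomial.eq_C_of_natDegree_le_zero h0]
      refine (IsUnit.mk0 _ fun h1 => hr0 ?_).map Polynomial.C
      rw [Polynomial.eq_C_of_natDegree_le_zero h0, h1, map_zero]
    have hdeg : d = q.natDegree + r.natDegree := by
      rw [← hn, hqr, Polynomial.natDegree_mul hq0 hr0]
    rcases le_total (q.eval a * q.eval b) 0 with h1 | h1
    · obtain ⟨c, c1, c2, c3⟩ := ih q.natDegree (by omega) q rfl a b hab h1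
      exact hno c c1 c2 (by rw [hqr, Polynomial.eval_mul, c3, zero_mul])
    · have h2 : r.eval a * r.eval b ≤ 0 := by
        by_contra! h3
        have h4 := mul_nonneg h1 h3.le
        rw [hqr, Polynomial.eval_mul, Polynomial.eval_mul] at hlt
        linarith [show q.eval a * r.eval a * (q.eval b * r.eval b) =
          q.eval a * q.eval b * (r.eval a * r.eval b) by ring]
      obtain ⟨c, c1, c2, c3⟩ := ih r.natDegree (by omega) r rfl a b hab h2
      exact hno c c1 c2 (by rw [hqr, Polynomial.eval_mul, c3, mul_zero])
  have : Fact (Irreducible p) := ⟨hirr⟩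
  obtain ⟨o, ho, hoK⟩ := exists_order_adjoinRoot p hlt
    fun q hq hq2 => ih q.natDegree (by omega) q rfl a b hab hq2
  have hdeg0 : (p.map hP.subfield.subtype).degree ≠ 0 := by
    rw [Polynomial.degree_map]
    exact (Polynomial.degree_pos_of_irreducible hirr).ne'
  obtain ⟨θ, hθ⟩ := IsAlgClosed.exists_root _ hdeg0
  have hθ' : p.eval₂ hP.subfield.subtype θ = 0 := by
    rwa [Polynomial.IsRoot.def, Polynomial.eval_map] at hθ
  let i : AdjoinRoot p →+* Ω := AdjoinRoot.lift hP.subfield.subtype θ hθ'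
  have hsub := hmax _ (IsPartialCone.image i) (by
    intro x hx
    exact ⟨AdjoinRoot.of p ⟨x, Or.inl hx⟩, hoK _ ((hord _).2 hx), by simp [i]⟩)
  have hθK : θ ∈ hP.subfield := by
    rcases le_total 0 (AdjoinRoot.root p) with h1 | h1
    · exact Or.inl (hsub ⟨_, h1, by simp [i]⟩)
    · exact Or.inr (hsub ⟨-AdjoinRoot.root p, neg_nonneg.2 h1, by simp [i]⟩)
  have hroot : p.eval ⟨θ, hθK⟩ = 0 := by
    apply hP.subfield.subtype.injective
    rw [map_zero, ← hθ', ← Polynomial.eval₂_at_apply]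
    rfl
  have hd1 := Polynomial.degree_eq_one_of_irreducible_of_root hirr hroot
  generalize (⟨θ, hθK⟩ : hP.subfield) = k at hroot
  have hlin : ∀ u, p.eval u = p.coeff 1 * (u - k) := by
    intro u
    have h1 := Polynomial.eq_X_add_C_of_degree_eq_one hd1
    have h2 : ∀ v, p.eval v = p.coeff 1 * v + p.coeff 0 := by
      intro v
      conv_lhs => rw [h1]
      simp only [Polynomial.eval_add, Polynomial.eval_mul, Polynomial.eval_C, Polynomial.eval_X,
        Polynomial.leadingCoeff, Polynomial.natDegree_eq_of_degree_eq_some hd1]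
      rfl
    rw [h2] at hroot ⊢
    linear_combination hroot
  rw [hlin, hlin] at hlt
  have h3 : p.coeff 1 * (a - k) * (p.coeff 1 * (b - k)) =
    p.coeff 1 ^ 2 * ((a - k) * (b - k)) := by ring
  rw [h3] at hlt
  have h4 : (a - k) * (b - k) < 0 := by
    by_contra! h5
    exact absurd hlt (not_lt.2 (mul_nonneg (sq_nonneg _) h5))
  refine hno k ?_ ?_ hroot
  · by_contra! h5
    exact absurd h4 (not_lt.2 (mul_nonneg (by linarith) (by linarith)))
  · by_contra! h5
    exact absurd h4 (not_lt.2 (mul_nonneg_of_nonpos_of_nonpos (by linarith) (by linarith)))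

/-- Every ordered field embeds into one with the intermediate value property. -/
theorem exists_polyIVT_extension (F : Type) [Field F] [LinearOrder F] [IsStrictOrderedRing F] :
    ∃ (R : Type) (_ : Field R) (_ : LinearOrder R) (_ : IsStrictOrderedRing R), PolyIVT R ∧
      ∃ i : F →+* R, ∀ x, 0 ≤ x → 0 ≤ i x := by
  let j : F →+* AlgebraicClosure F := algebraMap F (AlgebraicClosure F)
  obtain ⟨P, hjP, hPmax⟩ := zorn_subset_nonempty {P : Set (AlgebraicClosure F) | IsPartialCone P}
    (by
      intro c hc hchain hne
      obtain ⟨P0, hP0⟩ := hne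
      have two : ∀ {x y}, x ∈ ⋃₀ c → y ∈ ⋃₀ c → ∃ P ∈ c, x ∈ P ∧ y ∈ P := by
        rintro x y ⟨P, hP, hx⟩ ⟨P', hP', hy⟩
        rcases hchain.total hP hP' with hh | hh
        · exact ⟨P', hP', hh hx, hy⟩
        · exact ⟨P, hP, hx, hh hy⟩
      refine ⟨⋃₀ c, ?_, fun s hs => Set.subset_sUnion_of_mem hs⟩
      refine ⟨fun hx hy => ?_, fun hx hy => ?_, ?_, fun hx hy => ?_, fun hx hy => ?_,
        ⟨P0, hP0, (hc hP0).one⟩⟩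
      · obtain ⟨P, hP, h1, h2⟩ := two hx hy
        exact ⟨P, hP, (hc hP).add h1 h2⟩
      · obtain ⟨P, hP, h1, h2⟩ := two hx hy
        exact ⟨P, hP, (hc hP).mul h1 h2⟩
      · rintro a ⟨P, hP, h1⟩
        exact ⟨P, hP, (hc hP).inv h1⟩
      · obtain ⟨P, hP, h1, h2⟩ := two hx hy
        exact ((hc hP).sub h1 h2).imp (fun h => ⟨P, hP, h⟩) fun h => ⟨P, hP, h⟩
      · obtain ⟨P, hP, h1, h2⟩ := two hx hy
        exact (hc hP).anti h1 h2) _ (IsPartialCone.image j)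
  have hP : IsPartialCone P := hPmax.prop
  obtain ⟨o, ho, hoP⟩ := exists_linearOrder_of_cone {x : hP.subfield | (x : AlgebraicClosure F) ∈ P}
    (fun a b ha hb => hP.add ha hb) (fun a b ha hb => hP.mul ha hb)
    (fun a ha hb => Subtype.ext (hP.anti ha hb)) (fun a => a.2)
  refine ⟨hP.subfield, inferInstance, o, ho, hP.polyIVT (fun P' hP' h => hPmax.le_of_ge hP' h) hoP,
    j.codRestrict hP.subfield fun x => ?_, fun x hx => (hoP _).2 (hjP ⟨x, hx, rfl⟩)⟩
  rcases le_total 0 x with h | h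
  · exact Or.inl (hjP ⟨x, h, rfl⟩)
  · exact Or.inr (hjP ⟨-x, neg_nonneg.2 h, map_neg j x⟩)

theorem PolyIVT.real : PolyIVT ℝ := by
  intro p a b hab ha hb
  obtain ⟨c, hc, hc0⟩ := intermediate_value_Icc hab p.continuous.continuousOn ⟨ha, hb⟩
  exact ⟨c, hc.1, hc.2, hc0⟩

/-- A total preordering with prime support induces an ordered field quotient. -/
theorem IsPreordering.exists_orderedField_hom {A : Type} [CommRing A] {T : Set A}
    (hT : IsPreordering T) (h : A) (hTh : ∀ l : ℕ, -h ^ (2 * l) ∉ T) :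
    ∃ (L : Type) (_ : Field L) (_ : LinearOrder L) (_ : IsStrictOrderedRing L) (θ : A →+* L),
      θ h ≠ 0 ∧ ∀ a ∈ T, 0 ≤ θ a := by
  obtain ⟨P, hTP, hP, htot, hhP, h1P, hprime⟩ := hT.exists_total h hTh
  let J : Ideal A :=
    { carrier := {a | a ∈ P ∧ -a ∈ P}
      add_mem' := by
        rintro a b ⟨ha, ha'⟩ ⟨hb, hb'⟩
        exact ⟨hP.add ha hb, by rw [neg_add]; exact hP.add ha' hb'⟩
      zero_mem' := ⟨hP.zero_mem, by rw [neg_zero]; exact hP.zero_mem⟩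
      smul_mem' := by
        rintro c a ⟨ha, ha'⟩
        rcases htot c with hc | hc
        · exact ⟨hP.mul hc ha, by rw [smul_eq_mul, ← mul_neg]; exact hP.mul hc ha'⟩
        · refine ⟨?_, ?_⟩
          · rw [smul_eq_mul, ← neg_mul_neg]; exact hP.mul hc ha'
          · rw [smul_eq_mul, ← neg_mul]; exact hP.mul hc ha }
  have hJmem : ∀ a, a ∈ J ↔ a ∈ P ∧ -a ∈ P := fun a => Iff.rfl
  have hJ : J.IsPrime := by
    refine ⟨fun htop => h1P ?_, fun {a b} hab => ?_⟩
    · exact ((hJmem 1).1 (htop ▸ Submodule.mem_top)).2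
    · exact hprime a b hab.1 hab.2
  let θ : A →+* FractionRing (A ⧸ J) :=
    (algebraMap (A ⧸ J) (FractionRing (A ⧸ J))).comp (Ideal.Quotient.mk J)
  have hθ0 : ∀ a, θ a = 0 ↔ a ∈ J := fun a => by
    simp only [θ, RingHom.comp_apply]
    rw [map_eq_zero_iff _ (IsFractionRing.injective (A ⧸ J) (FractionRing (A ⧸ J))),
      Ideal.Quotient.eq_zero_iff_mem]
  let T0 : Set (FractionRing (A ⧸ J)) := {x | ∃ p ∈ P, ∃ s, θ s ≠ 0 ∧ x * θ s ^ 2 = θ p}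
  have hT0 : IsPreordering T0 :=
    { add := by
        rintro x y ⟨p, hp, s, hs, hx⟩ ⟨p', hp', s', hs', hy⟩
        refine ⟨p * s' ^ 2 + p' * s ^ 2, hP.add (hP.mul hp (hP.sq _)) (hP.mul hp' (hP.sq _)),
          s * s', by rw [map_mul]; exact mul_ne_zero hs hs', ?_⟩
        simp only [map_mul, map_add, map_pow]
        linear_combination θ s' ^ 2 * hx + θ s ^ 2 * hy
      mul := by
        rintro x y ⟨p, hp, s, hs, hx⟩ ⟨p', hp', s', hs', hy⟩
        refine ⟨p * p', hP.mul hp hp', s * s', by rw [map_mul]; exact mul_ne_zero hs hs', ?_⟩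
        simp only [map_mul]
        rw [← hx, ← hy]
        ring
      sq := by
        intro x
        obtain ⟨a, s, hs, rfl⟩ := IsFractionRing.div_surjective (A := A ⧸ J) x
        obtain ⟨a, rfl⟩ := Ideal.Quotient.mk_surjective a
        obtain ⟨s, rfl⟩ := Ideal.Quotient.mk_surjective s
        have hs0 : θ s ≠ 0 := by
          rw [Ne, hθ0, ← Ideal.Quotient.eq_zero_iff_mem]
          exact nonZeroDivisors.ne_zero hs
        refine ⟨a ^ 2, hP.sq a, s, hs0, ?_⟩
        rw [map_pow]
        change (θ a / θ s) ^ 2 * θ s ^ 2 = θ a ^ 2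
        field_simp }
  have hT0' : (-1 : FractionRing (A ⧸ J)) ∉ T0 := by
    rintro ⟨p, hp, s, hs, hx⟩
    have h1 : p + s ^ 2 ∈ J := by
      rw [← hθ0, map_add, map_pow, ← hx]; ring
    have h2 : -s ^ 2 ∈ P := by
      have := hP.add h1.2 hp
      convert this using 1; ring
    have h3 : s ^ 2 ∈ J := ⟨hP.sq s, h2⟩
    exact hs ((hθ0 s).2 (hJ.mem_of_pow_mem 2 h3))
  obtain ⟨o, ho, hoT⟩ := hT0.exists_linearOrder hT0'
  refine ⟨FractionRing (A ⧸ J), inferInstance, o, ho, θ, fun h0 => hhP ((hθ0 h).1 h0), ?_⟩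
  intro a ha
  exact hoT _ ⟨a, hTP ha, 1, by simp, by simp⟩

/-- The Positivstellensatz: if no `-h ^ (2 * l)` lies in a preordering, then finitely many
elements of it are simultaneously nonnegative at some real point where `h` does not vanish. -/
theorem IsPreordering.exists_point {n : ℕ} {T : Set (MvPolynomial (Fin n) ℝ)}
    (hT : IsPreordering T) (h : MvPolynomial (Fin n) ℝ) (hTh : ∀ l : ℕ, -h ^ (2 * l) ∉ T)
    (E : Finset (MvPolynomial (Fin n) ℝ)) (hE : ∀ e ∈ E, e ∈ T) :
    ∃ x : Fin n → ℝ, eval x h ≠ 0 ∧ ∀ e ∈ E, 0 ≤ eval x e := by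
  classical
  obtain ⟨L, _, _, _, θ, hθh, hθT⟩ := hT.exists_orderedField_hom h hTh
  obtain ⟨R, _, _, _, hR, i, hi⟩ := exists_polyIVT_extension L
  let γ : MvPolynomial (Fin n) ℝ →+* R := i.comp θ
  have hγ : ∀ p, γ p = p.eval₂ (γ.comp C) (fun j => γ (X j)) := by
    intro p
    have : γ = eval₂Hom (γ.comp C) (fun j => γ (X j)) := by
      apply MvPolynomial.ringHom_ext <;> intro r <;> simp
    exact congrArg (fun f : MvPolynomial (Fin n) ℝ →+* R => f p) this
  have hpos : ∀ r : ℝ, 0 < r → 0 < (γ.comp C) r := by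
    intro r hr
    have h1 : (γ.comp C) r = ((γ.comp C) (Real.sqrt r)) ^ 2 := by
      rw [← map_pow, Real.sq_sqrt hr.le]
    refine lt_of_le_of_ne (by rw [h1]; exact sq_nonneg _) ?_
    exact ((map_ne_zero (γ.comp C)).2 hr.ne').symm
  have hsign : ∀ r : ℝ, SignType.sign ((γ.comp C) r) = SignType.sign (RingHom.id ℝ r) := by
    intro r
    rcases lt_trichotomy r 0 with hr | rfl | hr
    · have := hpos (-r) (by linarith)
      rw [map_neg] at this
      rw [RingHom.id_apply, sign_neg hr, sign_neg (by linarith)]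
    · simp
    · rw [RingHom.id_apply, sign_pos hr, sign_pos (hpos r hr)]
  obtain ⟨x, hx⟩ := exists_match n ℝ R ℝ hR PolyIVT.real (γ.comp C) (RingHom.id ℝ) hsign
    (fun j => γ (X j)) (insert h E)
  have hx' : ∀ p ∈ insert h E, SignType.sign (γ p) = SignType.sign (eval x p) := by
    intro p hp
    rw [hγ p, hx p hp]
    rfl
  refine ⟨x, ?_, ?_⟩
  · have h1 := hx' h (Finset.mem_insert_self _ _)
    intro h0
    rw [h0, sign_zero, sign_eq_zero_iff] at h1
    exact hθh ((map_eq_zero i).1 h1)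
  · intro e he
    have h1 := hx' e (Finset.mem_insert_of_mem he)
    have h2 : 0 ≤ γ e := hi _ (hθT e (hE e he))
    by_contra h3
    rw [sign_neg (not_le.1 h3), sign_eq_neg_one_iff] at h1
    exact absurd h2 (not_le.2 h1)

theorem IsPreordering.isSumSq {A : Type} [CommRing A] : IsPreordering {a : A | IsSumSq a} where
  add := fun ha hb => IsSumSq.add ha hb
  mul := fun ha hb => IsSumSq.mul ha hb
  sq := fun a => (IsSquare.sq a).isSumSq

/-- A quadratic module. -/
structure IsQuadMod {A : Type} [CommRing A] (M : Set A) : Prop where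
  one : 1 ∈ M
  add : ∀ {a b}, a ∈ M → b ∈ M → a + b ∈ M
  sq_mul : ∀ c {a}, a ∈ M → c ^ 2 * a ∈ M

theorem IsPreordering.isQuadMod {A : Type} [CommRing A] {T : Set A} (hT : IsPreordering T) :
    IsQuadMod T :=
  ⟨hT.one_mem, hT.add, fun c _ ha => hT.mul (hT.sq c) ha⟩

namespace IsQuadMod

section Ring

variable {A : Type} [CommRing A] {M : Set A}

theorem sq_mem (hM : IsQuadMod M) (a : A) : a ^ 2 ∈ M := by
  simpa using hM.sq_mul a hM.one

theorem zero_mem (hM : IsQuadMod M) : 0 ∈ M := by simpa using hM.sq_mem 0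

theorem sumSq_mul (hM : IsQuadMod M) {s a : A} (hs : IsSumSq s) (ha : a ∈ M) : s * a ∈ M := by
  induction hs with
  | zero => rw [zero_mul]; exact hM.zero_mem
  | sq_add b h ih => rw [add_mul, ← sq]; exact hM.add (hM.sq_mul b ha) ih

theorem sumSq_mem (hM : IsQuadMod M) {s : A} (hs : IsSumSq s) : s ∈ M := by
  simpa using hM.sumSq_mul hs hM.one

theorem sum_mem (hM : IsQuadMod M) {ι : Type*} (s : Finset ι) (f : ι → A)
    (hf : ∀ i ∈ s, f i ∈ M) : ∑ i ∈ s, f i ∈ M :=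
  Finset.sum_induction f (· ∈ M) (fun _ _ => hM.add) hM.zero_mem hf

/-- The quadratic module generated by `M` and `a`. -/
theorem adjoin (hM : IsQuadMod M) (a : A) :
    IsQuadMod {x | ∃ p ∈ M, ∃ s, IsSumSq s ∧ x = p + a * s} where
  one := ⟨1, hM.one, 0, IsSumSq.zero, by ring⟩
  add := by
    rintro _ _ ⟨p, hp, q, hq, rfl⟩ ⟨p', hp', q', hq', rfl⟩
    exact ⟨p + p', hM.add hp hp', q + q', hq.add hq', by ring⟩
  sq_mul := by
    rintro c _ ⟨p, hp, q, hq, rfl⟩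
    exact ⟨c ^ 2 * p, hM.sq_mul c hp, c ^ 2 * q, (IsSquare.sq c).isSumSq.mul hq, by ring⟩

end Ring

section Poly

variable {n : ℕ} {M : Set (MvPolynomial (Fin n) ℝ)}

theorem C_mul_mem (hM : IsQuadMod M) {r : ℝ} (hr : 0 ≤ r) {a : MvPolynomial (Fin n) ℝ}
    (ha : a ∈ M) : C r * a ∈ M := by
  have := hM.sq_mul (C (Real.sqrt r)) ha
  rwa [← C_pow, Real.sq_sqrt hr] at this

theorem C_mem (hM : IsQuadMod M) {r : ℝ} (hr : 0 ≤ r) : C r ∈ M := by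
  simpa using hM.C_mul_mem hr hM.one

theorem of_C_mul_mem (hM : IsQuadMod M) {r : ℝ} (hr : 0 < r) {a : MvPolynomial (Fin n) ℝ}
    (ha : C r * a ∈ M) : a ∈ M := by
  have := hM.C_mul_mem (inv_nonneg.2 hr.le) ha
  rwa [← mul_assoc, ← C_mul, inv_mul_cancel₀ hr.ne', C_1, one_mul] at this

theorem C_sub_mono (hM : IsQuadMod M) {r s : ℝ} (hrs : r ≤ s) {a : MvPolynomial (Fin n) ℝ}
    (ha : C r + a ∈ M) : C s + a ∈ M := by
  have := hM.add ha (hM.C_mem (sub_nonneg.2 hrs))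
  convert this using 1
  rw [C_sub]; ring

theorem sq_sub_sq_mem (hM : IsQuadMod M) {N : ℝ} (hN : 0 < N) {a : MvPolynomial (Fin n) ℝ}
    (h1 : C N + a ∈ M) (h2 : C N + -a ∈ M) : C (N ^ 2) + -a ^ 2 ∈ M := by
  have h3 := hM.add (hM.sq_mul (C N + -a) h1) (hM.sq_mul (C N + a) h2)
  refine hM.of_C_mul_mem (r := 2 * N) (by positivity) ?_
  convert h3 using 1
  rw [C_pow, C_mul]
  have : (C 2 : MvPolynomial (Fin n) ℝ) = 2 := map_ofNat C 2
  rw [this]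
  ring

theorem of_sub_sq_mem (hM : IsQuadMod M) {N : ℝ} {a : MvPolynomial (Fin n) ℝ}
    (h : C N + -a ^ 2 ∈ M) : C (N + 1 / 4) + a ∈ M := by
  have h1 := hM.add h (hM.sq_mem (a + C (1 / 2)))
  convert h1 using 1
  have h2 : (C (1 / 4) : MvPolynomial (Fin n) ℝ) = C (1 / 2) ^ 2 := by
    rw [← C_pow]; norm_num
  have h3 : 2 * (C (1 / 2) : MvPolynomial (Fin n) ℝ) = 1 := by
    rw [← map_ofNat C 2, ← C_mul]; norm_num
  rw [C_add, h2]
  linear_combination -(a * h3)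

/-- The elements bounded above and below by constants modulo `M`. -/
def Bdd (M : Set (MvPolynomial (Fin n) ℝ)) (a : MvPolynomial (Fin n) ℝ) : Prop :=
  ∃ N : ℝ, 0 < N ∧ C N + a ∈ M ∧ C N + -a ∈ M

theorem Bdd.neg {a : MvPolynomial (Fin n) ℝ} (ha : Bdd M a) : Bdd M (-a) := by
  obtain ⟨N, h0, h1, h2⟩ := ha
  exact ⟨N, h0, h2, by rwa [neg_neg]⟩

theorem bdd_add (hM : IsQuadMod M) {a b : MvPolynomial (Fin n) ℝ} (ha : Bdd M a)
    (hb : Bdd M b) : Bdd M (a + b) := by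
  obtain ⟨N, h0, h1, h2⟩ := ha
  obtain ⟨N', h0', h1', h2'⟩ := hb
  refine ⟨N + N', add_pos h0 h0', ?_, ?_⟩
  · convert hM.add h1 h1' using 1; rw [C_add]; ring
  · convert hM.add h2 h2' using 1; rw [C_add]; ring

theorem bdd_C_mul (hM : IsQuadMod M) {a : MvPolynomial (Fin n) ℝ} (ha : Bdd M a) (r : ℝ) :
    Bdd M (C r * a) := by
  have key : ∀ r : ℝ, 0 ≤ r → ∀ a, Bdd M a → Bdd M (C r * a) := by
    rintro r hr a ⟨N, h0, h1, h2⟩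
    refine ⟨r * N + 1, by positivity, ?_, ?_⟩
    · refine hM.C_sub_mono (r := r * N) (by linarith) ?_
      convert hM.C_mul_mem hr h1 using 1; rw [C_mul]; ring
    · refine hM.C_sub_mono (r := r * N) (by linarith) ?_
      convert hM.C_mul_mem hr h2 using 1; rw [C_mul]; ring
  rcases le_total 0 r with hr | hr
  · exact key r hr a ha
  · have := key (-r) (by linarith) _ ha.neg
    rwa [C_neg, neg_mul_neg] at this

theorem bdd_sq (hM : IsQuadMod M) {a : MvPolynomial (Fin n) ℝ} (ha : Bdd M a) :
    Bdd M (a ^ 2) := by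
  obtain ⟨N, h0, h1, h2⟩ := ha
  exact ⟨N ^ 2, by positivity, hM.add (hM.C_mem (by positivity)) (hM.sq_mem a),
    hM.sq_sub_sq_mem h0 h1 h2⟩

theorem bdd_mul (hM : IsQuadMod M) {a b : MvPolynomial (Fin n) ℝ} (ha : Bdd M a)
    (hb : Bdd M b) : Bdd M (a * b) := by
  have h1 := hM.bdd_C_mul (hM.bdd_add (hM.bdd_sq (hM.bdd_add ha hb))
    (hM.bdd_sq (hM.bdd_add ha hb.neg)).neg) (1 / 4)
  convert h1 using 1
  have h3 : 4 * (C (1 / 4) : MvPolynomial (Fin n) ℝ) = 1 := by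
    rw [← map_ofNat C 4, ← C_mul]; norm_num
  linear_combination -(a * b * h3)

theorem bdd_C (hM : IsQuadMod M) (r : ℝ) : Bdd M (C r) := by
  refine ⟨|r| + 1, by positivity, ?_, ?_⟩
  · rw [← C_add]; exact hM.C_mem (by linarith [neg_abs_le r])
  · rw [← C_neg, ← C_add]; exact hM.C_mem (by linarith [le_abs_self r])

theorem bdd_all (hM : IsQuadMod M) {N : ℝ} (hN : C N - ∑ i, X i ^ 2 ∈ M)
    (a : MvPolynomial (Fin n) ℝ) : Bdd M a := by
  classical
  have hX : ∀ i, Bdd M (X i) := by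
    intro i
    have h1 : C N + -X i ^ 2 ∈ M := by
      have := hM.add hN (hM.sum_mem (Finset.univ.erase i) (fun j => X j ^ 2)
        fun j _ => hM.sq_mem _)
      rw [← Finset.add_sum_erase _ _ (Finset.mem_univ i)] at this
      convert this using 1; ring
    refine ⟨max (N + 1 / 4) 1, by positivity, ?_, ?_⟩
    · exact hM.C_sub_mono (le_max_left _ _) (hM.of_sub_sq_mem h1)
    · exact hM.C_sub_mono (le_max_left _ _) (hM.of_sub_sq_mem (by rwa [neg_sq]))
  induction a using MvPolynomial.induction_on with
  | C r => exact hM.bdd_C r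
  | add p q hp hq => exact hM.bdd_add hp hq
  | mul_X p i hp => exact hM.bdd_mul hp (hX i)

/-- A maximal proper quadratic module is total. -/
theorem exists_total (hM : IsQuadMod M) (h1 : -1 ∉ M) :
    ∃ P ⊇ M, IsQuadMod P ∧ -1 ∉ P ∧ ∀ a, a ∈ P ∨ -a ∈ P := by
  obtain ⟨P, hMP, hPmax⟩ := zorn_subset_nonempty
    {P : Set (MvPolynomial (Fin n) ℝ) | IsQuadMod P ∧ -1 ∉ P} (by
    intro c hc hchain hne
    obtain ⟨P0, hP0⟩ := hne
    refine ⟨⋃₀ c, ⟨⟨⟨P0, hP0, (hc hP0).1.one⟩, ?_, ?_⟩, ?_⟩,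
      fun s hs => Set.subset_sUnion_of_mem hs⟩
    · rintro a b ⟨P, hP, ha⟩ ⟨P', hP', hb⟩
      rcases hchain.total hP hP' with h | h
      · exact ⟨P', hP', (hc hP').1.add (h ha) hb⟩
      · exact ⟨P, hP, (hc hP).1.add ha (h hb)⟩
    · rintro d a ⟨P, hP, ha⟩
      exact ⟨P, hP, (hc hP).1.sq_mul d ha⟩
    · rintro ⟨P, hP, ha⟩
      exact (hc hP).2 ha) M ⟨hM, h1⟩
  obtain ⟨hP, h1P⟩ := hPmax.prop
  refine ⟨P, hMP, hP, h1P, fun a => ?_⟩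
  have key : ∀ a, a ∉ P → ∃ p ∈ P, ∃ s, IsSumSq s ∧ -1 = p + a * s := by
    intro a ha
    by_contra hcon
    have h2 := hPmax.le_of_ge (y := {x | ∃ p ∈ P, ∃ s, IsSumSq s ∧ x = p + a * s})
      ⟨hP.adjoin a, hcon⟩ (fun p hp => ⟨p, hp, 0, IsSumSq.zero, by ring⟩)
    exact ha (h2 ⟨0, hP.zero_mem, 1, IsSumSq.one, by ring⟩)
  by_contra hcon
  push Not at hcon
  obtain ⟨p, hp, s, hs, hps⟩ := key a hcon.1
  obtain ⟨q, hq, t, ht, hqt⟩ := key (-a) hcon.2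
  have h3 : -s ∈ P := by
    have := hP.add (hP.sumSq_mem ht) (hP.add (hP.sumSq_mul ht hp) (hP.sumSq_mul hs hq))
    convert this using 1
    linear_combination t * hps + s * hqt
  have h4 : s ∈ P := hP.sumSq_mem hs
  have h5 : a * s ∈ P := by
    have h6 := hP.add (hP.sq_mul (a + 1) h4) (hP.sq_mul (a - 1) h3)
    refine hP.of_C_mul_mem (r := 4) (by norm_num) ?_
    convert h6 using 1
    rw [map_ofNat C 4]; ring
  exact h1P (hps ▸ hP.add hp h5)

theorem exists_infinitesimal (hM : IsQuadMod M) (h1 : -1 ∉ M) (htot : ∀ a, a ∈ M ∨ -a ∈ M)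
    {a : MvPolynomial (Fin n) ℝ} (ha : Bdd M a) :
    ∃ r : ℝ, ∀ ε > 0, C ε + (a - C r) ∈ M ∧ C ε + -(a - C r) ∈ M := by
  obtain ⟨N, hN, hN1, hN2⟩ := ha
  have hneg : ∀ r : ℝ, C r ∈ M → 0 ≤ r := by
    intro r hr
    by_contra h0
    push Not at h0
    apply h1
    refine hM.of_C_mul_mem (r := -r) (by linarith) ?_
    convert hr using 1
    rw [C_neg]; ring
  let U : Set ℝ := {r | C r + -a ∈ M}
  have hU : N ∈ U := hN2
  have hUb : ∀ r ∈ U, -N ≤ r := by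
    intro r hr
    have h2 := hM.add hN1 hr
    have h3 : C (N + r) ∈ M := by
      convert h2 using 1; rw [C_add]; ring
    linarith [hneg _ h3]
  refine ⟨sInf U, fun ε hε => ⟨?_, ?_⟩⟩
  · have h2 : sInf U - ε ∉ U := fun h3 => by
      linarith [csInf_le ⟨-N, fun r hr => hUb r hr⟩ h3]
    rcases htot (C (sInf U - ε) + -a) with h3 | h3
    · exact absurd h3 h2
    · convert h3 using 1; rw [C_sub]; ring
  · obtain ⟨r, hr, hrlt⟩ := exists_lt_of_csInf_lt ⟨N, hU⟩ (lt_add_of_pos_right (sInf U) hε)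
    have := hM.C_sub_mono hrlt.le hr
    convert this using 1; rw [C_add]; ring

theorem infinitesimal_mul (hM : IsQuadMod M) {a b : MvPolynomial (Fin n) ℝ}
    (ha : ∀ ε > 0, C ε + a ∈ M ∧ C ε + -a ∈ M) (hb : Bdd M b) :
    ∀ ε > 0, C ε + a * b ∈ M ∧ C ε + -(a * b) ∈ M := by
  have key : ∀ b, Bdd M b → ∀ ε > 0, C ε + a * b ∈ M := by
    rintro b ⟨N, hN, hN1, hN2⟩ ε hε
    have hb2 := hM.sq_sub_sq_mem hN hN1 hN2
    have hδ : 0 < ε / N := by positivity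
    obtain ⟨ha1, ha2⟩ := ha (ε / N) hδ
    have ha3 := hM.sq_sub_sq_mem hδ ha1 ha2
    have h2 := hM.sq_mul (C (ε / N ^ 2)) hb2
    have h3 := hM.add (hM.add ha3 h2) (hM.sq_mem (a + C (ε / N ^ 2) * b))
    refine hM.of_C_mul_mem (r := 2 * (ε / N ^ 2)) (by positivity) ?_
    convert h3 using 1
    have h4 : (C (2 * (ε / N ^ 2)) * C ε : MvPolynomial (Fin n) ℝ) =
        C ((ε / N) ^ 2) + C (ε / N ^ 2) ^ 2 * C (N ^ 2) := by
      rw [← C_pow, ← C_mul, ← C_mul, ← C_add]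
      congr 1
      field_simp
      ring
    have h5 : (C (2 * (ε / N ^ 2)) : MvPolynomial (Fin n) ℝ) = 2 * C (ε / N ^ 2) := by
      rw [C_mul, map_ofNat C 2]
    rw [mul_add, h4, h5]
    ring
  intro ε hε
  refine ⟨key b hb ε hε, ?_⟩
  rw [← mul_neg]
  exact key _ hb.neg ε hε

/-- A proper archimedean total quadratic module is nonnegative at some real point. -/
theorem exists_point (hM : IsQuadMod M) (h1 : -1 ∉ M) {N : ℝ} (hN : C N - ∑ i, X i ^ 2 ∈ M) :
    ∃ x : Fin n → ℝ, ∀ q ∈ M, 0 ≤ eval x q := by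
  obtain ⟨P, hMP, hP, h1P, htot⟩ := hM.exists_total h1
  have hb := hP.bdd_all (hMP hN)
  choose x hx using fun i => hP.exists_infinitesimal h1P htot (hb (X i))
  have key : ∀ p : MvPolynomial (Fin n) ℝ, ∀ ε > 0,
      C ε + (p - C (eval x p)) ∈ P ∧ C ε + -(p - C (eval x p)) ∈ P := by
    have hadd : ∀ a b : MvPolynomial (Fin n) ℝ, (∀ ε > 0, C ε + a ∈ P ∧ C ε + -a ∈ P) →
        (∀ ε > 0, C ε + b ∈ P ∧ C ε + -b ∈ P) →
        ∀ ε > 0, C ε + (a + b) ∈ P ∧ C ε + -(a + b) ∈ P := by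
      intro a b ha hb ε hε
      have h2 : (C ε : MvPolynomial (Fin n) ℝ) = C (ε / 2) + C (ε / 2) := by
        rw [← C_add, add_halves]
      obtain ⟨h3, h4⟩ := ha (ε / 2) (by positivity)
      obtain ⟨h5, h6⟩ := hb (ε / 2) (by positivity)
      refine ⟨?_, ?_⟩
      · convert hP.add h3 h5 using 1; rw [h2]; ring
      · convert hP.add h4 h6 using 1; rw [h2]; ring
    intro p
    induction p using MvPolynomial.induction_on with
    | C r =>
      intro ε hε
      rw [eval_C, sub_self, neg_zero, add_zero]
      exact ⟨hP.C_mem hε.le, hP.C_mem hε.le⟩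
    | add p q hp hq =>
      have := hadd _ _ hp hq
      convert this using 7 <;> rw [eval_add, C_add] <;> ring
    | mul_X p i hp =>
      have := hadd _ _ (hP.infinitesimal_mul hp (hb (X i)))
        (hP.infinitesimal_mul (hx i) (hb (C (eval x p))))
      convert this using 7 <;> rw [eval_mul, eval_X, C_mul] <;> ring
  refine ⟨x, fun q hq => ?_⟩
  by_contra h0
  push Not at h0
  obtain ⟨-, h2⟩ := key q (-(eval x q) / 2) (by linarith)
  have h3 := hP.add h2 (hMP hq)
  apply h1P
  refine hP.of_C_mul_mem (r := -(eval x q) / 2) (by linarith) ?_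
  convert h3 using 1
  have h4 : (C (eval x q) : MvPolynomial (Fin n) ℝ) =
      -(C (-(eval x q) / 2) + C (-(eval x q) / 2)) := by
    rw [← C_add, ← C_neg]; congr 1; ring
  rw [h4]; ring

theorem decrease (hM : IsQuadMod M) {N r : ℝ} {f s : MvPolynomial (Fin n) ℝ} (hN : 0 < N)
    (hs : IsSumSq s) (hfs : f * s - 1 ∈ M) (hNs : C N + -s ∈ M) (hNf : C N + -(s ^ 2 * f) ∈ M)
    (hr : 0 ≤ r) (hf : f + C r ∈ M) : f + C (r - 1 / N) ∈ M := by
  have h1 := hM.sq_mul (C N - s) hf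
  have h2 := hM.C_mul_mem (r := 2 * N) (by positivity) hfs
  have h3 := hM.C_mul_mem hr (hM.sumSq_mul hs (hM.C_sub_mono (s := 2 * N) (by linarith) hNs))
  have h4 := hM.add (hM.add (hM.add h1 h2) h3) hNf
  refine hM.of_C_mul_mem (r := N ^ 2) (by positivity) ?_
  convert h4 using 1
  have h5 : (C N * C (1 / N) : MvPolynomial (Fin n) ℝ) = 1 := by
    rw [← C_mul, mul_one_div_cancel hN.ne', C_1]
  rw [C_pow, C_sub, C_mul, map_ofNat C 2]
  linear_combination -(C N * h5)

/-- Putinar's Positivstellensatz. -/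
theorem mem_of_pos (hM : IsQuadMod M) {N : ℝ} (hN : C N - ∑ i, X i ^ 2 ∈ M)
    {f : MvPolynomial (Fin n) ℝ}
    (hf : ∀ x : Fin n → ℝ, (∀ q ∈ M, 0 ≤ eval x q) → 0 < eval x f) : f ∈ M := by
  have hneg : (-1 : MvPolynomial (Fin n) ℝ) ∈ {x | ∃ p ∈ M, ∃ s, IsSumSq s ∧ x = p + -f * s} := by
    by_contra h1
    obtain ⟨x, hx⟩ := (hM.adjoin (-f)).exists_point h1 (N := N)
      ⟨_, hN, 0, IsSumSq.zero, by ring⟩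
    have h2 := hx (-f) ⟨0, hM.zero_mem, 1, IsSumSq.one, by ring⟩
    have h3 := hf x fun q hq => hx q ⟨q, hq, 0, IsSumSq.zero, by ring⟩
    rw [map_neg] at h2
    linarith
  obtain ⟨p, hp, s, hs, hps⟩ := hneg
  have hfs : f * s - 1 ∈ M := by
    convert hp using 1
    linear_combination hps
  obtain ⟨N1, hN1, -, hNs⟩ := hM.bdd_all hN s
  obtain ⟨N2, hN2, -, hNf⟩ := hM.bdd_all hN (s ^ 2 * f)
  obtain ⟨r0, hr0, hr0f, -⟩ := hM.bdd_all hN f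
  have hK : 0 < N1 + N2 := by positivity
  replace hNs := hM.C_sub_mono (s := N1 + N2) (by linarith) hNs
  replace hNf := hM.C_sub_mono (s := N1 + N2) (by linarith) hNf
  have key : ∀ j : ℕ, f ∈ M ∨ f + C (r0 - j * (1 / (N1 + N2))) ∈ M := by
    intro j
    induction j with
    | zero => right; simpa [add_comm] using hr0f
    | succ j ih =>
      rcases ih with ih | ih
      · exact Or.inl ih
      · rcases le_total 0 (r0 - j * (1 / (N1 + N2))) with h | h
        · right
          have := hM.decrease hK hs hfs hNs hNf h ih
          convert this using 3
          push_cast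
          ring
        · left
          have := hM.add ih (hM.C_mem (r := -(r0 - j * (1 / (N1 + N2)))) (by linarith))
          convert this using 1
          rw [C_neg]; ring
  obtain ⟨j, hj⟩ := exists_nat_gt (r0 * (N1 + N2))
  rcases key j with h | h
  · exact h
  · have h2 : r0 - j * (1 / (N1 + N2)) ≤ 0 := by
      rw [mul_one_div, sub_nonpos, le_div_iff₀ hK]; exact hj.le
    have := hM.add h (hM.C_mem (r := -(r0 - j * (1 / (N1 + N2)))) (by linarith))
    convert this using 1
    rw [C_neg]; ring

theorem exists_ball (hM : IsQuadMod M) {σ : MvPolynomial (Fin n) ℝ} (hσ : σ ∈ M)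
    (hc : IsCompact {z : Fin n → ℝ | 0 ≤ eval z σ}) : ∃ N : ℝ, C N - ∑ i, X i ^ 2 ∈ M := by
  classical
  have hT := IsPreordering.isSumSq.adjoin (A := MvPolynomial (Fin n) ℝ) σ
  set T := {x | ∃ p ∈ {a : MvPolynomial (Fin n) ℝ | IsSumSq a},
    ∃ q ∈ {a : MvPolynomial (Fin n) ℝ | IsSumSq a}, x = p + σ * q} with hTdef
  have hTM : T ⊆ M := by
    rintro _ ⟨p, hp, q, hq, rfl⟩
    refine hM.add (hM.sumSq_mem hp) ?_
    rw [mul_comm]; exact hM.sumSq_mul hq hσ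
  have hσT : σ ∈ T := ⟨0, IsSumSq.zero, 1, IsSumSq.one, by ring⟩
  obtain ⟨K, hK⟩ := hc.exists_bound_of_continuousOn (f := fun z : Fin n → ℝ => ∑ i, z i ^ 2)
    (by fun_prop)
  let N := |K| + 1
  have hN : 0 < N := by positivity
  let w : MvPolynomial (Fin n) ℝ := ∑ i, X i ^ 2
  have hwT : w ∈ T := hT.sum_mem _ _ fun i _ => hT.sq _
  let q : MvPolynomial (Fin n) ℝ := C N - w
  have hneg : -1 ∈ {x | ∃ p ∈ T, ∃ t ∈ T, x = p + -q * t} := by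
    by_contra hcon
    obtain ⟨x, -, hx⟩ := (hT.adjoin (-q)).exists_point 1 (by simpa using hcon) {σ, -q} (by
      intro e he
      rw [Finset.mem_insert, Finset.mem_singleton] at he
      rcases he with rfl | rfl
      · exact ⟨_, hσT, 0, hT.zero_mem, by ring⟩
      · exact ⟨0, hT.zero_mem, 1, hT.one_mem, by ring⟩)
    have h1 := hK x (hx σ (by simp))
    have h2 := hx (-q) (by simp)
    simp only [q, w, map_neg, map_sub, eval_C, map_sum, map_pow, eval_X] at h2
    have h3 := (le_abs_self _).trans h1
    linarith [le_abs_self K, show N = |K| + 1 from rfl]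
  obtain ⟨t', ht', t, ht, htt⟩ := hneg
  have hqT : (1 + t') * q ∈ T := by
    have := hT.mul (hT.sq q) ht
    convert this using 1
    linear_combination -q * htt
  have hW := (hT.adjoin q).isQuadMod
  obtain ⟨R, hR, -, a, ha, b, hb, hab⟩ := hW.bdd_all (N := N)
    ⟨0, hT.zero_mem, 1, hT.one_mem, by ring⟩ t'
  have h2 : (1 + t') * (C R + -t') ∈ T := by
    rw [hab]
    convert hT.add (hT.mul (hT.add hT.one_mem ht') ha) (hT.mul hqT hb) using 1
    ring
  have h3 : C (R + R ^ 2 / 4) + -t' ∈ T := by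
    convert hT.add h2 (hT.sq (C (R / 2) - t')) using 1
    have e1 : (C R : MvPolynomial (Fin n) ℝ) = 2 * C (R / 2) := by
      rw [← map_ofNat C 2, ← C_mul]; congr 1; ring
    have e2 : (C (R ^ 2 / 4) : MvPolynomial (Fin n) ℝ) = C (R / 2) ^ 2 := by
      rw [← C_pow]; congr 1; ring
    rw [C_add, e2, e1]
    ring
  refine ⟨N + N * (R + R ^ 2 / 4), hTM ?_⟩
  convert hT.add (hT.add hqT (hT.mul hwT ht')) (hT.isQuadMod.C_mul_mem hN.le h3) using 1
  rw [C_add, C_mul]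
  simp only [q]
  ring

end Poly
end IsQuadMod

open scoped IntermediateField.algebraAdjoinAdjoin in
theorem Transcendental.exists_derivation {k K : Type} [Field k] [CharZero k] [Field K]
    [Algebra k K] {f : K} (hf : Transcendental k f) : ∃ D : Derivation k K K, D f ≠ 0 := by
  classical
  have hs : AlgebraicIndepOn k id ({f} : Set K) :=
    (algebraicIndependent_singleton_iff (⟨f, rfl⟩ : ({f} : Set K))).2 hf
  obtain ⟨t, hft, ht⟩ := exists_isTranscendenceBasis_superset hs
  let x : t → K := Subtype.val
  let i0 : t := ⟨f, hft rfl⟩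
  have halg := ht.isAlgebraic_field
  let S := Algebra.adjoin k (Set.range x)
  let L := IntermediateField.adjoin k (Set.range x)
  have : Algebra.FormallyEtale S L :=
    Algebra.FormallyEtale.of_isLocalization (nonZeroDivisors S)
  have : Algebra.IsAlgebraic L K := halg
  have : CharZero L := charZero_of_injective_algebraMap (algebraMap k L).injective
  have : Algebra.FormallyEtale L K := Algebra.FormallyEtale.of_isSeparable L K
  have hSK : Algebra.FormallyEtale S K := Algebra.FormallyEtale.comp S L K
  let e : MvPolynomial t k ≃ₐ[k] S := ht.1.aevalEquiv
  let d : Derivation k S K := Derivation.mk'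
    (S.val.toLinearMap ∘ₗ e.toLinearMap ∘ₗ (pderiv i0).toLinearMap ∘ₗ e.symm.toLinearMap) (by
      intro a b
      obtain ⟨a, rfl⟩ := e.surjective a
      obtain ⟨b, rfl⟩ := e.surjective b
      simp only [← map_mul, LinearMap.comp_apply, AlgEquiv.toLinearMap_apply,
        AlgEquiv.symm_apply_apply, Derivation.coeFn_coe,
        Derivation.leibniz, map_add, smul_eq_mul]
      simp only [map_mul]
      rfl)
  have hd : ∀ p, d (e p) = (e (pderiv i0 p) : K) := by
    intro p
    simp [d, Derivation.coe_mk']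
  have hbc := KaehlerDifferential.isBaseChange_of_formallyEtale k S K
  refine ⟨(hbc.lift d.liftKaehlerDifferential).compDer (KaehlerDifferential.D k K), ?_⟩
  have he : algebraMap S K (e (X i0)) = f := by
    change ((ht.1.aevalEquiv (X i0) : S) : K) = f
    simp [i0]
  have hmap := KaehlerDifferential.map_D k k S K (e (X i0))
  rw [he] at hmap
  change hbc.lift d.liftKaehlerDifferential (KaehlerDifferential.D k K f) ≠ 0
  rw [← hmap, hbc.lift_eq, Derivation.liftKaehlerDifferential_comp_D, hd, pderiv_X_self, map_one]
  exact one_ne_zero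

theorem Derivation.algHom_apply_eq_sum {n : ℕ} {K : Type} [Field K] [Algebra ℝ K]
    (D : Derivation ℝ K K) (θ : MvPolynomial (Fin n) ℝ →ₐ[ℝ] K) (p : MvPolynomial (Fin n) ℝ) :
    D (θ p) = ∑ j, θ (pderiv j p) * D (θ (X j)) := by
  classical
  induction p using MvPolynomial.induction_on with
  | C r =>
    have : θ (C r) = algebraMap ℝ K r := θ.commutes r
    simp [this]
  | add p q hp hq => simp [hp, hq, add_mul, Finset.sum_add_distrib]
  | mul_X p i hp =>
    simp only [map_mul, Derivation.leibniz, smul_eq_mul, map_add, pderiv_X, add_mul,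
      Finset.sum_add_distrib, hp]
    congr 1
    · rw [Finset.sum_eq_single i]
      · simp
      · intro j _ hj
        simp [hj.symm]
      · simp
    · rw [Finset.mul_sum]
      exact Finset.sum_congr rfl fun j _ => by ring

/-- If all derivations of residue fields of `I` kill `f`, then `f` is algebraic modulo `I`. -/
theorem exists_aeval_mem_of_derivation {n : ℕ} (I : Ideal (MvPolynomial (Fin n) ℝ))
    (f : MvPolynomial (Fin n) ℝ)
    (h : ∀ (K : Type) [Field K] [Algebra ℝ K] (θ : MvPolynomial (Fin n) ℝ →ₐ[ℝ] K)
      (D : Derivation ℝ K K), (∀ a ∈ I, θ a = 0) → D (θ f) = 0) :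
    ∃ p : Polynomial ℝ, p ≠ 0 ∧ Polynomial.aeval f p ∈ I := by
  by_contra! hcon
  obtain ⟨P, hP, hIP, hdisj⟩ := Ideal.exists_le_prime_disjoint I
    ((nonZeroDivisors (Polynomial ℝ)).map (Polynomial.aeval f : Polynomial ℝ →ₐ[ℝ] _)) (by
      rw [Set.disjoint_left]
      rintro _ ha ⟨p, hp, rfl⟩
      exact hcon p (nonZeroDivisors.ne_zero hp) ha)
  let θ : MvPolynomial (Fin n) ℝ →ₐ[ℝ] FractionRing (MvPolynomial (Fin n) ℝ ⧸ P) :=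
    (IsScalarTower.toAlgHom ℝ (MvPolynomial (Fin n) ℝ ⧸ P) _).comp (Ideal.Quotient.mkₐ ℝ P)
  have hθ : ∀ a, θ a = 0 ↔ a ∈ P := fun a => by
    change algebraMap _ (FractionRing (MvPolynomial (Fin n) ℝ ⧸ P)) (Ideal.Quotient.mk P a) = 0 ↔ _
    rw [map_eq_zero_iff _ (IsFractionRing.injective _ _), Ideal.Quotient.eq_zero_iff_mem]
  have htr : Transcendental ℝ (θ f) := by
    rw [transcendental_iff]
    intro p hp
    by_contra hp0
    rw [Polynomial.aeval_algHom_apply, hθ] at hp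
    exact Set.disjoint_left.1 hdisj hp ⟨p, mem_nonZeroDivisors_of_ne_zero hp0, rfl⟩
  obtain ⟨D, hD⟩ := htr.exists_derivation
  exact hD (h _ θ D fun a ha => (hθ a).2 (hIP ha))

theorem MvPolynomial.hasStrictFDerivAt_eval {n : ℕ} (p : MvPolynomial (Fin n) ℝ)
    (x : Fin n → ℝ) :
    HasStrictFDerivAt (fun y => eval y p)
      (∑ j, eval x (pderiv j p) • (ContinuousLinearMap.proj j : (Fin n → ℝ) →L[ℝ] ℝ)) x := by
  classical
  induction p using MvPolynomial.induction_on with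
  | C r =>
    simp only [eval_C, pderiv_C, map_zero, zero_smul, Finset.sum_const_zero]
    exact hasStrictFDerivAt_const r x
  | add p q hp hq =>
    simp only [map_add, add_smul, Finset.sum_add_distrib]
    exact hp.add hq
  | mul_X p i hp =>
    simp only [map_mul, eval_X]
    refine (hp.mul (hasStrictFDerivAt_apply i x)).congr_fderiv ?_
    simp only [Derivation.leibniz, map_add, smul_eq_mul, map_mul, eval_X, add_smul,
      Finset.sum_add_distrib, Finset.smul_sum, mul_smul]
    congr 1
    rw [← Finset.smul_sum, Finset.sum_eq_single i]
    · simp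
    · intro j _ hj
      simp [pderiv_X_of_ne hj.symm]
    · simp

open Topology in
/-- Nonnegativity of the Lagrange multiplier of an active inequality constraint. -/
theorem eval_lamSub_nonneg {n l : ℕ} {E1 E2 : Finset (Fin l)}
    (hXd : Disjoint E1 E2) (g : Fin l → MvPolynomial (Fin n) ℝ)
    (G1 : Matrix (Fin l) (Fin n ⊕ Fin l) (MvPolynomial (Fin n) ℝ))
    {x0 : Fin n → ℝ}
    (hG1 : (Matrix.of fun i j => eval x0 (G1 i j)) * Gmat g x0 = 1)
    (f : MvPolynomial (Fin n) ℝ) (hx0 : x0 ∈ SemiSet E1 E2 g)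
    (hmin : ∀ x ∈ SemiSet E1 E2 g, eval x0 f ≤ eval x f) {i : Fin l} (hi : i ∈ E2)
    (hact : eval x0 (g i) = 0) : 0 ≤ eval x0 (lamSub G1 f i) := by
  classical
  let A := {c : Fin l // eval x0 (g c) = 0}
  let B : (A → ℝ) →L[ℝ] (Fin n → ℝ) := ContinuousLinearMap.pi fun j =>
    ∑ a : A, eval x0 (G1 a.1 (Sum.inl j)) • (ContinuousLinearMap.proj a : (A → ℝ) →L[ℝ] ℝ)
  have hBapply : ∀ v j, B v j = ∑ a : A, eval x0 (G1 a.1 (Sum.inl j)) * v a := by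
    intro v j; simp [B]
  have hdual : ∀ (a c : A), ∑ j, eval x0 (pderiv j (g c.1)) * eval x0 (G1 a.1 (Sum.inl j)) =
      if a = c then 1 else 0 := by
    intro a c
    have h1 := congrFun (congrFun hG1 a.1) c.1
    rw [Matrix.mul_apply, Fintype.sum_sum_type, Matrix.one_apply] at h1
    simp only [Gmat, Matrix.of_apply, c.2, ite_self, mul_zero, Finset.sum_const_zero,
      add_zero] at h1
    have h2 : (a.1 = c.1) = (a = c) := propext Subtype.ext_iff.symm
    simp only [h2] at h1
    rw [← h1]
    exact Finset.sum_congr rfl fun j _ => mul_comm _ _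
  let Φ : (A → ℝ) → (A → ℝ) := fun v c => eval (x0 + B v) (g c.1)
  have hB0 : x0 + B 0 = x0 := by simp
  have hpoly : ∀ p : MvPolynomial (Fin n) ℝ, HasStrictFDerivAt (fun v => eval (x0 + B v) p)
      ((∑ j, eval x0 (pderiv j p) • (ContinuousLinearMap.proj j : (Fin n → ℝ) →L[ℝ] ℝ)).comp B)
      0 := by
    intro p
    have h1 := p.hasStrictFDerivAt_eval (x0 + B 0)
    rw [hB0] at h1
    have h2 : HasStrictFDerivAt (fun v => x0 + B v) B 0 := B.hasStrictFDerivAt.const_add x0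
    rw [← hB0] at h1
    have := h1.comp 0 h2
    rw [hB0] at this
    exact this
  have hΦ : HasStrictFDerivAt Φ ((ContinuousLinearEquiv.refl ℝ (A → ℝ) : _ ≃L[ℝ] _) :
      (A → ℝ) →L[ℝ] (A → ℝ)) 0 := by
    rw [hasStrictFDerivAt_pi']
    intro c
    refine (hpoly (g c.1)).congr_fderiv (ContinuousLinearMap.ext fun v => ?_)
    simp only [ContinuousLinearMap.comp_apply, ContinuousLinearMap.proj_apply,
      ContinuousLinearEquiv.coe_coe, ContinuousLinearEquiv.refl_apply,
      _root_.sum_apply, _root_.smul_apply, smul_eq_mul, hBapply,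
      Finset.mul_sum]
    rw [Finset.sum_comm]
    simp only [← mul_assoc, ← Finset.sum_mul, hdual, ite_mul, one_mul, zero_mul]
    exact (Finset.sum_eq_single c (fun b _ hb => if_neg hb)
      (fun h => absurd (Finset.mem_univ c) h)).trans (if_pos rfl)
  have hΦ0 : Φ 0 = 0 := by
    funext c; simp only [Φ, hB0]; exact c.2
  let i' : A := ⟨i, hact⟩
  let e : A → ℝ := Pi.single i' 1
  let k := hΦ.localInverse Φ _ 0
  have hk : HasStrictFDerivAt k (ContinuousLinearMap.id ℝ (A → ℝ)) 0 := by
    have := hΦ.to_localInverse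
    rw [hΦ0] at this
    exact this
  have hk0 : k 0 = 0 := by
    have := hΦ.localInverse_apply_image
    rwa [hΦ0] at this
  have hkr : ∀ᶠ y in 𝓝 (0 : A → ℝ), Φ (k y) = y := by
    have := hΦ.eventually_right_inverse
    rwa [hΦ0] at this
  have hline : HasDerivAt (fun s : ℝ => s • e) e 0 := by
    simpa using (hasDerivAt_id (0 : ℝ)).smul_const e
  have hγ : HasDerivAt (fun s : ℝ => k (s • e)) e 0 := by
    have h1 : HasFDerivAt k (ContinuousLinearMap.id ℝ (A → ℝ)) ((0 : ℝ) • e) := by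
      rw [zero_smul]; exact hk.hasFDerivAt
    exact h1.comp_hasDerivAt (0 : ℝ) hline
  have hγ0 : k ((0 : ℝ) • e) = 0 := by rw [zero_smul, hk0]
  have hχ : HasDerivAt (fun s : ℝ => eval (x0 + B (k (s • e))) f) (eval x0 (lamSub G1 f i)) 0 := by
    have h1 := (hpoly f).hasFDerivAt
    rw [← hγ0] at h1
    have h2 := h1.comp_hasDerivAt (0 : ℝ) hγ
    refine h2.congr_deriv ?_
    simp only [lamSub, map_sum, map_mul, ContinuousLinearMap.comp_apply,
      ContinuousLinearMap.proj_apply, _root_.sum_apply,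
      _root_.smul_apply, smul_eq_mul, hBapply]
    refine Finset.sum_congr rfl fun j _ => ?_
    rw [mul_comm, Finset.sum_eq_single i']
    · simp [e, i']
    · intro a _ ha
      simp [e, ha]
    · simp
  have hslope := (hasDerivWithinAt_iff_tendsto_slope' (s := Set.Ioi (0 : ℝ)) (by simp)).1
    hχ.hasDerivWithinAt
  refine ge_of_tendsto hslope ?_
  have hcont : Filter.Tendsto (fun s : ℝ => x0 + B (k (s • e))) (𝓝[>] 0) (𝓝 x0) := by
    have h1 : ContinuousAt (fun s : ℝ => x0 + B (k (s • e))) 0 :=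
      (B.continuous.continuousAt.comp hγ.continuousAt).const_add x0
    have h2 := h1.tendsto
    simp only [hγ0, map_zero, add_zero] at h2
    exact h2.mono_left nhdsWithin_le_nhds
  have hin : ∀ᶠ s in 𝓝[>] (0 : ℝ), ∀ c : Fin l, 0 < eval x0 (g c) →
      0 < eval (x0 + B (k (s • e))) (g c) := by
    rw [Filter.eventually_all]
    intro c
    by_cases hc : 0 < eval x0 (g c)
    · have h1 : Filter.Tendsto (fun s : ℝ => eval (x0 + B (k (s • e))) (g c)) (𝓝[>] 0)
          (𝓝 (eval x0 (g c))) :=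
        ((MvPolynomial.continuous_eval (g c)).tendsto x0).comp hcont
      filter_upwards [h1.eventually_const_lt hc] with s hs _ using hs
    · exact Filter.Eventually.of_forall fun s h => absurd h hc
  have hright : ∀ᶠ s in 𝓝[>] (0 : ℝ), Φ (k (s • e)) = s • e := by
    have h1 : Filter.Tendsto (fun s : ℝ => s • e) (𝓝[>] 0) (𝓝 0) := by
      have := hline.continuousAt.tendsto
      simp only [zero_smul] at this
      exact this.mono_left nhdsWithin_le_nhds
    exact h1.eventually hkr
  filter_upwards [hin, hright, self_mem_nhdsWithin] with s h1 h2 hs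
  have hactive : ∀ c : A, eval (x0 + B (k (s • e))) (g c.1) = s * e c := fun c => congrFun h2 c
  have hmem : x0 + B (k (s • e)) ∈ SemiSet E1 E2 g := by
    refine ⟨fun c hc => ?_, fun c hc => ?_⟩
    · have h3 := hactive ⟨c, hx0.1 c hc⟩
      rw [h3]
      have h4 : (⟨c, hx0.1 c hc⟩ : A) ≠ i' := by
        intro h5
        have : c = i := congrArg Subtype.val h5
        exact Finset.disjoint_left.1 hXd hc (this ▸ hi)
      simp [e, h4]
    · rcases (hx0.2 c hc).lt_or_eq with h | h
      · exact (h1 c h).le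
      · rw [hactive ⟨c, h.symm⟩]
        refine mul_nonneg (le_of_lt hs) ?_
        simp only [e, Pi.single_apply]
        split_ifs <;> norm_num
  rw [slope_def_field]
  refine div_nonneg ?_ (by simpa using (le_of_lt hs))
  have := hmin _ hmem
  simp only [hγ0, map_zero, add_zero]
  linarith

section Riesz

variable {σ : Type}

theorem riesz_eq_sum (w : (σ →₀ ℕ) → ℝ) (f : MvPolynomial σ ℝ) {s : Finset (σ →₀ ℕ)}
    (hs : f.support ⊆ s) : riesz w f = ∑ α ∈ s, f.coeff α * w α :=
  Finset.sum_subset hs fun α _ hα => by rw [notMem_support_iff.1 hα, zero_mul]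

theorem riesz_add (w : (σ →₀ ℕ) → ℝ) (f g : MvPolynomial σ ℝ) :
    riesz w (f + g) = riesz w f + riesz w g := by
  classical
  rw [riesz_eq_sum w (f + g) (support_add (p := f) (q := g)),
    riesz_eq_sum w f Finset.subset_union_left,
    riesz_eq_sum w g Finset.subset_union_right, ← Finset.sum_add_distrib]
  exact Finset.sum_congr rfl fun α _ => by rw [coeff_add, add_mul]

theorem riesz_smul (w : (σ →₀ ℕ) → ℝ) (r : ℝ) (f : MvPolynomial σ ℝ) :
    riesz w (r • f) = r * riesz w f := by
  rw [riesz_eq_sum w (r • f) support_smul, riesz, Finset.mul_sum]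
  exact Finset.sum_congr rfl fun α _ => by rw [coeff_smul, smul_eq_mul, mul_assoc]

theorem riesz_monomial (w : (σ →₀ ℕ) → ℝ) (α : σ →₀ ℕ) : riesz w (monomial α 1) = w α := by
  classical
  rw [riesz_eq_sum w _ support_monomial_subset]
  simp

/-- The Riesz functional as a linear map. -/
def rieszLin (w : (σ →₀ ℕ) → ℝ) : MvPolynomial σ ℝ →ₗ[ℝ] ℝ where
  toFun := riesz w
  map_add' := riesz_add w
  map_smul' := riesz_smul w

theorem riesz_eq_rieszLin (w : (σ →₀ ℕ) → ℝ) (f : MvPolynomial σ ℝ) :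
    riesz w f = rieszLin w f := rfl

theorem riesz_C_mul (w : (σ →₀ ℕ) → ℝ) (r : ℝ) (f : MvPolynomial σ ℝ) :
    riesz w (C r * f) = r * riesz w f := by
  rw [← smul_eq_C_mul, riesz_smul]

theorem riesz_C (w : (σ →₀ ℕ) → ℝ) (r : ℝ) : riesz w (C r) = r * w 0 := by
  have := riesz_C_mul w r (monomial 0 1)
  rwa [riesz_monomial, ← C_apply, C_1, mul_one] at this

/-- The Riesz functional of the sequence of values of all monomials at a point. -/
theorem riesz_eval (x : σ → ℝ) (f : MvPolynomial σ ℝ) :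
    riesz (fun α => eval x (monomial α 1)) f = eval x f := by
  conv_rhs => rw [f.as_sum, map_sum]
  refine Finset.sum_congr rfl fun α _ => ?_
  simp only [eval_monomial, one_mul]

end Riesz

section MomIdx

variable {σ : Type} [Fintype σ] [DecidableEq σ]

theorem MomIdx.exp_injective {t : ℕ} :
    Function.Injective (MomIdx.exp : MomIdx σ t → σ →₀ ℕ) := by
  intro a b h
  refine Subtype.ext (funext fun i => Fin.ext ?_)
  exact DFunLike.congr_fun h i

theorem MomIdx.exists_exp {t : ℕ} {α : σ →₀ ℕ} (hα : α.degree ≤ t) :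
    ∃ a : MomIdx σ t, a.exp = α := by
  rw [Finsupp.degree_eq_sum] at hα
  have h : ∀ i, α i < t + 1 := fun i =>
    Nat.lt_succ_of_le ((Finset.single_le_sum (fun _ _ => Nat.zero_le _)
      (Finset.mem_univ i)).trans hα)
  exact ⟨⟨fun i => ⟨α i, h i⟩, hα⟩, Finsupp.ext fun i => rfl⟩

theorem MomIdx.degree_exp {t : ℕ} (a : MomIdx σ t) : a.exp.degree ≤ t := by
  rw [Finsupp.degree_eq_sum]
  exact a.2

theorem sum_momIdx_monomial {t : ℕ} {f : MvPolynomial σ ℝ} (hf : f.totalDegree ≤ t) :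
    ∑ a : MomIdx σ t, f.coeff a.exp • monomial a.exp (1 : ℝ) = f := by
  classical
  ext α
  rw [coeff_sum]
  by_cases hα : α.degree ≤ t
  · obtain ⟨a, rfl⟩ := MomIdx.exists_exp hα
    rw [Finset.sum_eq_single a]
    · simp
    · intro b _ hb
      rw [coeff_smul, coeff_monomial, if_neg fun h => hb (MomIdx.exp_injective h), smul_zero]
    · simp
  · rw [coeff_eq_zero_of_totalDegree_lt]
    · refine Finset.sum_eq_zero fun b _ => ?_
      rw [coeff_smul, coeff_monomial, if_neg, smul_zero]
      rintro rfl
      exact hα b.degree_exp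
    · exact lt_of_le_of_lt hf (not_le.1 hα)

theorem riesz_mul_mul (w : (σ →₀ ℕ) → ℝ) (q : MvPolynomial σ ℝ) {t : ℕ} {f g : MvPolynomial σ ℝ}
    (hf : f.totalDegree ≤ t) (hg : g.totalDegree ≤ t) :
    riesz w (q * (f * g)) = (fun a : MomIdx σ t => f.coeff a.exp) ⬝ᵥ
      (Matrix.of fun a b : MomIdx σ t => riesz w (q * monomial (a.exp + b.exp) 1)).mulVec
        fun a => g.coeff a.exp := by
  conv_lhs => rw [← sum_momIdx_monomial hf, ← sum_momIdx_monomial hg]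
  simp only [dotProduct, Matrix.mulVec, Matrix.of_apply, Finset.mul_sum, Finset.sum_mul,
    riesz_eq_rieszLin, map_sum]
  rw [Finset.sum_comm]
  refine Finset.sum_congr rfl fun a _ => Finset.sum_congr rfl fun b _ => ?_
  rw [smul_mul_smul_comm, monomial_mul, mul_one, mul_smul_comm, map_smul, smul_eq_mul]
  ring

variable {ι κ : Type*} {φ : ι → MvPolynomial σ ℝ} {ψ : κ → MvPolynomial σ ℝ} {k : ℕ}
  {w : (σ →₀ ℕ) → ℝ}

theorem locMat_nonneg {q : MvPolynomial σ ℝ} (hw : (locMat k q w).PosSemidef)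
    {a : MvPolynomial σ ℝ} (ha : a.totalDegree ≤ k - (q.totalDegree + 1) / 2) :
    0 ≤ riesz w (q * a ^ 2) := by
  rw [sq, riesz_mul_mul w q ha ha]
  exact hw.dotProduct_mulVec_nonneg fun b => a.coeff b.exp

theorem RelaxFeasible.ineq_nonneg (hw : RelaxFeasible k φ ψ w) (j : κ) {a : MvPolynomial σ ℝ}
    (ha : a.totalDegree ≤ k - ((ψ j).totalDegree + 1) / 2) : 0 ≤ riesz w (ψ j * a ^ 2) :=
  locMat_nonneg (hw.2.2.2 j) ha

theorem RelaxFeasible.eq_zero (hw : RelaxFeasible k φ ψ w) (i : ι) {a : MvPolynomial σ ℝ}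
    (ha : a.totalDegree ≤ k - ((φ i).totalDegree + 1) / 2) : riesz w (φ i * a) = 0 := by
  have h := riesz_mul_mul w (φ i) ha (g := 1) (by simp)
  rw [mul_one] at h
  rw [h]
  have h2 : (Matrix.of fun a b => riesz w (φ i * monomial (a.exp + b.exp) 1)) = locMat k (φ i) w :=
    rfl
  rw [h2, hw.2.2.1 i, Matrix.zero_mulVec, dotProduct_zero]

theorem locMat_one : Matrix.of (fun a b : MomIdx σ k => riesz w (1 * monomial (a.exp + b.exp) 1)) =
    momMat k w := by
  ext a b
  simp [momMat, riesz_monomial]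

theorem RelaxFeasible.sq_nonneg (hw : RelaxFeasible k φ ψ w) {a : MvPolynomial σ ℝ}
    (ha : a.totalDegree ≤ k) : 0 ≤ riesz w (a ^ 2) := by
  have h := riesz_mul_mul w 1 ha ha
  rw [locMat_one, one_mul, ← sq] at h
  rw [h]
  exact hw.2.1.dotProduct_mulVec_nonneg fun b => a.coeff b.exp

/-- Elements of the kernel of the moment matrix annihilate everything of small degree. -/
theorem RelaxFeasible.mul_eq_zero (hw : RelaxFeasible k φ ψ w) {a b : MvPolynomial σ ℝ}
    (ha : a.totalDegree ≤ k) (hb : b.totalDegree ≤ k) (h0 : riesz w (a ^ 2) ≤ 0) :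
    riesz w (a * b) = 0 := by
  have key : ∀ t : ℝ, 0 ≤ riesz w (b ^ 2) + 2 * t * riesz w (a * b) := by
    intro t
    have hdeg : (b + C t * a).totalDegree ≤ k := by
      refine (totalDegree_add _ _).trans (max_le hb ?_)
      refine (totalDegree_mul _ _).trans ?_
      simpa using ha
    have h1 := hw.sq_nonneg hdeg
    have h2 : (b + C t * a) ^ 2 = b ^ 2 + (C (2 * t) * (a * b) + C (t ^ 2) * a ^ 2) := by
      rw [C_mul, C_pow, map_ofNat C 2]; ring
    rw [h2, riesz_add, riesz_add, riesz_C_mul, riesz_C_mul] at h1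
    nlinarith [_root_.sq_nonneg t, mul_nonneg (_root_.sq_nonneg t) (neg_nonneg.2 h0)]
  by_contra h
  have h1 := key (-(riesz w (b ^ 2) + 1) / (2 * riesz w (a * b)))
  have h2 : 2 * (-(riesz w (b ^ 2) + 1) / (2 * riesz w (a * b))) * riesz w (a * b) =
      -(riesz w (b ^ 2) + 1) := by
    field_simp
  linarith

/-- The sequence of monomial values at a feasible point is feasible. -/
theorem relaxFeasible_eval (k : ℕ) {x : σ → ℝ} (hφ : ∀ i, eval x (φ i) = 0)
    (hψ : ∀ j, 0 ≤ eval x (ψ j)) :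
    RelaxFeasible k φ ψ fun α => eval x (monomial α 1) := by
  refine ⟨by simp, ?_, fun i => ?_, fun j => ?_⟩
  · have h : momMat k (fun α => eval x (monomial α 1)) = Matrix.vecMulVec
        (fun a : MomIdx σ k => eval x (monomial a.exp 1))
        (star fun a : MomIdx σ k => eval x (monomial a.exp 1)) := by
      ext a b
      simp only [momMat, Matrix.of_apply, Matrix.vecMulVec_apply, star_trivial]
      rw [← map_mul, monomial_mul, mul_one]
    rw [h]
    exact Matrix.posSemidef_vecMulVec_self_star _
  · ext a b
    rw [locMat, Matrix.of_apply, riesz_eval, map_mul, hφ, zero_mul, Matrix.zero_apply]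
  · have h : locMat k (ψ j) (fun α => eval x (monomial α 1)) = eval x (ψ j) • Matrix.vecMulVec
        (fun a : MomIdx σ _ => eval x (monomial a.exp 1))
        (star fun a : MomIdx σ _ => eval x (monomial a.exp 1)) := by
      ext a b
      simp only [locMat, Matrix.of_apply, Matrix.smul_apply, Matrix.vecMulVec_apply,
        star_trivial, riesz_eval, smul_eq_mul]
      rw [map_mul, ← map_mul (eval x) (monomial a.exp 1), monomial_mul, mul_one]
    rw [h]
    exact (Matrix.posSemidef_vecMulVec_self_star _).smul (hψ j)

end MomIdx

section QuadMod

variable {A : Type} [CommRing A]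

theorem IsQuadMod.add_ideal {M : Set A} (hM : IsQuadMod M) (I : Ideal A) :
    IsQuadMod {x | ∃ p ∈ M, ∃ u ∈ I, x = p + u} where
  one := ⟨1, hM.one, 0, I.zero_mem, by ring⟩
  add := by
    rintro _ _ ⟨p, hp, q, hq, rfl⟩ ⟨p', hp', q', hq', rfl⟩
    exact ⟨p + p', hM.add hp hp', q + q', I.add_mem hq hq', by ring⟩
  sq_mul := by
    rintro c _ ⟨p, hp, q, hq, rfl⟩
    exact ⟨c ^ 2 * p, hM.sq_mul c hp, c ^ 2 * q, I.mul_mem_left _ hq, by ring⟩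

theorem IsPreordering.add_ideal {T : Set A} (hT : IsPreordering T) (I : Ideal A) :
    IsPreordering {x | ∃ p ∈ T, ∃ u ∈ I, x = p + u} where
  add := by
    rintro _ _ ⟨p, hp, q, hq, rfl⟩ ⟨p', hp', q', hq', rfl⟩
    exact ⟨p + p', hT.add hp hp', q + q', I.add_mem hq hq', by ring⟩
  mul := by
    rintro _ _ ⟨p, hp, q, hq, rfl⟩ ⟨p', hp', q', hq', rfl⟩
    refine ⟨p * p', hT.mul hp hp', p * q' + q * (p' + q'),
      I.add_mem (I.mul_mem_left _ hq') (I.mul_mem_right _ hq), by ring⟩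
  sq := fun a => ⟨a ^ 2, hT.sq a, 0, I.zero_mem, by ring⟩

theorem isSOS_iff_isSumSq {σ : Type} {p : MvPolynomial σ ℝ} : IsSOS p ↔ IsSumSq p := by
  constructor
  · rintro ⟨t, s, rfl⟩
    exact IsSumSq.sum fun i _ => (IsSquare.sq _).isSumSq
  · intro h
    induction h with
    | zero => exact ⟨0, Fin.elim0, by simp⟩
    | sq_add a _ ih =>
      obtain ⟨t, s, rfl⟩ := ih
      exact ⟨t + 1, Fin.cons a s, by rw [Fin.sum_univ_succ]; simp [sq]⟩

variable {σ : Type} {ι κ : Type*} [Fintype ι] [Fintype κ]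
  {φ : ι → MvPolynomial σ ℝ} {ψ : κ → MvPolynomial σ ℝ}

theorem isQuadMod_inIQ (φ : ι → MvPolynomial σ ℝ) (ψ : κ → MvPolynomial σ ℝ) :
    IsQuadMod {f | InIQ φ ψ f} where
  one := ⟨0, 1, 0, isSOS_iff_isSumSq.2 IsSumSq.one, fun _ => isSOS_iff_isSumSq.2 IsSumSq.zero,
    by simp⟩
  add := by
    rintro _ _ ⟨p, s, τ, hs, hτ, rfl⟩ ⟨p', s', τ', hs', hτ', rfl⟩
    simp only [isSOS_iff_isSumSq] at *
    refine ⟨p + p', s + s', τ + τ', isSOS_iff_isSumSq.2 (hs.add hs'),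
      fun j => isSOS_iff_isSumSq.2 ((hτ j).add (hτ' j)), ?_⟩
    simp only [Pi.add_apply, mul_add, Finset.sum_add_distrib]
    ring
  sq_mul := by
    rintro c _ ⟨p, s, τ, hs, hτ, rfl⟩
    simp only [isSOS_iff_isSumSq] at *
    have hc : IsSumSq (c ^ 2) := (IsSquare.sq c).isSumSq
    refine ⟨fun i => c ^ 2 * p i, c ^ 2 * s, fun j => c ^ 2 * τ j,
      isSOS_iff_isSumSq.2 (hc.mul hs), fun j => isSOS_iff_isSumSq.2 (hc.mul (hτ j)), ?_⟩
    simp only [mul_add, Finset.mul_sum, mul_left_comm]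

theorem inIQ_of_mem_span {f : MvPolynomial σ ℝ} (hf : f ∈ Ideal.span (Set.range φ)) :
    InIQ φ ψ f := by
  obtain ⟨c, hc⟩ := (Ideal.mem_span_range_iff_exists_fun).1 hf
  refine ⟨c, 0, 0, isSOS_iff_isSumSq.2 IsSumSq.zero, fun _ => isSOS_iff_isSumSq.2 IsSumSq.zero, ?_⟩
  simp [← hc, mul_comm]

theorem inIQ_ineq (φ : ι → MvPolynomial σ ℝ) (ψ : κ → MvPolynomial σ ℝ) (j : κ) :
    InIQ φ ψ (ψ j) := by
  classical
  refine ⟨0, 0, Pi.single j 1, isSOS_iff_isSumSq.2 IsSumSq.zero, fun i => ?_, ?_⟩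
  · rw [isSOS_iff_isSumSq]
    by_cases h : i = j
    · subst h; simp
    · simp [h]
  · simp [Pi.single_apply]

theorem InIQ.eval_nonneg {f : MvPolynomial σ ℝ} (hf : InIQ φ ψ f) {x : σ → ℝ}
    (hφ : ∀ i, eval x (φ i) = 0) (hψ : ∀ j, 0 ≤ eval x (ψ j)) : 0 ≤ eval x f := by
  obtain ⟨p, s, τ, ⟨t, a, rfl⟩, hτ, rfl⟩ := hf
  simp only [map_add, map_sum, map_mul, hφ, zero_mul, Finset.sum_const_zero, zero_add, map_pow]
  refine add_nonneg (Finset.sum_nonneg fun _ _ => sq_nonneg _)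
    (Finset.sum_nonneg fun j _ => mul_nonneg (hψ j) ?_)
  obtain ⟨t', b, hb⟩ := hτ j
  rw [hb, map_sum]
  exact Finset.sum_nonneg fun _ _ => by rw [map_pow]; exact sq_nonneg _

end QuadMod

section EvNonneg

open Filter

variable {σ : Type} {𝒞 : ℕ → ((σ →₀ ℕ) → ℝ) → Prop}

/-- The Riesz functional of every sequence in `𝒞 k` is nonnegative at `q`, for all large `k`. -/
def EvNonneg (𝒞 : ℕ → ((σ →₀ ℕ) → ℝ) → Prop) (q : MvPolynomial σ ℝ) : Prop :=
  ∀ᶠ k in atTop, ∀ w, 𝒞 k w → 0 ≤ riesz w q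

theorem EvNonneg.add {p q : MvPolynomial σ ℝ} (hp : EvNonneg 𝒞 p) (hq : EvNonneg 𝒞 q) :
    EvNonneg 𝒞 (p + q) := by
  filter_upwards [hp, hq] with k h1 h2 w hw
  rw [riesz_add]
  exact add_nonneg (h1 w hw) (h2 w hw)

theorem EvNonneg.C_mul {p : MvPolynomial σ ℝ} (hp : EvNonneg 𝒞 p) {r : ℝ} (hr : 0 ≤ r) :
    EvNonneg 𝒞 (C r * p) := by
  filter_upwards [hp] with k h1 w hw
  rw [riesz_C_mul]
  exact mul_nonneg hr (h1 w hw)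

theorem EvNonneg.sum {ι : Type*} (s : Finset ι) (f : ι → MvPolynomial σ ℝ)
    (hf : ∀ i ∈ s, EvNonneg 𝒞 (f i)) : EvNonneg 𝒞 (∑ i ∈ s, f i) := by
  refine Finset.sum_induction f (EvNonneg 𝒞) (fun _ _ => EvNonneg.add) ?_ hf
  exact Eventually.of_forall fun k w _ => by simp [riesz]

variable [Fintype σ] [DecidableEq σ] {ι κ : Type*}
  {φ : ι → MvPolynomial σ ℝ} {ψ : κ → MvPolynomial σ ℝ}

theorem evNonneg_sq (h𝒞 : ∀ k w, 𝒞 k w → RelaxFeasible k φ ψ w) (a : MvPolynomial σ ℝ) :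
    EvNonneg 𝒞 (a ^ 2) := by
  filter_upwards [eventually_ge_atTop a.totalDegree] with k hk w hw
  exact (h𝒞 k w hw).sq_nonneg hk

theorem evNonneg_ineq (h𝒞 : ∀ k w, 𝒞 k w → RelaxFeasible k φ ψ w) (j : κ)
    (a : MvPolynomial σ ℝ) : EvNonneg 𝒞 (ψ j * a ^ 2) := by
  filter_upwards [eventually_ge_atTop (a.totalDegree + ((ψ j).totalDegree + 1) / 2)]
    with k hk w hw
  exact (h𝒞 k w hw).ineq_nonneg j (Nat.le_sub_of_add_le hk)

theorem evNonneg_eq (h𝒞 : ∀ k w, 𝒞 k w → RelaxFeasible k φ ψ w) (i : ι)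
    (a : MvPolynomial σ ℝ) : EvNonneg 𝒞 (φ i * a) := by
  filter_upwards [eventually_ge_atTop (a.totalDegree + ((φ i).totalDegree + 1) / 2)]
    with k hk w hw
  exact ((h𝒞 k w hw).eq_zero i (Nat.le_sub_of_add_le hk)).ge

theorem InIQ.evNonneg [Fintype ι] [Fintype κ] (h𝒞 : ∀ k w, 𝒞 k w → RelaxFeasible k φ ψ w)
    {f : MvPolynomial σ ℝ} (hf : InIQ φ ψ f) : EvNonneg 𝒞 f := by
  obtain ⟨p, s, τ, ⟨t, a, rfl⟩, hτ, rfl⟩ := hf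
  refine ((EvNonneg.sum _ _ fun i _ => evNonneg_eq h𝒞 i (p i)).add
    (EvNonneg.sum _ _ fun i _ => evNonneg_sq h𝒞 (a i))).add (EvNonneg.sum _ _ fun j _ => ?_)
  obtain ⟨t', b, hb⟩ := hτ j
  rw [hb, Finset.mul_sum]
  exact EvNonneg.sum _ _ fun i _ => evNonneg_ineq h𝒞 j (b i)

theorem eventually_riesz_mul_eq_zero (h𝒞 : ∀ k w, 𝒞 k w → RelaxFeasible k φ ψ w)
    {q : MvPolynomial σ ℝ} (hq : EvNonneg 𝒞 (-q ^ 2)) (p : MvPolynomial σ ℝ) :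
    ∀ᶠ k in atTop, ∀ w, 𝒞 k w → riesz w (q * p) = 0 := by
  filter_upwards [hq, eventually_ge_atTop q.totalDegree, eventually_ge_atTop p.totalDegree]
    with k h1 h2 h3 w hw
  refine (h𝒞 k w hw).mul_eq_zero h2 h3 ?_
  have := h1 w hw
  rw [riesz_eq_rieszLin, map_neg] at this
  rw [riesz_eq_rieszLin]
  linarith

theorem evNonneg_mul (h𝒞 : ∀ k w, 𝒞 k w → RelaxFeasible k φ ψ w)
    {q : MvPolynomial σ ℝ} (hq : EvNonneg 𝒞 (-q ^ 2)) (p : MvPolynomial σ ℝ) :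
    EvNonneg 𝒞 (q * p) := by
  filter_upwards [eventually_riesz_mul_eq_zero h𝒞 hq p] with k h w hw
  exact (h w hw).ge

/-- The ideal of polynomials eventually in the kernel of all moment matrices. -/
def nullIdeal (h𝒞 : ∀ k w, 𝒞 k w → RelaxFeasible k φ ψ w) : Ideal (MvPolynomial σ ℝ) where
  carrier := {q | EvNonneg 𝒞 (-q ^ 2)}
  add_mem' := by
    intro p q hp hq
    have h := (evNonneg_mul h𝒞 hp (-p - 2 * q)).add (evNonneg_mul h𝒞 hq (-q))
    have h2 : -(p + q) ^ 2 = p * (-p - 2 * q) + q * (-q) := by ring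
    rw [Set.mem_ofPred, h2]
    exact h
  zero_mem' := by
    rw [Set.mem_ofPred]
    exact Eventually.of_forall fun k w _ => by simp [riesz]
  smul_mem' := by
    intro c q hq
    have h := evNonneg_mul h𝒞 hq (-(c ^ 2 * q))
    have h2 : -(c * q) ^ 2 = q * (-(c ^ 2 * q)) := by ring
    rw [Set.mem_ofPred, smul_eq_mul, h2]
    exact h

theorem mem_nullIdeal {h𝒞 : ∀ k w, 𝒞 k w → RelaxFeasible k φ ψ w} {q : MvPolynomial σ ℝ} :
    q ∈ nullIdeal h𝒞 ↔ EvNonneg 𝒞 (-q ^ 2) := Iff.rfl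

theorem evNonneg_of_mem_nullIdeal {h𝒞 : ∀ k w, 𝒞 k w → RelaxFeasible k φ ψ w}
    {q : MvPolynomial σ ℝ} (hq : q ∈ nullIdeal h𝒞) : EvNonneg 𝒞 q := by
  simpa using evNonneg_mul h𝒞 hq 1

theorem mem_nullIdeal_of_sq {h𝒞 : ∀ k w, 𝒞 k w → RelaxFeasible k φ ψ w} {q : MvPolynomial σ ℝ}
    (hq : q ^ 2 ∈ nullIdeal h𝒞) : q ∈ nullIdeal h𝒞 :=
  mem_nullIdeal.2 (evNonneg_of_mem_nullIdeal (neg_mem hq))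

theorem mem_nullIdeal_of_pow {h𝒞 : ∀ k w, 𝒞 k w → RelaxFeasible k φ ψ w} {q : MvPolynomial σ ℝ}
    {m : ℕ} (hq : q ^ m ∈ nullIdeal h𝒞) : q ∈ nullIdeal h𝒞 := by
  have key : ∀ l : ℕ, q ^ 2 ^ l ∈ nullIdeal h𝒞 → q ∈ nullIdeal h𝒞 := by
    intro l
    induction l with
    | zero => intro h; simpa using h
    | succ l ih =>
      intro h
      rw [pow_succ, pow_mul] at h
      exact ih (mem_nullIdeal_of_sq h)
  refine key m ?_
  rw [← Nat.sub_add_cancel (Nat.lt_two_pow_self (n := m)).le, pow_add]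
  exact Ideal.mul_mem_left _ _ hq

theorem span_le_nullIdeal (h𝒞 : ∀ k w, 𝒞 k w → RelaxFeasible k φ ψ w) :
    Ideal.span (Set.range φ) ≤ nullIdeal h𝒞 := by
  rw [Ideal.span_le]
  rintro _ ⟨i, rfl⟩
  have h : -(φ i) ^ 2 = φ i * (-φ i) := by ring
  rw [SetLike.mem_coe, mem_nullIdeal, h]
  exact evNonneg_eq h𝒞 i _

end EvNonneg

theorem Polynomial.exists_gap {p : Polynomial ℝ} (hp : p ≠ 0) (v : ℝ) :
    ∃ (m : ℕ) (r a b : Polynomial ℝ) (δ : ℝ), p = (Polynomial.X - Polynomial.C v) ^ m * r ∧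
      a * r + b * (Polynomial.X - Polynomial.C v) ^ m = 1 ∧ r.eval v ≠ 0 ∧ 0 < δ ∧
      ∀ t, r.eval t = 0 → v < t → v + δ < t := by
  obtain ⟨r, hr, hdvd⟩ := Polynomial.exists_eq_pow_rootMultiplicity_mul_and_not_dvd p hp v
  have hcop : IsCoprime r ((Polynomial.X - Polynomial.C v) ^ p.rootMultiplicity v) :=
    (((Polynomial.irreducible_X_sub_C v).coprime_iff_not_dvd.2 hdvd).symm).pow_right
  obtain ⟨a, b, hab⟩ := hcop
  have hrv : r.eval v ≠ 0 := by rwa [Polynomial.dvd_iff_isRoot] at hdvd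
  have hr0 : r ≠ 0 := by rintro rfl; simp at hrv
  have h : ∀ᶠ δ in nhdsWithin (0 : ℝ) (Set.Ioi 0), ∀ t ∈ r.roots.toFinset, v < t → v + δ < t := by
    rw [Filter.eventually_all_finset]
    intro t _
    by_cases hvt : v < t
    · filter_upwards [Ioo_mem_nhdsGT (sub_pos.2 hvt)] with δ hδ _
      linarith [hδ.2]
    · exact Filter.Eventually.of_forall fun _ h => absurd h hvt
  obtain ⟨δ, h1, h2⟩ := (h.and self_mem_nhdsWithin).exists
  exact ⟨_, r, a, b, δ, hr, hab, hrv, h2, fun t ht =>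
    h1 t (by rw [Multiset.mem_toFinset, Polynomial.mem_roots hr0]; exact ht)⟩

section

variable {n : ℕ} {ι κ : Type*} [Fintype ι] [Fintype κ]
  {φ : ι → MvPolynomial (Fin n) ℝ} {ψ : κ → MvPolynomial (Fin n) ℝ}

theorem eval_eq_zero_of_inIQ_nonneg {x : Fin n → ℝ}
    (h : ∀ q, InIQ φ ψ q → 0 ≤ eval x q) (i : ι) : eval x (φ i) = 0 := by
  have h1 : φ i ∈ Ideal.span (Set.range φ) := Ideal.subset_span ⟨i, rfl⟩
  have h2 := h _ (inIQ_of_mem_span (neg_mem h1))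
  rw [map_neg] at h2
  linarith [h _ (inIQ_of_mem_span h1)]

/-- A finite-valued objective function separates from its minimal value modulo nilpotents. -/
theorem exists_gap_certificate {N : ℝ} (hN : InIQ φ ψ (C N - ∑ i, X i ^ 2))
    {f : MvPolynomial (Fin n) ℝ} {v : ℝ}
    (hv : ∀ x, (∀ i, eval x (φ i) = 0) → (∀ j, 0 ≤ eval x (ψ j)) → v ≤ eval x f)
    {p : Polynomial ℝ} (hp : p ≠ 0) (hpf : Polynomial.aeval f p ∈ Ideal.span (Set.range φ)) :
    ∃ δ > 0, ∃ (e q u : MvPolynomial (Fin n) ℝ) (M : ℕ), InIQ φ ψ q ∧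
      u ^ M ∈ Ideal.span (Set.range φ) ∧ f - C v - C δ * e ^ 2 = q + u ∧
      ∀ x, (∀ i, eval x (φ i) = 0) → eval x e = 0 → eval x f = v := by
  obtain ⟨m, r, a, b, δ, hpr, hab, hrv, hδ, hgap⟩ := Polynomial.exists_gap hp v
  have hpr' := congrArg (Polynomial.aeval f) hpr
  have hab' := congrArg (Polynomial.aeval f) hab
  simp only [map_add, map_mul, map_sub, map_pow, Polynomial.aeval_X, Polynomial.aeval_C, map_one,
    algebraMap_eq] at hpr' hab'
  have hQ := isQuadMod_inIQ φ ψ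
  set R := Polynomial.aeval f r
  set a' := Polynomial.aeval f a
  set b' := Polynomial.aeval f b
  set P := Polynomial.aeval f p
  have hQR := hQ.add_ideal (Ideal.span {R})
  have hle : ∀ q, InIQ φ ψ q → q ∈ {x | ∃ p ∈ {f | InIQ φ ψ f}, ∃ u ∈ Ideal.span {R}, x = p + u} :=
    fun q hq => ⟨q, hq, 0, Ideal.zero_mem _, by ring⟩
  have hRe : ∀ x, eval x R = r.eval (eval x f) := fun x => by
    rw [show R = Polynomial.aeval f r from rfl, Polynomial.aeval_def, Polynomial.hom_eval₂,
      algebraMap_eq, show (eval x).comp C = RingHom.id ℝ from RingHom.ext fun t => eval_C t]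
    rfl
  obtain ⟨q, hq, c, hc, hqc⟩ := hQR.mem_of_pos (hle _ hN) (f := f - C v - C δ) <| by
    intro x hx
    have hφ := eval_eq_zero_of_inIQ_nonneg fun q hq => hx q (hle q hq)
    have hψ : ∀ j, 0 ≤ eval x (ψ j) := fun j => hx _ (hle _ (inIQ_ineq φ ψ j))
    have hR : eval x R = 0 := by
      have h1 := hx R ⟨0, hQ.zero_mem, R, Ideal.mem_span_singleton_self R, by ring⟩
      have h2 := hx (-R) ⟨0, hQ.zero_mem, -R, neg_mem (Ideal.mem_span_singleton_self R), by ring⟩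
      rw [map_neg] at h2
      linarith
    rw [hRe] at hR
    have h1 := hgap _ hR (lt_of_le_of_ne (hv x hφ hψ) fun h => hrv (by rw [h]; exact hR))
    simp only [map_sub, eval_C]
    linarith
  obtain ⟨c', rfl⟩ := Ideal.mem_span_singleton.1 hc
  set e := b' * (f - C v) ^ m with he
  refine ⟨δ, hδ, e, e ^ 2 * q + P * (c' * b' ^ 2 * (f - C v) ^ m), (f - C v) * (a' * R) * (1 + e),
    m + 1, hQ.add (hQ.sq_mul e hq) (inIQ_of_mem_span (Ideal.mul_mem_right _ _ hpf)), ?_, ?_, ?_⟩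
  · have h : ((f - C v) * (a' * R) * (1 + e)) ^ (m + 1) =
        P * ((f - C v) * a' * (a' * R) ^ m * (1 + e) ^ (m + 1)) := by
      have key : ∀ y a r z : MvPolynomial (Fin n) ℝ,
          (y * (a * r) * z) ^ (m + 1) = y ^ m * r * (y * a * (a * r) ^ m * z ^ (m + 1)) := by
        intros; ring
      rw [hpr', key]
    rw [h]
    exact Ideal.mul_mem_right _ _ hpf
  · have h1 : a' * R = 1 - e := by rw [he, ← hab']; ring
    rw [h1, hpr']
    have h2 : q = f - C v - C δ - R * c' := by rw [hqc]; ring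
    rw [h2, he]
    ring
  · intro x hφ hx
    have hP : eval x P = 0 := by
      have : Ideal.span (Set.range φ) ≤ RingHom.ker (eval x) := by
        rw [Ideal.span_le]; rintro _ ⟨i, rfl⟩; exact hφ i
      exact this hpf
    have h1 := congrArg (eval x) hab'
    rw [map_add, hx, add_zero, map_one, map_mul] at h1
    rw [hpr', map_mul, map_pow, mul_eq_zero] at hP
    have h2 : eval x (f - C v) = 0 := eq_zero_of_pow_eq_zero <|
      hP.resolve_right fun h0 => by rw [h0, mul_zero] at h1; exact zero_ne_one h1
    rw [map_sub, eval_C] at h2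
    linarith

/-- A polynomial that is positive on a finite set of isolated points of `V`, and negative on the
rest of `V`. -/
theorem exists_isolating (S : Finset (Fin n → ℝ)) (V : Set (Fin n → ℝ))
    (hS : ∀ u ∈ S, ∃ U, IsOpen U ∧ u ∈ U ∧ U ∩ V = {u}) :
    ∃ b : MvPolynomial (Fin n) ℝ, (∀ u ∈ S, 0 < eval u b) ∧ ∀ x ∈ V, 0 ≤ eval x b → x ∈ S := by
  have h : ∀ᶠ ε in nhdsWithin (0 : ℝ) (Set.Ioi 0), ∀ u ∈ S, ∀ x ∈ V,
      ∑ i, (x i - u i) ^ 2 < ε → x = u := by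
    rw [Filter.eventually_all_finset]
    intro u hu
    obtain ⟨U, hU, huU, hUV⟩ := hS u hu
    obtain ⟨η, hη, hball⟩ := Metric.isOpen_iff.1 hU u huU
    filter_upwards [Ioo_mem_nhdsGT (show (0 : ℝ) < η ^ 2 by positivity)] with ε hε x hx hlt
    have hxU : x ∈ U := hball <| by
      rw [Metric.mem_ball, dist_pi_lt_iff hη]
      intro i
      rw [Real.dist_eq]
      refine abs_lt_of_sq_lt_sq ?_ hη.le
      exact (Finset.single_le_sum (f := fun i => (x i - u i) ^ 2) (fun _ _ => sq_nonneg _)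
        (Finset.mem_univ i)).trans_lt (hlt.trans hε.2)
    exact (Set.ext_iff.1 hUV x).1 ⟨hxU, hx⟩
  obtain ⟨ε, h1, h2⟩ := (h.and self_mem_nhdsWithin).exists
  have hε : 0 < ε := h2
  refine ⟨C (ε ^ S.card / 2) - ∏ u ∈ S, ∑ i, (X i - C (u i)) ^ 2, fun u hu => ?_,
    fun x hx h0 => ?_⟩
  · rw [map_sub, eval_C, map_prod, Finset.prod_eq_zero hu, sub_zero]
    · positivity
    · simp
  · by_contra hxS
    have h3 : ∏ _u ∈ S, ε ≤ ∏ u ∈ S, ∑ i, (x i - u i) ^ 2 := by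
      refine Finset.prod_le_prod (fun _ _ => hε.le) fun u hu => ?_
      by_contra! hlt
      exact hxS (h1 u hu x hx hlt ▸ hu)
    rw [Finset.prod_const] at h3
    simp only [map_sub, eval_C, map_prod, map_sum, map_pow, eval_X] at h0
    linarith [pow_pos hε S.card]

theorem exists_neg_pow_mem {Q : Set (MvPolynomial (Fin n) ℝ)} (hQ : IsQuadMod Q)
    {I : Ideal (MvPolynomial (Fin n) ℝ)} (hI : ∀ u ∈ I, u ∈ Q) (hφ : ∀ i, φ i ∈ I)
    {b h : MvPolynomial (Fin n) ℝ} (hb : b ∈ Q)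
    (hh : ∀ x, (∀ i, eval x (φ i) = 0) → 0 ≤ eval x b → eval x h = 0) :
    ∃ l : ℕ, -h ^ (2 * l) ∈ Q := by
  classical
  have hT := (IsPreordering.isSumSq.adjoin b).add_ideal I
  have hTQ : ∀ a ∈ {x | ∃ p ∈ {x | ∃ p ∈ {a : MvPolynomial (Fin n) ℝ | IsSumSq a},
      ∃ q ∈ {a : MvPolynomial (Fin n) ℝ | IsSumSq a}, x = p + b * q}, ∃ u ∈ I, x = p + u},
      a ∈ Q := by
    rintro _ ⟨_, ⟨p, hp, q, hq, rfl⟩, u, hu, rfl⟩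
    refine hQ.add (hQ.add (hQ.sumSq_mem hp) ?_) (hI u hu)
    rw [mul_comm]
    exact hQ.sumSq_mul hq hb
  by_contra! hcon
  obtain ⟨x, hx, hE⟩ := hT.exists_point h (fun l hl => hcon l (hTQ _ hl))
    (insert b (Finset.univ.image φ ∪ Finset.univ.image fun i => -φ i)) <| by
      intro a ha
      simp only [Finset.mem_insert, Finset.mem_union, Finset.mem_image, Finset.mem_univ,
        true_and] at ha
      rcases ha with rfl | ⟨i, rfl⟩ | ⟨i, rfl⟩
      · exact ⟨a, ⟨0, IsSumSq.zero, 1, IsSumSq.one, by ring⟩, 0, I.zero_mem, by ring⟩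
      · exact ⟨0, ⟨0, IsSumSq.zero, 0, IsSumSq.zero, by ring⟩, φ i, hφ i, by ring⟩
      · exact ⟨0, ⟨0, IsSumSq.zero, 0, IsSumSq.zero, by ring⟩, -φ i, neg_mem (hφ i), by ring⟩
  refine hx (hh x (fun i => ?_) (hE b (by simp)))
  have h1 := hE (φ i) (by simp)
  have h2 := hE (-φ i) (by simp)
  rw [map_neg] at h2
  linarith

/-- Polynomials which take the value `1` at one point of a finite set and `0` at the others. -/
theorem exists_interpolators (S : Finset (Fin n → ℝ)) :
    ∃ e : (Fin n → ℝ) → MvPolynomial (Fin n) ℝ,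
      ∀ u ∈ S, ∀ x ∈ S, eval x (e u) = if x = u then 1 else 0 := by
  classical
  refine ⟨fun u => ∏ y ∈ S.erase u, C (∑ i, (u i - y i) ^ 2)⁻¹ * ∑ i, (X i - C (y i)) ^ 2,
    fun u hu x hx => ?_⟩
  simp only [map_prod, map_mul, eval_C, map_sum, map_pow, map_sub, eval_X]
  split_ifs with h
  · subst h
    refine Finset.prod_eq_one fun y hy => inv_mul_cancel₀ fun h0 => ?_
    rw [Finset.sum_eq_zero_iff_of_nonneg fun _ _ => sq_nonneg _] at h0
    refine (Finset.mem_erase.1 hy).1 (funext fun i => ?_)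
    have := pow_eq_zero_iff (two_ne_zero) |>.1 (h0 i (Finset.mem_univ i))
    linarith
  · exact Finset.prod_eq_zero (Finset.mem_erase.2 ⟨h, hx⟩) (by simp)

end

theorem rank_momMat_eq {σ : Type} [Fintype σ] [DecidableEq σ] {s t : ℕ} (hst : s ≤ t)
    {w : (σ →₀ ℕ) → ℝ} (P : MomIdx σ t → MvPolynomial σ ℝ) (hP : ∀ a, (P a).totalDegree ≤ s)
    (h1 : ∀ a b : MomIdx σ t, riesz w ((monomial a.exp 1 - P a) * monomial b.exp 1) = 0)
    (h2 : ∀ a b : MomIdx σ t, riesz w ((monomial b.exp 1 - P b) * P a) = 0) :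
    (momMat t w).rank = (momMat s w).rank := by
  apply le_antisymm
  · have hM : momMat t w = (Matrix.of fun a (c : MomIdx σ s) => (P a).coeff c.exp) * momMat s w *
        (Matrix.of fun a (c : MomIdx σ s) => (P a).coeff c.exp).transpose := by
      ext a b
      have h3 := riesz_mul_mul w 1 (hP a) (hP b)
      rw [locMat_one, one_mul, Matrix.dotProduct_mulVec] at h3
      have h4 : riesz w (P a * P b) = w (a.exp + b.exp) := by
        have e1 := h1 a b
        have e2 := h2 a b
        rw [sub_mul, riesz_eq_rieszLin, map_sub, sub_eq_zero] at e1 e2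
        rw [monomial_mul, mul_one, ← riesz_eq_rieszLin, riesz_monomial] at e1
        rw [mul_comm (monomial b.exp 1), mul_comm (P b)] at e2
        rw [e1, e2, riesz_eq_rieszLin]
      rw [momMat, Matrix.of_apply, ← h4, h3, Matrix.mul_apply_eq_vecMul]
      rfl
    rw [hM]
    exact (Matrix.rank_mul_le_left _ _).trans (Matrix.rank_mul_le_right _ _)
  · have hsub : ∀ a : MomIdx σ s, ∃ b : MomIdx σ t, b.exp = a.exp :=
      fun a => MomIdx.exists_exp (a.degree_exp.trans hst)
    choose r hr using hsub
    have hM : momMat s w = (momMat t w).submatrix r r := by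
      ext a b
      simp [momMat, hr]
    rw [hM]
    exact Matrix.rank_submatrix_le _ _ _

section

variable {n : ℕ} {ι κ : Type*} [Fintype ι] [Fintype κ]
  {φ : ι → MvPolynomial (Fin n) ℝ} {ψ : κ → MvPolynomial (Fin n) ℝ}

theorem finite_minimizers {σ : MvPolynomial (Fin n) ℝ} (hσ : InIQ φ ψ σ)
    (hc : IsCompact {z : Fin n → ℝ | 0 ≤ eval z σ}) (f : MvPolynomial (Fin n) ℝ) (v : ℝ)
    (hiso : ∀ x, (∀ i, eval x (φ i) = 0) → (∀ j, 0 ≤ eval x (ψ j)) → eval x f = v →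
      ∃ U : Set (Fin n → ℝ), IsOpen U ∧ x ∈ U ∧ U ∩ {x | ∀ i, eval x (φ i) = 0} = {x}) :
    {x : Fin n → ℝ | (∀ i, eval x (φ i) = 0) ∧ (∀ j, 0 ≤ eval x (ψ j)) ∧ eval x f = v}.Finite := by
  have hcont : ∀ p : MvPolynomial (Fin n) ℝ, Continuous fun x => eval x p :=
    fun p => MvPolynomial.continuous_eval p
  refine IsCompact.finite (hc.of_isClosed_subset ?_ fun x hx => hσ.eval_nonneg hx.1 hx.2.1) ?_
  · simp only [Set.ofPred_and, Set.ofPred_forall]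
    exact (isClosed_iInter fun i => isClosed_eq (hcont _) continuous_const).inter
      ((isClosed_iInter fun j => isClosed_le continuous_const (hcont _)).inter
        (isClosed_eq (hcont _) continuous_const))
  · rw [isDiscrete_iff_forall_mem_exists_isOpen]
    intro x hx
    obtain ⟨U, hU, hxU, hUV⟩ := hiso x hx.1 hx.2.1 hx.2.2
    refine ⟨U, hU, Set.Subset.antisymm (fun y hy => ?_) (Set.singleton_subset_iff.2 ⟨hxU, hx⟩)⟩
    rw [← hUV]
    exact ⟨hy.1, hy.2.1⟩

theorem mem_nullIdeal_of_vanishing {𝒞 : ℕ → ((Fin n →₀ ℕ) → ℝ) → Prop}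
    (h𝒞 : ∀ k w, 𝒞 k w → RelaxFeasible k φ ψ w) {N : ℝ} (hN : InIQ φ ψ (C N - ∑ i, X i ^ 2))
    {e : MvPolynomial (Fin n) ℝ} (he : e ∈ nullIdeal h𝒞) (S : Finset (Fin n → ℝ))
    (hS : ∀ x, (∀ i, eval x (φ i) = 0) → (∀ j, 0 ≤ eval x (ψ j)) → eval x e = 0 → x ∈ S)
    (hiso : ∀ u ∈ S, ∃ U : Set (Fin n → ℝ), IsOpen U ∧ u ∈ U ∧
      U ∩ {x | ∀ i, eval x (φ i) = 0} = {u})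
    {h : MvPolynomial (Fin n) ℝ} (hh : ∀ x ∈ S, eval x h = 0) : h ∈ nullIdeal h𝒞 := by
  have hQ := isQuadMod_inIQ φ ψ
  have hQN := hQ.add_ideal (nullIdeal h𝒞)
  set Q := {x | ∃ p ∈ {f | InIQ φ ψ f}, ∃ u ∈ nullIdeal h𝒞, x = p + u} with hQdef
  have hle : ∀ q, InIQ φ ψ q → q ∈ Q := fun q hq => ⟨q, hq, 0, Ideal.zero_mem _, by ring⟩
  have hI : ∀ u ∈ nullIdeal h𝒞, u ∈ Q := fun u hu => ⟨0, hQ.zero_mem, u, hu, by ring⟩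
  obtain ⟨b, hbS, hbV⟩ := exists_isolating S _ hiso
  have hb : b ∈ Q := by
    refine hQN.mem_of_pos (hle _ hN) fun x hx => hbS x (hS x ?_ ?_ ?_)
    · exact eval_eq_zero_of_inIQ_nonneg fun q hq => hx q (hle q hq)
    · exact fun j => hx _ (hle _ (inIQ_ineq φ ψ j))
    · have h1 := hx e (hI e he)
      have h2 := hx (-e) (hI (-e) (neg_mem he))
      rw [map_neg] at h2
      linarith
  obtain ⟨l, q, hq, u, hu, hl⟩ := exists_neg_pow_mem hQN hI
    (fun i => span_le_nullIdeal h𝒞 (Ideal.subset_span ⟨i, rfl⟩)) hb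
    fun x hx hx0 => hh x (hbV x hx hx0)
  refine mem_nullIdeal_of_pow (m := l) (mem_nullIdeal.2 ?_)
  rw [← pow_mul, mul_comm l, hl]
  exact (InIQ.evNonneg h𝒞 hq).add (evNonneg_of_mem_nullIdeal hu)

/-- Finite convergence and flat truncation for the moment hierarchy, for an objective `f` which
takes finitely many values on the variety of `φ` and whose minimizers are isolated. -/
theorem exists_forall_flat_truncation {f : MvPolynomial (Fin n) ℝ} {v : ℝ} (d : ℕ)
    (hv : ∀ x, (∀ i, eval x (φ i) = 0) → (∀ j, 0 ≤ eval x (ψ j)) → v ≤ eval x f)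
    {x0 : Fin n → ℝ} (hφ0 : ∀ i, eval x0 (φ i) = 0) (hψ0 : ∀ j, 0 ≤ eval x0 (ψ j))
    (hx0 : eval x0 f = v)
    (hiso : ∀ x, (∀ i, eval x (φ i) = 0) → (∀ j, 0 ≤ eval x (ψ j)) → eval x f = v →
      ∃ U : Set (Fin n → ℝ), IsOpen U ∧ x ∈ U ∧ U ∩ {x | ∀ i, eval x (φ i) = 0} = {x})
    (harch : IsArchimedean φ ψ)
    {p : Polynomial ℝ} (hp : p ≠ 0) (hpf : Polynomial.aeval f p ∈ Ideal.span (Set.range φ)) :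
    ∃ k0 : ℕ, ∀ k ≥ k0,
      (∃ w, RelaxFeasible k φ ψ w ∧ ∀ w', RelaxFeasible k φ ψ w' → riesz w f ≤ riesz w' f) ∧
      ∀ w, RelaxFeasible k φ ψ w → (∀ w', RelaxFeasible k φ ψ w' → riesz w f ≤ riesz w' f) →
        ∃ t, d ≤ t ∧ t ≤ k ∧ (momMat t w).rank = (momMat (t - d) w).rank := by
  classical
  obtain ⟨τ, hτ, hc⟩ := harch
  obtain ⟨N, hN⟩ := (isQuadMod_inIQ φ ψ).exists_ball hτ hc
  obtain ⟨δ, hδ, e, q, u, M, hq, hu, heq, he⟩ := exists_gap_certificate hN hv hp hpf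
  have hfin := finite_minimizers hτ hc f v hiso
  set S := hfin.toFinset with hSdef
  have hSmem : ∀ x, x ∈ S ↔ (∀ i, eval x (φ i) = 0) ∧ (∀ j, 0 ≤ eval x (ψ j)) ∧ eval x f = v :=
    fun x => by rw [hSdef, Set.Finite.mem_toFinset]; rfl
  have hbound : EvNonneg (fun k w => RelaxFeasible k φ ψ w) (f - C v) := by
    have h𝒞 : ∀ k w, RelaxFeasible k φ ψ w → RelaxFeasible k φ ψ w := fun _ _ h => h
    have h1 : f - C v = q + u + C δ * e ^ 2 := by rw [← heq]; ring
    rw [h1]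
    exact ((InIQ.evNonneg h𝒞 hq).add (evNonneg_of_mem_nullIdeal (h𝒞 := h𝒞)
      (mem_nullIdeal_of_pow (span_le_nullIdeal h𝒞 hu)))).add ((evNonneg_sq h𝒞 e).C_mul hδ.le)
  let 𝒞 : ℕ → ((Fin n →₀ ℕ) → ℝ) → Prop := fun k w => RelaxFeasible k φ ψ w ∧ riesz w f ≤ v
  have h𝒞 : ∀ k w, 𝒞 k w → RelaxFeasible k φ ψ w := fun _ _ h => h.1
  have heN : e ∈ nullIdeal h𝒞 := by
    have h1 : EvNonneg 𝒞 (-(f - C v)) := Filter.Eventually.of_forall fun k w hw => by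
      rw [riesz_eq_rieszLin, map_neg, map_sub, ← riesz_eq_rieszLin, ← riesz_eq_rieszLin, riesz_C,
        hw.1.1]
      linarith [hw.2]
    have h2 := (((InIQ.evNonneg h𝒞 hq).add (evNonneg_of_mem_nullIdeal (h𝒞 := h𝒞)
      (mem_nullIdeal_of_pow (span_le_nullIdeal h𝒞 hu)))).add h1).C_mul (inv_nonneg.2 hδ.le)
    have h3 : C δ⁻¹ * (q + u + -(f - C v)) = -e ^ 2 := by
      have h4 : (C δ⁻¹ * C δ : MvPolynomial (Fin n) ℝ) = 1 := by
        rw [← C_mul, inv_mul_cancel₀ hδ.ne', C_1]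
      rw [← heq]
      linear_combination -(e ^ 2) * h4
    rw [mem_nullIdeal, ← h3]
    exact h2
  obtain ⟨E, hE⟩ := exists_interpolators S
  set s := S.sup fun u => (E u).totalDegree
  set t := s + d
  let P : MomIdx (Fin n) t → MvPolynomial (Fin n) ℝ :=
    fun a => ∑ u ∈ S, C (eval u (monomial a.exp 1)) * E u
  have hPdeg : ∀ a, (P a).totalDegree ≤ s := fun a => by
    refine totalDegree_finsetSum_le fun u hu => (totalDegree_mul _ _).trans ?_
    rw [totalDegree_C, zero_add]
    exact Finset.le_sup (f := fun u => (E u).totalDegree) hu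
  have hnull : ∀ a, monomial a.exp 1 - P a ∈ nullIdeal h𝒞 := fun a => by
    refine mem_nullIdeal_of_vanishing h𝒞 hN heN S
      (fun x h1 h2 h3 => (hSmem x).2 ⟨h1, h2, he x h1 h3⟩)
      (fun x hx => hiso x ((hSmem x).1 hx).1 ((hSmem x).1 hx).2.1 ((hSmem x).1 hx).2.2)
      fun x hx => ?_
    simp only [P, map_sub, map_sum, map_mul, eval_C]
    rw [Finset.sum_eq_single x, hE x hx x hx, if_pos rfl, mul_one, sub_self]
    · intro u hu hne
      rw [hE u hu x hx, if_neg hne.symm, mul_zero]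
    · exact fun h => absurd hx h
  have hflat : ∀ᶠ k in Filter.atTop, ∀ w, 𝒞 k w → (momMat t w).rank = (momMat s w).rank := by
    have h1 : ∀ᶠ k in Filter.atTop, ∀ a b : MomIdx (Fin n) t, ∀ w, 𝒞 k w →
        riesz w ((monomial a.exp 1 - P a) * monomial b.exp 1) = 0 :=
      Filter.eventually_all.2 fun a => Filter.eventually_all.2 fun b =>
        eventually_riesz_mul_eq_zero h𝒞 (mem_nullIdeal.1 (hnull a)) _
    have h2 : ∀ᶠ k in Filter.atTop, ∀ a b : MomIdx (Fin n) t, ∀ w, 𝒞 k w →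
        riesz w ((monomial b.exp 1 - P b) * P a) = 0 :=
      Filter.eventually_all.2 fun a => Filter.eventually_all.2 fun b =>
        eventually_riesz_mul_eq_zero h𝒞 (mem_nullIdeal.1 (hnull b)) _
    filter_upwards [h1, h2] with k h1 h2 w hw
    exact rank_momMat_eq (Nat.le_add_right s d) P hPdeg (fun a b => h1 a b w hw)
      fun a b => h2 a b w hw
  have hdirac : ∀ k, RelaxFeasible k φ ψ fun α => eval x0 (monomial α 1) :=
    fun k => relaxFeasible_eval k hφ0 hψ0
  have hdf : riesz (fun α => eval x0 (monomial α 1)) f = v := by rw [riesz_eval, hx0]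
  refine Filter.eventually_atTop.1 ?_
  filter_upwards [hbound, hflat, Filter.eventually_ge_atTop t] with k hk1 hk2 hk3
  refine ⟨⟨_, hdirac k, fun w' hw' => ?_⟩, fun w hw hmin => ⟨t, Nat.le_add_left d s, hk3, ?_⟩⟩
  · have h1 := hk1 w' hw'
    rw [riesz_eq_rieszLin, map_sub, ← riesz_eq_rieszLin, ← riesz_eq_rieszLin, riesz_C,
      hw'.1] at h1
    rw [hdf]
    linarith
  · rw [Nat.add_sub_cancel]
    exact hk2 w ⟨hw, (hmin _ (hdirac k)).trans_eq hdf⟩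

end

section

variable {n l : ℕ} {E1 E2 : Finset (Fin l)} {g : Fin l → MvPolynomial (Fin n) ℝ}
  {G1 : Matrix (Fin l) (Fin n ⊕ Fin l) (MvPolynomial (Fin n) ℝ)} {f : MvPolynomial (Fin n) ℝ}

theorem eval_Fsub {n m : ℕ} (F : MvPolynomial (Fin n ⊕ Fin m) ℝ) (y : Fin m → ℝ)
    (x : Fin n → ℝ) : eval x (Fsub F y) = eval (Sum.elim x y) F := by
  rw [Fsub, aeval_def, eval_eval₂]
  have h1 : (eval x).comp (algebraMap ℝ (MvPolynomial (Fin n) ℝ)) = RingHom.id ℝ :=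
    RingHom.ext fun t => by simp [algebraMap_eq]
  rw [h1, ← eval₂_id]
  congr 1
  funext i
  cases i <;> simp

/-- An objective function is locally constant on its critical variety, algebraically. -/
theorem exists_aeval_mem_span_phiLow (hXu : E1 ∪ E2 = Finset.univ)
    (g : Fin l → MvPolynomial (Fin n) ℝ)
    (G1 : Matrix (Fin l) (Fin n ⊕ Fin l) (MvPolynomial (Fin n) ℝ)) (f : MvPolynomial (Fin n) ℝ) :
    ∃ p : Polynomial ℝ, p ≠ 0 ∧
      Polynomial.aeval f p ∈ Ideal.span (Set.range (phiLow E1 E2 g G1 f)) := by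
  refine exists_aeval_mem_of_derivation _ f fun K _ _ θ D hθ => ?_
  have hφ : ∀ i, θ (phiLow E1 E2 g G1 f i) = 0 := fun i => hθ _ (Ideal.subset_span ⟨i, rfl⟩)
  have hgrad : ∀ j, θ (pderiv j f) = ∑ i, θ (lamSub G1 f i) * θ (pderiv j (g i)) := fun j => by
    have h := hφ (Sum.inl j)
    simp only [phiLow, map_sub, map_sum, map_mul, sub_eq_zero] at h
    exact h
  have hzero : ∀ i, θ (lamSub G1 f i) * D (θ (g i)) = 0 := fun i => by
    rcases Finset.mem_union.1 (hXu ▸ Finset.mem_univ i) with hi | hi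
    · have h : θ (g i) = 0 := hφ (Sum.inr (Sum.inl ⟨i, hi⟩))
      rw [h, map_zero, mul_zero]
    · have h : θ (lamSub G1 f i * g i) = 0 := hφ (Sum.inr (Sum.inr ⟨i, hi⟩))
      rw [map_mul, mul_eq_zero] at h
      rcases h with h | h
      · rw [h, zero_mul]
      · rw [h, map_zero, mul_zero]
  rw [Derivation.algHom_apply_eq_sum]
  simp only [hgrad, Finset.sum_mul]
  rw [Finset.sum_comm]
  refine Finset.sum_eq_zero fun i _ => ?_
  rw [← hzero i, Derivation.algHom_apply_eq_sum, Finset.mul_sum]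
  exact Finset.sum_congr rfl fun j _ => mul_assoc _ _ _

theorem mem_semiSet {x : Fin n → ℝ} (hφ : ∀ i, eval x (phiLow E1 E2 g G1 f i) = 0)
    (hψ : ∀ j, 0 ≤ eval x (psiLow E2 g G1 f j)) : x ∈ SemiSet E1 E2 g :=
  ⟨fun i hi => hφ (Sum.inr (Sum.inl ⟨i, hi⟩)), fun i hi => hψ (Sum.inl ⟨i, hi⟩)⟩

theorem psiLow_nonneg_of_isMin (hXd : Disjoint E1 E2)
    (hG1 : ∀ x : Fin n → ℝ, (Matrix.of fun i j => eval x (G1 i j)) * Gmat g x = 1)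
    {x0 : Fin n → ℝ} (hx0 : x0 ∈ SemiSet E1 E2 g)
    (hmin : ∀ x ∈ SemiSet E1 E2 g, eval x0 f ≤ eval x f)
    (hφ : ∀ i, eval x0 (phiLow E1 E2 g G1 f i) = 0) (j : ↥E2 ⊕ ↥E2) :
    0 ≤ eval x0 (psiLow E2 g G1 f j) := by
  obtain i | i := j
  · exact hx0.2 i.1 i.2
  · by_cases h : eval x0 (g i.1) = 0
    · exact eval_lamSub_nonneg hXd g G1 (hG1 x0) f hx0 hmin i.2 h
    · have h1 : eval x0 (lamSub G1 f i.1 * g i.1) = 0 := hφ (Sum.inr (Sum.inr i))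
      rw [map_mul] at h1
      exact ((mul_eq_zero.1 h1).resolve_right h).ge

theorem InIQ.phiLow_psiLow {q : MvPolynomial (Fin n) ℝ}
    (hq : InIQ (fun i : ↥E1 => g i.1) (fun i : ↥E2 => g i.1) q) :
    InIQ (phiLow E1 E2 g G1 f) (psiLow E2 g G1 f) q := by
  obtain ⟨p, s, τ, hs, hτ, rfl⟩ := hq
  have hQ := isQuadMod_inIQ (phiLow E1 E2 g G1 f) (psiLow E2 g G1 f)
  refine hQ.add (hQ.add (inIQ_of_mem_span (Ideal.sum_mem _ fun i _ => ?_))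
    (hQ.sumSq_mem (isSOS_iff_isSumSq.1 hs))) (hQ.sum_mem _ _ fun j _ => ?_)
  · exact Ideal.mul_mem_right _ _ (Ideal.subset_span ⟨Sum.inr (Sum.inl i), rfl⟩)
  · rw [mul_comm]
    exact hQ.sumSq_mul (isSOS_iff_isSumSq.1 (hτ j))
      (inIQ_ineq (phiLow E1 E2 g G1 f) (psiLow E2 g G1 f) (Sum.inl j))

theorem isArchimedean_of_finite {σ : Type} [Fintype σ] {ι κ : Type*} [Fintype ι] [Fintype κ]
    {φ : ι → MvPolynomial σ ℝ} (ψ : κ → MvPolynomial σ ℝ)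
    (hfin : {x : σ → ℝ | ∀ i, eval x (φ i) = 0}.Finite) : IsArchimedean φ ψ := by
  refine ⟨∑ i, φ i * -φ i, inIQ_of_mem_span (Ideal.sum_mem _ fun i _ =>
    Ideal.mul_mem_right _ _ (Ideal.subset_span ⟨i, rfl⟩)), ?_⟩
  convert hfin.isCompact using 1
  ext x
  simp only [Set.mem_ofPred, map_sum, map_mul, map_neg]
  constructor
  · intro h
    have h0 : ∑ i, eval x (φ i) * eval x (φ i) = 0 := by
      refine le_antisymm ?_ (Finset.sum_nonneg fun i _ => mul_self_nonneg _)
      simpa [mul_neg] using h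
    rw [Finset.sum_eq_zero_iff_of_nonneg fun i _ => mul_self_nonneg _] at h0
    exact fun i => mul_self_eq_zero.1 (h0 i (Finset.mem_univ i))
  · intro h
    simp [h]

end

/-- Theorem 4.6: finite convergence, with flat truncation, of the Lasserre hierarchy for
the lower level minimization problem `min_{x ∈ X} F(x, y*)`. -/
theorem stmt11 {n m l1 : ℕ}
    (E1X E2X : Finset (Fin l1)) (hXu : E1X ∪ E2X = Finset.univ) (hXd : Disjoint E1X E2X)
    (g : Fin l1 → MvPolynomial (Fin n) ℝ)
    (G1 : Matrix (Fin l1) (Fin n ⊕ Fin l1) (MvPolynomial (Fin n) ℝ))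
    (hG1 : ∀ x : Fin n → ℝ, (Matrix.of fun i j => eval x (G1 i j)) * Gmat g x = 1)
    (F : MvPolynomial (Fin n ⊕ Fin m) ℝ) (ystar : Fin m → ℝ)
    -- the problem `min_{x ∈ X} F(x, y*)` has a minimizer
    (hmin : ∃ x0 ∈ SemiSet E1X E2X g, ∀ x ∈ SemiSet E1X E2X g,
      eval (Sum.elim x0 ystar) F ≤ eval (Sum.elim x ystar) F)
    -- Condition 4.4: (1) `IQ(g_eq, g_in)` archimedean, or (2) `φ_{y*} = 0` has finitely
    -- many real solutions, or (3) `IQ(φ_{y*}, ψ_{y*})` archimedean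
    (hcond :
      IsArchimedean (fun i : ↥E1X => g i.1) (fun i : ↥E2X => g i.1) ∨
      {x : Fin n → ℝ | ∀ idx, eval x (phiLow E1X E2X g G1 (Fsub F ystar) idx) = 0}.Finite ∨
      IsArchimedean (phiLow E1X E2X g G1 (Fsub F ystar)) (psiLow E2X g G1 (Fsub F ystar)))
    -- each minimizer is an isolated real solution of `φ_{y*}(x) = 0`
    (hiso : ∀ x0 ∈ SemiSet E1X E2X g,
      (∀ x ∈ SemiSet E1X E2X g, eval (Sum.elim x0 ystar) F ≤ eval (Sum.elim x ystar) F) →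
      (∀ idx, eval x0 (phiLow E1X E2X g G1 (Fsub F ystar) idx) = 0) ∧
      ∃ U : Set (Fin n → ℝ), IsOpen U ∧ x0 ∈ U ∧
        U ∩ {x | ∀ idx, eval x (phiLow E1X E2X g G1 (Fsub F ystar) idx) = 0} = {x0}) :
    ∃ k0 : ℕ, ∀ k ≥ k0,
      (∃ w : (Fin n →₀ ℕ) → ℝ,
        RelaxFeasible k (phiLow E1X E2X g G1 (Fsub F ystar)) (psiLow E2X g G1 (Fsub F ystar)) w ∧
        ∀ w' : (Fin n →₀ ℕ) → ℝ,
          RelaxFeasible k (phiLow E1X E2X g G1 (Fsub F ystar)) (psiLow E2X g G1 (Fsub F ystar)) w' →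
          riesz w (Fsub F ystar) ≤ riesz w' (Fsub F ystar)) ∧
      ∀ w : (Fin n →₀ ℕ) → ℝ,
        RelaxFeasible k (phiLow E1X E2X g G1 (Fsub F ystar)) (psiLow E2X g G1 (Fsub F ystar)) w →
        (∀ w' : (Fin n →₀ ℕ) → ℝ,
          RelaxFeasible k (phiLow E1X E2X g G1 (Fsub F ystar)) (psiLow E2X g G1 (Fsub F ystar)) w' →
          riesz w (Fsub F ystar) ≤ riesz w' (Fsub F ystar)) →
        ∃ t : ℕ, dLow E1X E2X g G1 (Fsub F ystar) ≤ t ∧ t ≤ k ∧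
          (momMat t w).rank = (momMat (t - dLow E1X E2X g G1 (Fsub F ystar)) w).rank := by
  obtain ⟨x0, hx0, hmin⟩ := hmin
  simp only [← eval_Fsub] at hmin hiso
  obtain ⟨hφ0, -⟩ := hiso x0 hx0 hmin
  obtain ⟨p, hp, hpf⟩ := exists_aeval_mem_span_phiLow hXu g G1 (Fsub F ystar)
  refine exists_forall_flat_truncation _ (v := eval x0 (Fsub F ystar))
    (fun x h1 h2 => hmin x (mem_semiSet h1 h2)) hφ0
    (psiLow_nonneg_of_isMin hXd hG1 hx0 hmin hφ0) rfl
    (fun x h1 h2 h3 => (hiso x (mem_semiSet h1 h2) fun y hy => h3.trans_le (hmin y hy)).2) ?_ hp hpf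
  rcases hcond with ⟨q, hq, hc⟩ | hfin | harch
  · exact ⟨q, hq.phiLow_psiLow, hc⟩
  · exact isArchimedean_of_finite _ hfin
  · exact harch
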